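/- Let G be a simple graph whose realization |G| has at least two points. Then the following are equivalent: (a) |G| is 7-arc connected; (b) |G| is n-arc connected for every n ∈ ℕ; (c) |G| is homeomorphic to one of the following nine spaces: the closed interval [0,1]; the half-open interval [0,1); the open interval (0,1); the circle S¹; the θ-curve (the union in ℝ² of the unit circle and the horizontal diameter); the figure-eight (the union in ℝ² of the circles of radius 1 centered at (−1,0) and (1,0)); the lollipop (the union in ℝ² of the unit circle and the segment from (1,0) to (2,0)); the lollipop with its free endpoint (2,0) removed; or the dumbbell (the union in ℝ² of the circles of radius 1 centered at (−2,0) and (2,0) and the segment from (−1,0) to (1,0)). -/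

import Mathlib

open Topology

noncomputable section

variable {V : Type*}

open Classical in
/-- The Dirac function marking a vertex: the point of `|G|` corresponding to vertex `v`. -/
noncomputable def vertexPoint (v : V) : V → ℝ := fun u => if u = v then 1 else 0

open Classical in
/-- The point of `|G|` lying on the edge `vw` at parameter `t` (measured from `v` towards `w`). -/
noncomputable def edgePoint (v w : V) (t : ℝ) : V → ℝ :=
  fun u => (if u = v then 1 - t else 0) + (if u = w then t else 0)

/-- The geometric realization `|G|` of a simple graph `G`, realized as the set of
formal convex combinations of adjacent pairs of vertices; each closed edge carries
its usual topology as a copy of `[0,1]`. -/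
def GraphRealization (G : SimpleGraph V) : Set (V → ℝ) :=
  {x | (∃ v, x = vertexPoint v) ∨
    ∃ v w t, G.Adj v w ∧ t ∈ Set.Icc (0 : ℝ) 1 ∧ x = edgePoint v w t}

/-- A subset of a topological space is an arc if it is homeomorphic to `[0,1]`. -/
def IsArc {X : Type*} [TopologicalSpace X] (A : Set X) : Prop :=
  Nonempty (↥A ≃ₜ ↥unitInterval)

/-- A space is `n`-arc connected if any at most `n` points lie on a common arc. -/
def NArcConn (X : Type*) [TopologicalSpace X] (n : ℕ) : Prop :=
  ∀ S : Finset X, S.card ≤ n → ∃ A : Set X, IsArc A ∧ ↑S ⊆ A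

/-- The unit circle in the plane. -/
def unitCircleSet : Set (ℝ × ℝ) := {p | p.1 ^ 2 + p.2 ^ 2 = 1}

/-- A subset of a topological space is a simple closed curve if homeomorphic to the circle. -/
def IsSimpleClosedCurve {X : Type*} [TopologicalSpace X] (C : Set X) : Prop :=
  Nonempty (↥C ≃ₜ ↥unitCircleSet)

/-- A space is `n`-circle connected if any at most `n` points lie on a common
simple closed curve. -/
def NCircleConn (X : Type*) [TopologicalSpace X] (n : ℕ) : Prop :=
  ∀ S : Finset X, S.card ≤ n → ∃ C : Set X, IsSimpleClosedCurve C ∧ ↑S ⊆ C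

/-- A space is `n`-strongly arc connected if any list of at most `n` points is contained
in an arc, the points appearing along the arc in the listed order. -/
def NStrongArcConn (X : Type*) [TopologicalSpace X] (n : ℕ) : Prop :=
  ∀ l : List X, l.length ≤ n →
    ∃ f : ↥unitInterval → X, Topology.IsEmbedding f ∧
      ∃ t : Fin l.length → ↥unitInterval, Monotone t ∧ ∀ i, f (t i) = l.get i

/-- A graph is `k`-connected if removing fewer than `k` vertices leaves it connected. -/
def KConnected (G : SimpleGraph V) (k : ℕ) : Prop :=
  ∀ S : Set V, S.encard < (k : ℕ∞) → (G.induce (Sᶜ : Set V)).Connected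

/-- A graph is cyclically connected if any two vertices lie on a common cycle. -/
def CyclicallyConnected (G : SimpleGraph V) : Prop :=
  ∀ v w : V, ∃ (u : V) (c : G.Walk u u), c.IsCycle ∧ v ∈ c.support ∧ w ∈ c.support

/-- The circle of radius `r` centered at `c` in the plane. -/
def circleAt (c : ℝ × ℝ) (r : ℝ) : Set (ℝ × ℝ) :=
  {p | (p.1 - c.1) ^ 2 + (p.2 - c.2) ^ 2 = r ^ 2}

/-- The horizontal segment at height `y` from abscissa `a` to `b`. -/
def hSeg (y a b : ℝ) : Set (ℝ × ℝ) := {p | p.2 = y ∧ a ≤ p.1 ∧ p.1 ≤ b}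

/-- The θ-curve: unit circle together with horizontal diameter. -/
def thetaSet : Set (ℝ × ℝ) := circleAt (0, 0) 1 ∪ hSeg 0 (-1) 1

/-- Figure-eight: two unit circles meeting at the origin. -/
def figureEightSet : Set (ℝ × ℝ) := circleAt (-1, 0) 1 ∪ circleAt (1, 0) 1

/-- Lollipop: unit circle with the segment from `(1,0)` to `(2,0)` attached. -/
def lollipopSet : Set (ℝ × ℝ) := circleAt (0, 0) 1 ∪ hSeg 0 1 2

/-- Lollipop with its free endpoint removed. -/
def openLollipopSet : Set (ℝ × ℝ) := lollipopSet \ {(2, 0)}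

/-- Dumbbell: two disjoint unit circles joined by a segment. -/
def dumbbellSet : Set (ℝ × ℝ) := circleAt (-2, 0) 1 ∪ circleAt (2, 0) 1 ∪ hSeg 0 (-1) 1

/-- Happy-face curve: two circles meeting at a point, joined by a further arc. -/
def happyFaceSet : Set (ℝ × ℝ) :=
  circleAt (-1, 0) 1 ∪ circleAt (1, 0) 1 ∪ {p | p.1 ^ 2 + p.2 ^ 2 = 4 ∧ p.2 ≤ 0}

/-- Baguette curve: two disjoint circles joined by two disjoint arcs. -/
def baguetteSet : Set (ℝ × ℝ) :=
  circleAt (-3, 0) 1 ∪ circleAt (3, 0) 1 ∪ hSeg 0 (-2) 2 ∪ hSeg 1 (-3) 3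

/-- A graph is a basic 4-ac graph iff its realization is homeomorphic to a circle,
a θ-curve, a happy-face curve or a baguette curve (this captures precisely the
subdivisions of those four graphs). -/
def IsBasicFourAC {W : Type*} (H : SimpleGraph W) : Prop :=
  Nonempty (↥(GraphRealization H) ≃ₜ ↥unitCircleSet) ∨
  Nonempty (↥(GraphRealization H) ≃ₜ ↥thetaSet) ∨
  Nonempty (↥(GraphRealization H) ≃ₜ ↥happyFaceSet) ∨
  Nonempty (↥(GraphRealization H) ≃ₜ ↥baguetteSet)

/-- A chain-graph decomposition of the connected graph `G`: links indexed by an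
interval `J` of `ℤ`, non-consecutive links are disjoint, consecutive links share
exactly one vertex. -/
structure IsChainGraph (G : SimpleGraph V) (J : Set ℤ) (L : ℤ → G.Subgraph) : Prop where
  connected : G.Connected
  ordConnected : J.OrdConnected
  nonempty : J.Nonempty
  cover : (⨆ i ∈ J, L i) = (⊤ : G.Subgraph)
  sep : ∀ i ∈ J, ∀ j ∈ J, i + 1 < j → (L i).verts ∩ (L j).verts = ∅
  link : ∀ i ∈ J, i + 1 ∈ J → ∃ v, (L i).verts ∩ (L (i + 1)).verts = {v}

/-- A cut-vertex: a vertex whose removal disconnects the graph. -/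
def IsCutVertex (G : SimpleGraph V) (v : V) : Prop :=
  ¬ (G.induce ({v}ᶜ : Set V)).Connected

/-- A block: a maximal 2-connected subgraph. -/
def IsBlock (G : SimpleGraph V) (H : G.Subgraph) : Prop :=
  KConnected H.coe 2 ∧ ∀ H' : G.Subgraph, H ≤ H' → KConnected H'.coe 2 → H' = H

/-- The block graph of `G`: the bipartite graph on cut-vertices and blocks, a cut-vertex
being adjacent to the blocks containing it. -/
def BlockGraph (G : SimpleGraph V) :
    SimpleGraph ({v : V // IsCutVertex G v} ⊕ {H : G.Subgraph // IsBlock G H}) :=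
  SimpleGraph.fromRel fun a b =>
    ∃ (c : {v : V // IsCutVertex G v}) (B : {H : G.Subgraph // IsBlock G H}),
      a = Sum.inl c ∧ b = Sum.inr B ∧ (c : V) ∈ (B : G.Subgraph).verts

/-- An `A`–`B` path: a path starting in `A`, ending in `B` and meeting `A ∪ B` only
in these two endvertices. -/
structure ABPath (G : SimpleGraph V) (A B : Set V) where
  first : V
  last : V
  walk : G.Walk first last
  isPath : walk.IsPath
  firstA : first ∈ A
  lastB : last ∈ B
  meetA : ∀ v ∈ walk.support, v ∈ A → v = first
  meetB : ∀ v ∈ walk.support, v ∈ B → v = last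

/-- A family of pairwise vertex-disjoint paths. -/
def PathFamilyDisjoint {G : SimpleGraph V} {A B : Set V} {k : ℕ}
    (P : Fin k → ABPath G A B) : Prop :=
  ∀ i j, i ≠ j → ∀ v, v ∈ (P i).walk.support → v ∉ (P j).walk.support

/-- The set of vertices used by a family of paths. -/
def familySupport {G : SimpleGraph V} {A B : Set V} {k : ℕ}
    (P : Fin k → ABPath G A B) : Set V :=
  {v | ∃ i, v ∈ (P i).walk.support}

/-- The set of edges used by a family of paths. -/
def familyEdges {G : SimpleGraph V} {A B : Set V} {k : ℕ}
    (P : Fin k → ABPath G A B) : Set (Sym2 V) :=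
  {e | ∃ i, e ∈ (P i).walk.edges}

/-- A walk `W` (with no repeated edges) is alternating with respect to the disjoint
path family `P`: it starts in `A` off the paths; repeated vertices lie on paths of the
family; upon hitting a path by a new edge it follows that path backwards for at least
one edge; and it traverses edges of paths of the family only backwards. -/
structure IsAlternatingWalk {G : SimpleGraph V} {A B : Set V} {k : ℕ}
    (P : Fin k → ABPath G A B) {x y : V} (W : G.Walk x y) : Prop where
  trail : W.IsTrail
  startA : x ∈ A
  startOff : x ∉ familySupport P
  repeats : ∀ v, List.Duplicate v W.support → v ∈ familySupport P
  follows : ∀ (i : ℕ) (hi : i < W.darts.length) (j : Fin k),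
      (W.darts.get ⟨i, hi⟩).snd ∈ (P j).walk.support →
      (W.darts.get ⟨i, hi⟩).edge ∉ (P j).walk.edges →
      ∃ h : i + 1 < W.darts.length, (W.darts.get ⟨i + 1, h⟩).symm ∈ (P j).walk.darts
  backward : ∀ d ∈ W.darts, ∀ j : Fin k,
      d.edge ∈ (P j).walk.edges → d.symm ∈ (P j).walk.darts

end

section EdgePoints

variable {V : Type*}

lemma edgePoint_zero (v w : V) : edgePoint v w 0 = vertexPoint v := by
  funext u; simp [edgePoint, vertexPoint]

lemma edgePoint_symm (v w : V) (t : ℝ) : edgePoint v w t = edgePoint w v (1 - t) := by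
  funext u; simp only [edgePoint, sub_sub_cancel]; ring

lemma edgePoint_one (v w : V) : edgePoint v w 1 = vertexPoint w := by
  rw [edgePoint_symm, sub_self, edgePoint_zero]

lemma edgePoint_left {v w : V} (h : v ≠ w) (t : ℝ) : edgePoint v w t v = 1 - t := by
  simp [edgePoint, h]

lemma edgePoint_right {v w : V} (h : v ≠ w) (t : ℝ) : edgePoint v w t w = t := by
  simp [edgePoint, h.symm]

lemma edgePoint_other {v w u : V} (hv : u ≠ v) (hw : u ≠ w) (t : ℝ) : edgePoint v w t u = 0 := by
  simp [edgePoint, hv, hw]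

lemma vertexPoint_self (v : V) : vertexPoint v v = 1 := by simp [vertexPoint]

lemma vertexPoint_of_ne {u v : V} (h : u ≠ v) : vertexPoint v u = 0 := by simp [vertexPoint, h]

lemma vertexPoint_injective : Function.Injective (vertexPoint : V → V → ℝ) := by
  intro v w h
  by_contra hne
  have := congrFun h v
  rw [vertexPoint_self, vertexPoint_of_ne hne] at this
  exact one_ne_zero this

lemma continuous_edgePoint (v w : V) : Continuous (edgePoint v w) := by
  refine continuous_pi fun u => ?_
  unfold edgePoint
  split_ifs <;> fun_prop

lemma eq_or_eq_of_edgePoint_pos {v w u : V} {t : ℝ} (h : 0 < edgePoint v w t u) :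
    u = v ∨ u = w := by
  by_contra! hc
  rw [edgePoint_other hc.1 hc.2] at h
  exact lt_irrefl _ h

lemma eq_of_vertexPoint_pos {v u : V} (h : 0 < vertexPoint v u) : u = v := by
  by_contra hc
  rw [vertexPoint_of_ne hc] at h
  exact lt_irrefl _ h

end EdgePoints

namespace GraphRealization

variable {V : Type*} {G : SimpleGraph V} {x : V → ℝ}

lemma edgePoint_mem {v w : V} {t : ℝ} (h : G.Adj v w) (ht : t ∈ Set.Icc (0 : ℝ) 1) :
    edgePoint v w t ∈ GraphRealization G := Or.inr ⟨v, w, t, h, ht, rfl⟩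

lemma vertexPoint_mem (v : V) : vertexPoint v ∈ GraphRealization G := Or.inl ⟨v, rfl⟩

lemma exists_pos (hx : x ∈ GraphRealization G) : ∃ u, 0 < x u := by
  obtain ⟨v, rfl⟩ | ⟨v, w, t, h, ht, rfl⟩ := hx
  · exact ⟨v, by rw [vertexPoint_self]; exact one_pos⟩
  · rcases ht.1.eq_or_lt with h0 | h0
    · exact ⟨v, by rw [edgePoint_left h.ne]; linarith⟩
    · exact ⟨w, by rw [edgePoint_right h.ne]; exact h0⟩

lemma eq_edgePoint_of_pos (hx : x ∈ GraphRealization G) {v w : V} (hvw : v ≠ w) (hv : 0 < x v)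
    (hw : 0 < x w) : G.Adj v w ∧ x w ∈ Set.Ioo (0 : ℝ) 1 ∧ x = edgePoint v w (x w) := by
  obtain ⟨u, rfl⟩ | ⟨p, q, t, h, ht, rfl⟩ := hx
  · exact absurd ((eq_of_vertexPoint_pos hv).trans (eq_of_vertexPoint_pos hw).symm) hvw
  · rcases eq_or_eq_of_edgePoint_pos hv with rfl | rfl <;>
      rcases eq_or_eq_of_edgePoint_pos hw with rfl | rfl
    · exact absurd rfl hvw
    · rw [edgePoint_right hvw] at *
      rw [edgePoint_left hvw] at *
      exact ⟨h, ⟨hw, by linarith⟩, rfl⟩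
    · rw [edgePoint_left h.ne] at *
      rw [edgePoint_right h.ne] at *
      exact ⟨h.symm, ⟨hw, by linarith⟩, edgePoint_symm _ _ _⟩
    · exact absurd rfl hvw

lemma not_three_pos (hx : x ∈ GraphRealization G) {v w u : V} (hvw : v ≠ w) (hvu : v ≠ u)
    (hwu : w ≠ u) (hv : 0 < x v) (hw : 0 < x w) (hu : 0 < x u) : False := by
  obtain ⟨-, -, h⟩ := eq_edgePoint_of_pos hx hvw hv hw
  rw [h] at hu
  rcases eq_or_eq_of_edgePoint_pos hu with h | h
  · exact hvu h.symm
  · exact hwu h.symm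

lemma eq_vertexPoint_or_of_half_lt (hx : x ∈ GraphRealization G) {v : V} (hv : 1 / 2 < x v) :
    x = vertexPoint v ∨
      ∃ w, G.Adj v w ∧ x w ∈ Set.Ioo (0 : ℝ) (1 / 2) ∧ x = edgePoint v w (x w) := by
  by_cases hex : ∃ w, w ≠ v ∧ 0 < x w
  · obtain ⟨w, hwv, hw⟩ := hex
    obtain ⟨h, h1, h2⟩ := eq_edgePoint_of_pos hx hwv.symm (by linarith) hw
    refine Or.inr ⟨w, h, ⟨h1.1, ?_⟩, h2⟩
    rw [h2, edgePoint_left hwv.symm] at hv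
    linarith
  · push Not at hex
    left
    obtain ⟨u, rfl⟩ | ⟨p, q, t, h, ht, rfl⟩ := hx
    · rw [eq_of_vertexPoint_pos (by linarith : 0 < vertexPoint u v)]
    · rcases eq_or_eq_of_edgePoint_pos (by linarith : 0 < edgePoint p q t v) with rfl | rfl
      · have := hex q h.ne'
        rw [edgePoint_right h.ne] at this
        rw [le_antisymm this ht.1, edgePoint_zero]
      · have := hex p h.ne
        rw [edgePoint_left h.ne] at this
        rw [show t = 1 by linarith [ht.2], edgePoint_one]

end GraphRealization

/-- The midpoint of an edge, as a point of the realization. -/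
noncomputable def edgeMid {V : Type*} (e : Sym2 V) : V → ℝ :=
  open Classical in fun u => if u ∈ e then 1 / 2 else 0

section EdgeMid

variable {V : Type*}

lemma edgeMid_mk {v w : V} (h : v ≠ w) : edgeMid s(v, w) = edgePoint v w (1 / 2) := by
  funext u
  by_cases hv : u = v
  · subst hv; rw [edgePoint_left h]; simp [edgeMid]; norm_num
  · by_cases hw : u = w
    · subst hw; rw [edgePoint_right h]; simp [edgeMid]
    · rw [edgePoint_other hv hw]; simp [edgeMid, hv, hw]

lemma edgeMid_injective : Function.Injective (edgeMid : Sym2 V → V → ℝ) := by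
  intro e f h
  ext u
  have := congrFun h u
  unfold edgeMid at this
  split_ifs at this <;> simp_all

lemma edgeMid_ne_vertexPoint (e : Sym2 V) (v : V) : edgeMid e ≠ vertexPoint v := by
  intro h
  have := congrFun h v
  rw [vertexPoint_self] at this
  unfold edgeMid at this
  split_ifs at this <;> norm_num at this

lemma edgePoint_eq_edgeMid {v w : V} (h : v ≠ w) {t : ℝ} (ht : t ∈ Set.Ioo (0 : ℝ) 1) {e : Sym2 V}
    (he : edgePoint v w t = edgeMid e) : t = 1 / 2 ∧ s(v, w) = e := by
  have hw := congrFun he w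
  rw [edgePoint_right h] at hw
  have : t = 1 / 2 := by
    unfold edgeMid at hw
    split_ifs at hw
    · exact hw
    · exact absurd hw ht.1.ne'
  refine ⟨this, edgeMid_injective ?_⟩
  rw [edgeMid_mk h, ← he, this]

end EdgeMid

/-- The combinatorial trace of an arc through the midpoints of the edges in `F`: the relation
`U v w` says that the arc covers the half-edge at `v` towards `w`. -/
structure GermSystem {V : Type*} (G : SimpleGraph V) (F : Set (Sym2 V)) (U : V → V → Prop) :
    Prop where
  adj : ∀ v w, U v w → G.Adj v w
  two : ∀ v w, U v w → ∃ w', w' ≠ w ∧ U v w' ∧ ∀ u, U v u → u = w ∨ u = w'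
  symm : ∀ v w, s(v, w) ∉ F → U v w → U w v
  missed : ∃ p q : V × V, ∀ v w, s(v, w) ∈ F → ¬ U v w → (v, w) = p ∨ (v, w) = q
  finite : {p : V × V | U p.1 p.2}.Finite

lemma image_mem_nhds_of_injOn {ψ : ℝ → ℝ} {c d s : ℝ} (hs : s ∈ Set.Ioo c d)
    (hc : ContinuousOn ψ (Set.Icc c d)) (hi : Set.InjOn ψ (Set.Icc c d)) :
    ψ '' Set.Icc c d ∈ 𝓝 (ψ s) := by
  have hcd := (hs.1.trans hs.2).le
  have hs' : s ∈ Set.Icc c d := ⟨hs.1.le, hs.2.le⟩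
  rcases hc.strictMonoOn_of_injOn_Icc' hcd hi with h | h
  · exact Filter.mem_of_superset (Icc_mem_nhds (h ⟨le_rfl, hcd⟩ hs' hs.1) (h hs' ⟨hcd, le_rfl⟩ hs.2))
      (intermediate_value_Icc hcd hc)
  · exact Filter.mem_of_superset (Icc_mem_nhds (h hs' ⟨hcd, le_rfl⟩ hs.2) (h ⟨le_rfl, hcd⟩ hs' hs.1))
      (intermediate_value_Icc' hcd hc)

/-- A parametrized arc in the realization of `G` joining the midpoints of two edges. -/
structure MidArc {V : Type*} (G : SimpleGraph V) (γ : ℝ → V → ℝ) (a b : ℝ) : Prop where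
  lt : a < b
  cont : ContinuousOn γ (Set.Icc a b)
  inj : Set.InjOn γ (Set.Icc a b)
  mem : ∀ s ∈ Set.Icc a b, γ s ∈ GraphRealization G
  left : ∃ e ∈ G.edgeSet, γ a = edgeMid e
  right : ∃ e ∈ G.edgeSet, γ b = edgeMid e

namespace MidArc

variable {V : Type*} {G : SimpleGraph V} {γ : ℝ → V → ℝ} {a b : ℝ}

lemma isClosed_image (h : MidArc G γ a b) : IsClosed (γ '' Set.Icc a b) :=
  (isCompact_Icc.image_of_continuousOn h.cont).isClosed

lemma exists_nhds (h : MidArc G γ a b) {s : ℝ} (hs : s ∈ Set.Ioo a b) {O : Set (V → ℝ)}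
    (hO : IsOpen O) (hsO : γ s ∈ O) :
    ∃ δ > 0, Set.Icc (s - δ) (s + δ) ⊆ Set.Icc a b ∧
      ∀ s' ∈ Set.Icc (s - δ) (s + δ), γ s' ∈ O := by
  have h1 : ∀ᶠ s' in 𝓝 s, γ s' ∈ O :=
    (h.cont.continuousAt (Icc_mem_nhds hs.1 hs.2)).eventually (hO.mem_nhds hsO)
  obtain ⟨δ, hδ, hb⟩ := Metric.eventually_nhds_iff.1 (h1.and (Icc_mem_nhds hs.1 hs.2))
  refine ⟨δ / 2, by positivity, fun s' hs' => (hb ?_).2, fun s' hs' => (hb ?_).1⟩ <;>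
  · rw [Real.dist_eq, abs_lt]
    constructor <;> linarith [hs'.1, hs'.2]

lemma eventually_mem_image (h : MidArc G γ a b) {v w : V} (hvw : G.Adj v w) {s t₀ : ℝ}
    (hs : s ∈ Set.Ioo a b) (ht₀ : t₀ ∈ Set.Ioo (0 : ℝ) 1) (he : γ s = edgePoint v w t₀) :
    ∀ᶠ t in 𝓝 t₀, edgePoint v w t ∈ γ '' Set.Icc a b := by
  obtain ⟨δ, hδ, hsub, hO⟩ := h.exists_nhds hs (O := {x | 0 < x v ∧ 0 < x w})
    ((isOpen_lt continuous_const (continuous_apply v)).inter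
      (isOpen_lt continuous_const (continuous_apply w)))
    (by simp only [Set.mem_ofPred_eq, he, edgePoint_left hvw.ne, edgePoint_right hvw.ne]
        exact ⟨by linarith [ht₀.2], ht₀.1⟩)
  have hrep : ∀ s' ∈ Set.Icc (s - δ) (s + δ), γ s' = edgePoint v w (γ s' w) := fun s' hs' =>
    (GraphRealization.eq_edgePoint_of_pos (h.mem s' (hsub hs')) hvw.ne (hO s' hs').1
      (hO s' hs').2).2.2
  have hc : ContinuousOn (fun s' => γ s' w) (Set.Icc (s - δ) (s + δ)) :=
    (continuous_apply w).comp_continuousOn (h.cont.mono hsub)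
  have hi : Set.InjOn (fun s' => γ s' w) (Set.Icc (s - δ) (s + δ)) := by
    intro p hp q hq hpq
    apply h.inj (hsub hp) (hsub hq)
    rw [hrep p hp, hrep q hq]
    exact congrArg _ hpq
  have := image_mem_nhds_of_injOn (s := s) ⟨by linarith, by linarith⟩ hc hi
  simp only [he, edgePoint_right hvw.ne] at this
  filter_upwards [this] with t ht
  obtain ⟨s', hs', rfl⟩ := ht
  exact ⟨s', hsub hs', hrep s' hs'⟩

lemma subset_image (h : MidArc G γ a b) {v w : V} (hvw : G.Adj v w) {α β t₀ : ℝ}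
    (hα : 0 ≤ α) (hβ : β ≤ 1) (ht₀ : t₀ ∈ Set.Ioo α β)
    (hmem : edgePoint v w t₀ ∈ γ '' Set.Icc a b)
    (ha : ∀ t ∈ Set.Ioo α β, γ a ≠ edgePoint v w t)
    (hb : ∀ t ∈ Set.Ioo α β, γ b ≠ edgePoint v w t) :
    ∀ t ∈ Set.Ioo α β, edgePoint v w t ∈ γ '' Set.Icc a b := by
  set K : Set ℝ := Set.Ioo α β ∩ edgePoint v w ⁻¹' (γ '' Set.Icc a b) with hK
  have hop : IsOpen K := by
    rw [isOpen_iff_mem_nhds]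
    rintro t ⟨ht, s, hs, hst⟩
    have hs' : s ∈ Set.Ioo a b := by
      refine ⟨lt_of_le_of_ne hs.1 ?_, lt_of_le_of_ne hs.2 ?_⟩
      · rintro rfl; exact ha t ht hst
      · rintro rfl; exact hb t ht hst
    exact Filter.inter_mem (Ioo_mem_nhds ht.1 ht.2)
      (h.eventually_mem_image hvw hs' ⟨by linarith [ht.1], by linarith [ht.2]⟩ hst)
  have := isPreconnected_Ioo.subset_of_closure_inter_subset hop ⟨t₀, ht₀, ht₀, hmem⟩ (by
    rintro t ⟨ht, ht'⟩
    refine ⟨ht', ?_⟩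
    exact (closure_minimal Set.inter_subset_right
      (h.isClosed_image.preimage (continuous_edgePoint v w))) ht)
  exact fun t ht => (this ht).2

/-- The half-edge at `v` towards `w` is covered by the arc. -/
def Covers (G : SimpleGraph V) (γ : ℝ → V → ℝ) (a b : ℝ) (v w : V) : Prop :=
  G.Adj v w ∧ ∃ t ∈ Set.Ioo (0 : ℝ) (1 / 2), edgePoint v w t ∈ γ '' Set.Icc a b

lemma covers_all (h : MidArc G γ a b) {v w : V} (hU : Covers G γ a b v w) :
    ∀ t ∈ Set.Ioo (0 : ℝ) (1 / 2), edgePoint v w t ∈ γ '' Set.Icc a b := by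
  obtain ⟨hvw, t₀, ht₀, hmem⟩ := hU
  have key : ∀ e : Sym2 V, ∀ t ∈ Set.Ioo (0 : ℝ) (1 / 2), edgeMid e ≠ edgePoint v w t :=
    fun e t ht he => ht.2.ne (edgePoint_eq_edgeMid hvw.ne ⟨ht.1, by linarith [ht.2]⟩ he.symm).1
  refine h.subset_image hvw le_rfl (by norm_num) ht₀ hmem ?_ ?_
  · obtain ⟨e, -, he⟩ := h.left; rw [he]; exact key e
  · obtain ⟨e, -, he⟩ := h.right; rw [he]; exact key e

lemma mem_Ioo_of_vertexPoint (h : MidArc G γ a b) {v : V} {s : ℝ} (hs : s ∈ Set.Icc a b)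
    (he : γ s = vertexPoint v) : s ∈ Set.Ioo a b := by
  refine ⟨lt_of_le_of_ne hs.1 ?_, lt_of_le_of_ne hs.2 ?_⟩
  · rintro rfl
    obtain ⟨e, -, h⟩ := h.left
    exact edgeMid_ne_vertexPoint e v (h.symm.trans he)
  · rintro rfl
    obtain ⟨e, -, h⟩ := h.right
    exact edgeMid_ne_vertexPoint e v (h.symm.trans he)

lemma exists_vertex_of_covers (h : MidArc G γ a b) {v w : V} (hU : Covers G γ a b v w) :
    ∃ s ∈ Set.Ioo a b, γ s = vertexPoint v := by
  have hcl : IsClosed (edgePoint v w ⁻¹' (γ '' Set.Icc a b)) :=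
    h.isClosed_image.preimage (continuous_edgePoint v w)
  have h0 : (0 : ℝ) ∈ closure (Set.Ioo (0 : ℝ) (1 / 2)) := by
    rw [closure_Ioo (by norm_num)]; constructor <;> norm_num
  have := closure_minimal (h.covers_all hU) hcl h0
  obtain ⟨s, hs, hs'⟩ := this
  rw [edgePoint_zero] at hs'
  exact ⟨s, h.mem_Ioo_of_vertexPoint hs hs', hs'⟩

lemma exists_direction (h : MidArc G γ a b) {v : V} {c d : ℝ} (hcd : c < d)
    (hsub : Set.Ioo c d ⊆ Set.Icc a b) (hhalf : ∀ s ∈ Set.Ioo c d, 1 / 2 < γ s v)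
    (hne : ∀ s ∈ Set.Ioo c d, γ s ≠ vertexPoint v) :
    ∃ w, G.Adj v w ∧ ∀ s ∈ Set.Ioo c d, γ s w ∈ Set.Ioo (0 : ℝ) (1 / 2) ∧
      γ s = edgePoint v w (γ s w) := by
  have hex : ∀ s ∈ Set.Ioo c d, ∃ w, G.Adj v w ∧ γ s w ∈ Set.Ioo (0 : ℝ) (1 / 2) ∧
      γ s = edgePoint v w (γ s w) := fun s hs =>
    (GraphRealization.eq_vertexPoint_or_of_half_lt (h.mem s (hsub hs)) (hhalf s hs)).resolve_left
      (hne s hs)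
  obtain ⟨s₀, hs₀⟩ : (Set.Ioo c d).Nonempty := Set.nonempty_Ioo.2 hcd
  obtain ⟨w, hvw, hw, -⟩ := hex s₀ hs₀
  refine ⟨w, hvw, fun s hs => ?_⟩
  obtain ⟨u, hvu, hu, hu'⟩ := hex s hs
  suffices u = w by subst this; exact ⟨hu, hu'⟩
  by_contra huw
  have hpre : IsPreconnected (γ '' Set.Ioo c d) :=
    isPreconnected_Ioo.image _ (h.cont.mono hsub)
  have ho : ∀ u : V, IsOpen {x : V → ℝ | 0 < x u} := fun u =>
    isOpen_lt continuous_const (continuous_apply u)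
  obtain ⟨x, ⟨r, hr, rfl⟩, hx1, hx2⟩ := hpre {x | 0 < x w} (⋃ u ∈ {u | u ≠ w ∧ u ≠ v}, {x | 0 < x u})
    (ho w) (isOpen_biUnion fun u _ => ho u) (by
      rintro _ ⟨r, hr, rfl⟩
      obtain ⟨z, hvz, hz, -⟩ := hex r hr
      by_cases hzw : z = w
      · subst hzw; exact Or.inl hz.1
      · exact Or.inr (Set.mem_biUnion (show z ∈ {u | u ≠ w ∧ u ≠ v} from ⟨hzw, hvz.ne'⟩) hz.1))
    ⟨_, ⟨s₀, hs₀, rfl⟩, hw.1⟩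
    ⟨_, ⟨s, hs, rfl⟩, Set.mem_biUnion (show u ∈ {u | u ≠ w ∧ u ≠ v} from ⟨huw, hvu.ne'⟩) hu.1⟩
  obtain ⟨z, ⟨hzw, hzv⟩, hz⟩ := Set.mem_iUnion₂.1 hx2
  exact GraphRealization.not_three_pos (h.mem r (hsub hr)) hvw.ne hzv.symm hzw.symm
    (by linarith [hhalf r hr]) hx1 hz

lemma exists_two_covers (h : MidArc G γ a b) {v : V} {s : ℝ} (hs : s ∈ Set.Ioo a b)
    (hv : γ s = vertexPoint v) :
    ∃ w₁ w₂, w₁ ≠ w₂ ∧ Covers G γ a b v w₁ ∧ Covers G γ a b v w₂ ∧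
      ∀ u, Covers G γ a b v u → u = w₁ ∨ u = w₂ := by
  obtain ⟨δ, hδ, hsub, hO⟩ := h.exists_nhds hs (O := {x | 1 / 2 < x v})
    (isOpen_lt continuous_const (continuous_apply v))
    (by simp only [Set.mem_ofPred_eq, hv, vertexPoint_self]; norm_num)
  have hss : s ∈ Set.Icc a b := ⟨hs.1.le, hs.2.le⟩
  have hne : ∀ s' ∈ Set.Icc (s - δ) (s + δ), s' ≠ s → γ s' ≠ vertexPoint v := fun s' hs' hn he =>
    hn (h.inj (hsub hs') hss (he.trans hv.symm))
  have hl : ∀ r ∈ Set.Ioo (s - δ) s, r ∈ Set.Icc (s - δ) (s + δ) := fun r hr =>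
    ⟨hr.1.le, by linarith [hr.2]⟩
  have hr : ∀ r ∈ Set.Ioo s (s + δ), r ∈ Set.Icc (s - δ) (s + δ) := fun r hr =>
    ⟨by linarith [hr.1], hr.2.le⟩
  obtain ⟨w₁, h1, h1'⟩ := h.exists_direction (v := v) (c := s - δ) (d := s) (by linarith)
    (fun r hr => hsub (hl r hr)) (fun r hr => hO r (hl r hr))
    (fun r hr => hne r (hl r hr) hr.2.ne)
  obtain ⟨w₂, h2, h2'⟩ := h.exists_direction (v := v) (c := s) (d := s + δ) (by linarith)
    (fun r hp => hsub (hr r hp)) (fun r hp => hO r (hr r hp))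
    (fun r hp => hne r (hr r hp) hp.1.ne')
  have hlm : s - δ / 2 ∈ Set.Ioo (s - δ) s := ⟨by linarith, by linarith⟩
  have hrm : s + δ / 2 ∈ Set.Ioo s (s + δ) := ⟨by linarith, by linarith⟩
  refine ⟨w₁, w₂, ?_, ⟨h1, _, (h1' _ hlm).1, _, hsub (hl _ hlm), (h1' _ hlm).2⟩,
    ⟨h2, _, (h2' _ hrm).1, _, hsub (hr _ hrm), (h2' _ hrm).2⟩, ?_⟩
  · rintro rfl
    have hsub2 : Set.Icc (s - δ / 2) (s + δ / 2) ⊆ Set.Icc a b :=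
      fun r hr => hsub ⟨by linarith [hr.1], by linarith [hr.2]⟩
    have hs0 : γ s w₁ = 0 := by rw [hv, vertexPoint_of_ne h1.ne']
    have hrep : ∀ r ∈ Set.Icc (s - δ / 2) (s + δ / 2), γ r = edgePoint v w₁ (γ r w₁) := by
      intro r hr
      rcases lt_trichotomy r s with hrs | rfl | hrs
      · exact (h1' r ⟨by linarith [hr.1], hrs⟩).2
      · rw [hs0, edgePoint_zero, hv]
      · exact (h2' r ⟨hrs, by linarith [hr.2]⟩).2
    have hc : ContinuousOn (fun s' => γ s' w₁) (Set.Icc (s - δ / 2) (s + δ / 2)) :=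
      (continuous_apply w₁).comp_continuousOn (h.cont.mono hsub2)
    have hi : Set.InjOn (fun s' => γ s' w₁) (Set.Icc (s - δ / 2) (s + δ / 2)) := by
      intro p hp q hq hpq
      apply h.inj (hsub2 hp) (hsub2 hq)
      rw [hrep p hp, hrep q hq]
      exact congrArg _ hpq
    have e1 := (h1' _ hlm).1.1
    have e2 := (h2' _ hrm).1.1
    have m1 : s - δ / 2 ∈ Set.Icc (s - δ / 2) (s + δ / 2) := ⟨le_rfl, by linarith⟩
    have m2 : s ∈ Set.Icc (s - δ / 2) (s + δ / 2) := ⟨by linarith, by linarith⟩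
    have m3 : s + δ / 2 ∈ Set.Icc (s - δ / 2) (s + δ / 2) := ⟨by linarith, le_rfl⟩
    rcases hc.strictMonoOn_of_injOn_Icc' (by linarith) hi with hm | hm
    · have := hm m1 m2 (by linarith)
      simp only [hs0] at this
      linarith
    · have := hm m2 m3 (by linarith)
      simp only [hs0] at this
      linarith
  · intro u hu
    set C : Set (V → ℝ) := γ '' (Set.Icc a b \ Set.Ioo (s - δ) (s + δ)) with hC
    have hCc : IsClosed C := ((isCompact_Icc.diff isOpen_Ioo).image_of_continuousOn
      (h.cont.mono Set.sdiff_subset)).isClosed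
    have hvC : vertexPoint v ∉ C := by
      rintro ⟨r, ⟨hr, hr'⟩, he⟩
      rw [h.inj hr hss (he.trans hv.symm)] at hr'
      exact hr' ⟨by linarith, by linarith⟩
    have hev : ∀ᶠ t in 𝓝[>] (0 : ℝ), edgePoint v u t ∉ C := by
      apply nhdsWithin_le_nhds
      apply (continuous_edgePoint v u).continuousAt.eventually (hCc.isOpen_compl.mem_nhds _)
      rw [edgePoint_zero]; exact hvC
    obtain ⟨t, htC, ht⟩ := (hev.and (Ioo_mem_nhdsGT (by norm_num : (0 : ℝ) < 1 / 2))).exists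
    obtain ⟨r, hr, hrt⟩ := h.covers_all hu t ht
    have hr' : r ∈ Set.Ioo (s - δ) (s + δ) := by
      by_contra hcon
      exact htC ⟨r, ⟨hr, hcon⟩, hrt⟩
    have hpos : 0 < γ r u := by rw [hrt, edgePoint_right hu.1.ne]; exact ht.1
    rcases lt_trichotomy r s with hrs | rfl | hrs
    · rw [(h1' r ⟨hr'.1, hrs⟩).2] at hpos
      exact Or.inl ((eq_or_eq_of_edgePoint_pos hpos).resolve_left hu.1.ne')
    · rw [hv, vertexPoint_of_ne hu.1.ne'] at hpos
      exact absurd hpos (lt_irrefl _)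
    · rw [(h2' r ⟨hrs, hr'.2⟩).2] at hpos
      exact Or.inr ((eq_or_eq_of_edgePoint_pos hpos).resolve_left hu.1.ne')

lemma finite_vertices (h : MidArc G γ a b) : {v : V | vertexPoint v ∈ γ '' Set.Icc a b}.Finite := by
  obtain ⟨T, hT⟩ := (isCompact_Icc.image_of_continuousOn h.cont).elim_finite_subcover
    (fun u : V => {x : V → ℝ | 0 < x u})
    (fun u => isOpen_lt continuous_const (continuous_apply u)) (by
      rintro _ ⟨s, hs, rfl⟩
      exact Set.mem_iUnion.2 (GraphRealization.exists_pos (h.mem s hs)))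
  refine T.finite_toSet.subset fun v hv => ?_
  obtain ⟨u, hu, hu'⟩ := Set.mem_iUnion₂.1 (hT hv)
  rw [← eq_of_vertexPoint_pos hu']
  exact hu

/-- The covered half-edges at the midpoint of an edge. -/
lemma missed_end (h : MidArc G γ a b) {e : Sym2 V} (he : e ∈ G.edgeSet)
    (hm : edgeMid e ∈ γ '' Set.Icc a b) :
    ∃ p : V × V, ∀ v w, s(v, w) = e → ¬ Covers G γ a b v w → (v, w) = p := by
  induction e using Sym2.ind with
  | _ x y =>
  have hxy : G.Adj x y := he
  suffices hc : Covers G γ a b x y ∨ Covers G γ a b y x by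
    rcases hc with hc | hc
    · refine ⟨(y, x), fun v w hvw hn => ?_⟩
      rcases Sym2.eq_iff.1 hvw with ⟨rfl, rfl⟩ | ⟨rfl, rfl⟩
      · exact absurd hc hn
      · rfl
    · refine ⟨(x, y), fun v w hvw hn => ?_⟩
      rcases Sym2.eq_iff.1 hvw with ⟨rfl, rfl⟩ | ⟨rfl, rfl⟩
      · rfl
      · exact absurd hc hn
  obtain ⟨s, hs, hse⟩ := hm
  rw [edgeMid_mk hxy.ne] at hse
  -- nearby parameters stay in the open edge
  obtain ⟨r, hr, hrs, hrx, hry⟩ : ∃ r ∈ Set.Icc a b, r ≠ s ∧ 0 < γ r x ∧ 0 < γ r y := by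
    have hev : ∀ᶠ r in 𝓝[Set.Icc a b] s, 0 < γ r x ∧ 0 < γ r y :=
      (h.cont s hs).eventually (((isOpen_lt continuous_const (continuous_apply x)).inter
      (isOpen_lt continuous_const (continuous_apply y))).mem_nhds
        (by simp only [Set.mem_inter_iff, Set.mem_ofPred_eq, hse, edgePoint_left hxy.ne,
              edgePoint_right hxy.ne]
            norm_num))
    obtain ⟨δ, hδ, hball⟩ := Metric.mem_nhdsWithin_iff.1 hev
    rcases eq_or_lt_of_le hs.2 with hsb | hsb
    · refine ⟨max a (s - δ / 2), ⟨le_max_left _ _, max_le h.lt.le (by linarith)⟩, ?_, ?_⟩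
      · have : max a (s - δ / 2) < s := max_lt (hsb ▸ h.lt) (by linarith)
        exact this.ne
      · refine hball ⟨?_, ⟨le_max_left _ _, max_le h.lt.le (by linarith)⟩⟩
        rw [Metric.mem_ball, Real.dist_eq, abs_lt]
        exact ⟨by linarith [le_max_right a (s - δ / 2)],
          by linarith [max_le hs.1 (by linarith : s - δ / 2 ≤ s)]⟩
    · refine ⟨min b (s + δ / 2), ⟨le_min h.lt.le (by linarith [hs.1]), min_le_left _ _⟩, ?_, ?_⟩
      · have : s < min b (s + δ / 2) := lt_min hsb (by linarith)
        exact this.ne'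
      · refine hball ⟨?_, ⟨le_min h.lt.le (by linarith [hs.1]), min_le_left _ _⟩⟩
        rw [Metric.mem_ball, Real.dist_eq, abs_lt]
        exact ⟨by linarith [le_min hs.2 (by linarith : s ≤ s + δ / 2)],
          by linarith [min_le_right b (s + δ / 2)]⟩
  obtain ⟨-, ht, hrep⟩ := GraphRealization.eq_edgePoint_of_pos (h.mem r hr) hxy.ne hrx hry
  rcases lt_trichotomy (γ r y) (1 / 2) with hlt | heq | hgt
  · exact Or.inl ⟨hxy, _, ⟨ht.1, hlt⟩, r, hr, hrep⟩
  · rw [heq, ← hse] at hrep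
    exact absurd (h.inj hr hs hrep) hrs
  · refine Or.inr ⟨hxy.symm, 1 - γ r y, ⟨by linarith [ht.2], by linarith⟩, r, hr, ?_⟩
    rw [edgePoint_symm, sub_sub_cancel]
    exact hrep

lemma covers_of_interior (h : MidArc G γ a b) {v w : V} (hvw : G.Adj v w) {s : ℝ}
    (hs : s ∈ Set.Ioo a b) (hm : γ s = edgeMid s(v, w)) : Covers G γ a b v w := by
  rw [edgeMid_mk hvw.ne] at hm
  have := h.eventually_mem_image hvw hs ⟨by norm_num, by norm_num⟩ hm
  have hlt : ∀ᶠ t in 𝓝[<] (1 / 2 : ℝ), edgePoint v w t ∈ γ '' Set.Icc a b :=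
    nhdsWithin_le_nhds this
  obtain ⟨t, ht, ht'⟩ := (hlt.and
    (Ioo_mem_nhdsLT (by norm_num : (0 : ℝ) < 1 / 2))).exists
  exact ⟨hvw, t, ht', ht⟩

theorem germSystem (h : MidArc G γ a b) {F : Set (Sym2 V)} (hF : F ⊆ G.edgeSet)
    (hFm : ∀ e ∈ F, edgeMid e ∈ γ '' Set.Icc a b)
    (hl : ∃ e ∈ F, γ a = edgeMid e) (hr : ∃ e ∈ F, γ b = edgeMid e) :
    GermSystem G F (Covers G γ a b) where
  adj v w hU := hU.1
  two v w hU := by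
    obtain ⟨s, hs, hv⟩ := h.exists_vertex_of_covers hU
    obtain ⟨w₁, w₂, hne, h1, h2, hall⟩ := h.exists_two_covers hs hv
    rcases hall w hU with rfl | rfl
    · exact ⟨w₂, hne.symm, h2, hall⟩
    · exact ⟨w₁, hne, h1, fun u hu => (hall u hu).symm⟩
  symm v w hvw hU := by
    obtain ⟨hadj, t, ht, hmem⟩ := hU
    have key : ∀ e ∈ F, ∀ t ∈ Set.Ioo (0 : ℝ) 1, edgeMid e ≠ edgePoint v w t :=
      fun e he t ht heq => hvw ((edgePoint_eq_edgeMid hadj.ne ht heq.symm).2 ▸ he)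
    have := h.subset_image hadj le_rfl le_rfl ⟨ht.1, by linarith [ht.2]⟩ hmem
      (by obtain ⟨e, he, h⟩ := hl; rw [h]; exact key e he)
      (by obtain ⟨e, he, h⟩ := hr; rw [h]; exact key e he) (3 / 4) (by constructor <;> norm_num)
    rw [edgePoint_symm] at this
    exact ⟨hadj.symm, _, by constructor <;> norm_num, this⟩
  missed := by
    obtain ⟨e, he, hae⟩ := hl
    obtain ⟨f, hf, hbf⟩ := hr
    obtain ⟨p, hp⟩ := h.missed_end (hF he) (hFm e he)
    obtain ⟨q, hq⟩ := h.missed_end (hF hf) (hFm f hf)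
    refine ⟨p, q, fun v w hvw hn => ?_⟩
    obtain ⟨s, hs, hsm⟩ := hFm _ hvw
    by_cases h1 : s = a
    · subst h1
      exact Or.inl (hp v w (edgeMid_injective (hsm.symm.trans hae)) hn)
    · by_cases h2 : s = b
      · subst h2
        exact Or.inr (hq v w (edgeMid_injective (hsm.symm.trans hbf)) hn)
      · exact absurd (h.covers_of_interior (hF hvw) ⟨lt_of_le_of_ne hs.1 (Ne.symm h1),
          lt_of_le_of_ne hs.2 h2⟩ hsm) hn
  finite := by
    have : {p : V × V | Covers G γ a b p.1 p.2} ⊆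
        ⋃ v ∈ {v : V | vertexPoint v ∈ γ '' Set.Icc a b}, Prod.mk v '' {w | Covers G γ a b v w} := by
      rintro ⟨v, w⟩ hU
      obtain ⟨s, hs, hv⟩ := h.exists_vertex_of_covers hU
      exact Set.mem_biUnion (show v ∈ {v : V | vertexPoint v ∈ γ '' Set.Icc a b} from
        ⟨s, ⟨hs.1.le, hs.2.le⟩, hv⟩) ⟨w, hU, rfl⟩
    refine (h.finite_vertices.biUnion fun v hv => Set.Finite.image _ ?_).subset this
    obtain ⟨s, hs, hv⟩ := hv
    obtain ⟨w₁, w₂, -, -, -, hall⟩ := h.exists_two_covers (h.mem_Ioo_of_vertexPoint hs hv) hv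
    exact (Set.toFinite {w₁, w₂}).subset fun u hu => hall u hu

end MidArc

section FromArcs

variable {V : Type*} {G : SimpleGraph V}

/-- A parametrization of an arc by the unit interval in `ℝ`. -/
lemma IsArc.exists_param {X : Set (V → ℝ)} {A : Set X} (hA : IsArc A) :
    ∃ γ : ℝ → V → ℝ, Continuous γ ∧ Set.InjOn γ (Set.Icc 0 1) ∧ (∀ s, γ s ∈ X) ∧
      ∀ x ∈ A, (x : V → ℝ) ∈ γ '' Set.Icc 0 1 := by
  obtain ⟨h⟩ := hA
  refine ⟨fun s => (h.symm (Set.projIcc 0 1 zero_le_one s)).1.1, ?_, ?_, fun s => Subtype.prop _, ?_⟩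
  · exact continuous_subtype_val.comp (continuous_subtype_val.comp
      (h.symm.continuous.comp continuous_projIcc))
  · intro s hs t ht hst
    have := h.symm.injective (Subtype.ext (Subtype.ext hst))
    rw [Set.projIcc_of_mem _ hs, Set.projIcc_of_mem _ ht] at this
    exact congrArg Subtype.val this
  · intro x hx
    refine ⟨(h ⟨x, hx⟩ : ℝ), (h ⟨x, hx⟩).2, ?_⟩
    simp

theorem NArcConn.exists_germSystem {n : ℕ} (hG : NArcConn ↥(GraphRealization G) n)
    (F : Finset (Sym2 V)) (hF : ↑F ⊆ G.edgeSet) (hn : F.card ≤ n) (h2 : 2 ≤ F.card) :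
    ∃ U, GermSystem G F U := by
  classical
  have hmid : ∀ e ∈ F, edgeMid e ∈ GraphRealization G := by
    intro e he
    induction e using Sym2.ind with
    | _ x y =>
    have hxy : G.Adj x y := hF he
    rw [edgeMid_mk hxy.ne]
    exact GraphRealization.edgePoint_mem hxy (by constructor <;> norm_num)
  obtain ⟨A, hA, hSA⟩ := hG (F.attach.image fun e : {e // e ∈ F} =>
      (⟨edgeMid e.1, hmid e.1 e.2⟩ : ↥(GraphRealization G)))
    (Finset.card_image_le.trans (by simpa using hn))
  obtain ⟨γ, hc, hi, hm, himg⟩ := hA.exists_param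
  have hFγ : ∀ e ∈ F, ∃ s ∈ Set.Icc (0 : ℝ) 1, γ s = edgeMid e := fun e he =>
    himg ⟨_, hmid e he⟩ (hSA (by simpa using ⟨e, he, rfl⟩))
  choose! τ hτ hτ' using hFγ
  have hne : F.Nonempty := Finset.card_pos.1 (by omega)
  obtain ⟨e₀, he₀, hmin⟩ := F.exists_min_image τ hne
  obtain ⟨e₁, he₁, hmax⟩ := F.exists_max_image τ hne
  have hlt : τ e₀ < τ e₁ := by
    obtain ⟨e, he, f, hf, hef⟩ := Finset.one_lt_card.1 (by omega : 1 < F.card)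
    by_contra! hle
    apply hef
    apply edgeMid_injective
    rw [← hτ' e he, ← hτ' f hf, le_antisymm ((hmax e he).trans (hle.trans (hmin f hf)))
      ((hmax f hf).trans (hle.trans (hmin e he)))]
  have hsub : Set.Icc (τ e₀) (τ e₁) ⊆ Set.Icc 0 1 :=
    Set.Icc_subset_Icc (hτ _ he₀).1 (hτ _ he₁).2
  have harc : MidArc G γ (τ e₀) (τ e₁) :=
    ⟨hlt, hc.continuousOn, hi.mono hsub, fun s _ => hm s, ⟨e₀, hF he₀, hτ' _ he₀⟩,
      ⟨e₁, hF he₁, hτ' _ he₁⟩⟩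
  exact ⟨_, harc.germSystem hF (fun e he => ⟨τ e, ⟨hmin e he, hmax e he⟩, hτ' e he⟩)
    ⟨e₀, he₀, hτ' _ he₀⟩ ⟨e₁, he₁, hτ' _ he₁⟩⟩

theorem NArcConn.eq_univ_of_closed {n : ℕ} (hG : NArcConn ↥(GraphRealization G) n) (hn : 2 ≤ n)
    {W : Set V} (hW : W.Nonempty) (hcl : ∀ v ∈ W, ∀ w, G.Adj v w → w ∈ W) : W = Set.univ := by
  classical
  by_contra hne
  obtain ⟨u, hu⟩ := hW
  obtain ⟨v, hv⟩ := (Set.ne_univ_iff_exists_notMem W).1 hne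
  obtain ⟨A, hA, hSA⟩ := hG {⟨vertexPoint u, GraphRealization.vertexPoint_mem u⟩,
    ⟨vertexPoint v, GraphRealization.vertexPoint_mem v⟩} (Finset.card_le_two.trans hn)
  obtain ⟨γ, hc, hi, hm, himg⟩ := hA.exists_param
  have hpre : IsPreconnected (γ '' Set.Icc 0 1) := isPreconnected_Icc.image _ hc.continuousOn
  have ho : ∀ u : V, IsOpen {x : V → ℝ | 0 < x u} := fun u =>
    isOpen_lt continuous_const (continuous_apply u)
  have h1 : ∀ u : V, 0 < vertexPoint u u := fun u => by rw [vertexPoint_self]; exact one_pos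
  obtain ⟨x, ⟨s, -, rfl⟩, hx1, hx2⟩ := hpre (⋃ u ∈ W, {x | 0 < x u}) (⋃ u ∈ Wᶜ, {x | 0 < x u})
    (isOpen_biUnion fun u _ => ho u) (isOpen_biUnion fun u _ => ho u) (by
      rintro _ ⟨s, -, rfl⟩
      obtain ⟨z, hz⟩ := GraphRealization.exists_pos (hm s)
      by_cases hzW : z ∈ W
      · exact Or.inl (Set.mem_biUnion hzW hz)
      · exact Or.inr (Set.mem_biUnion (show z ∈ Wᶜ from hzW) hz))
    ⟨vertexPoint u, himg ⟨_, GraphRealization.vertexPoint_mem u⟩ (hSA (by simp)), Set.mem_biUnion hu (h1 u)⟩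
    ⟨vertexPoint v, himg ⟨_, GraphRealization.vertexPoint_mem v⟩ (hSA (by simp)), Set.mem_biUnion (show v ∈ Wᶜ from hv) (h1 v)⟩
  obtain ⟨p, hp, hp'⟩ := Set.mem_iUnion₂.1 hx1
  obtain ⟨q, hq, hq'⟩ := Set.mem_iUnion₂.1 hx2
  exact hq (hcl p hp q (GraphRealization.eq_edgePoint_of_pos (hm s)
    (by rintro rfl; exact hq hp) hp' hq').1)

theorem NArcConn.exists_adj {n : ℕ} (hG : NArcConn ↥(GraphRealization G) n) (hn : 2 ≤ n)
    (hnt : Nontrivial ↥(GraphRealization G)) : ∃ v w, G.Adj v w := by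
  by_contra! hno
  have hvert : ∀ x ∈ GraphRealization G, ∃ v, x = vertexPoint v := by
    rintro x (h | ⟨v, w, t, h, -⟩)
    · exact h
    · exact absurd h (hno v w)
  obtain ⟨⟨x, hx⟩, ⟨y, hy⟩, hxy⟩ := hnt
  obtain ⟨v, rfl⟩ := hvert x hx
  obtain ⟨w, rfl⟩ := hvert y hy
  have := hG.eq_univ_of_closed hn (Set.singleton_nonempty v)
    (fun u _ w h => absurd h (hno u w))
  have hw : w ∈ ({v} : Set V) := this ▸ Set.mem_univ w
  rw [Set.mem_singleton_iff] at hw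
  subst hw
  exact hxy rfl

end FromArcs

section Tracks

variable {V : Type*} {G : SimpleGraph V} {F : Set (Sym2 V)} {U : V → V → Prop}

namespace GermSystem

lemma not_three (h : GermSystem G F U) {v x y z : V} (hxy : x ≠ y) (hxz : x ≠ z) (hyz : y ≠ z)
    (hx : U v x) (hy : U v y) (hz : U v z) : False := by
  obtain ⟨w', -, -, hw⟩ := h.two v x hx
  exact hyz (((hw y hy).resolve_left hxy.symm).trans ((hw z hz).resolve_left hxz.symm).symm)

lemma not_three_missed (h : GermSystem G F U) {p q r : V × V} (hpq : p ≠ q) (hpr : p ≠ r)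
    (hqr : q ≠ r) (hp : s(p.1, p.2) ∈ F ∧ ¬ U p.1 p.2) (hq : s(q.1, q.2) ∈ F ∧ ¬ U q.1 q.2)
    (hr : s(r.1, r.2) ∈ F ∧ ¬ U r.1 r.2) : False := by
  obtain ⟨a, b, hab⟩ := h.missed
  have h1 := hab _ _ hp.1 hp.2
  have h2 := hab _ _ hq.1 hq.2
  have h3 := hab _ _ hr.1 hr.2
  grind

/-- Among three edges at a vertex, all lying in `F`, one germ is missed. -/
lemma exists_missed (h : GermSystem G F U) {v x y z : V} (hxy : x ≠ y) (hxz : x ≠ z) (hyz : y ≠ z)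
    (hx : s(v, x) ∈ F) (hy : s(v, y) ∈ F) (hz : s(v, z) ∈ F) :
    ∃ u, s(v, u) ∈ F ∧ ¬ U v u := by
  by_contra! hc
  exact h.not_three hxy hxz hyz (hc _ hx) (hc _ hy) (hc _ hz)

/-- Among four edges at a vertex, all lying in `F`, two germs are missed. -/
lemma exists_two_missed (h : GermSystem G F U) {v x y z t : V} (hxy : x ≠ y) (hxz : x ≠ z)
    (hyz : y ≠ z) (hxt : x ≠ t) (hyt : y ≠ t) (hzt : z ≠ t)
    (hx : s(v, x) ∈ F) (hy : s(v, y) ∈ F) (hz : s(v, z) ∈ F) (ht : s(v, t) ∈ F) :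
    ∃ u u', u ≠ u' ∧ (s(v, u) ∈ F ∧ ¬ U v u) ∧ s(v, u') ∈ F ∧ ¬ U v u' := by
  have h1 := @not_three _ _ _ _ h v x y z hxy hxz hyz
  have h2 := @not_three _ _ _ _ h v x y t hxy hxt hyt
  have h3 := @not_three _ _ _ _ h v x z t hxz hxt hzt
  have h4 := @not_three _ _ _ _ h v y z t hyz hyt hzt
  by_cases hUx : U v x <;> by_cases hUy : U v y <;> by_cases hUz : U v z
  · exact (h1 hUx hUy hUz).elim
  · by_cases hUt : U v t
    · exact (h2 hUx hUy hUt).elim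
    · exact ⟨z, t, hzt, ⟨hz, hUz⟩, ht, hUt⟩
  · by_cases hUt : U v t
    · exact (h3 hUx hUz hUt).elim
    · exact ⟨y, t, hyt, ⟨hy, hUy⟩, ht, hUt⟩
  · exact ⟨y, z, hyz, ⟨hy, hUy⟩, hz, hUz⟩
  · by_cases hUt : U v t
    · exact (h4 hUy hUz hUt).elim
    · exact ⟨x, t, hxt, ⟨hx, hUx⟩, ht, hUt⟩
  · exact ⟨x, z, hxz, ⟨hx, hUx⟩, hz, hUz⟩
  · exact ⟨x, y, hxy, ⟨hx, hUx⟩, hy, hUy⟩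
  · exact ⟨x, y, hxy, ⟨hx, hUx⟩, hy, hUy⟩

end GermSystem

/-- An index of a track that has both a predecessor and a successor in the track. -/
def IsInner (I : Set ℤ) (i : ℤ) : Prop := i - 1 ∈ I ∧ i + 1 ∈ I

/-- A trail of `G`, indexed by an interval of integers, in which only the two extremal vertices may
repeat. -/
structure Track (G : SimpleGraph V) (I : Set ℤ) (w : ℤ → V) : Prop where
  ord : I.OrdConnected
  exists_edge : ∃ k, k ∈ I ∧ k + 1 ∈ I
  adj : ∀ k, k ∈ I → k + 1 ∈ I → G.Adj (w k) (w (k + 1))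
  inj : ∀ i j, IsInner I i → IsInner I j → w i = w j → i = j
  edge_inj : ∀ k l, k ∈ I → k + 1 ∈ I → l ∈ I → l + 1 ∈ I →
    s(w k, w (k + 1)) = s(w l, w (l + 1)) → k = l

/-- A germ of `G` at an inner vertex of a track that does not follow the track at this passage. -/
def Extra (G : SimpleGraph V) (I : Set ℤ) (w : ℤ → V) (i : ℤ) (x : V) : Prop :=
  IsInner I i ∧ G.Adj (w i) x ∧ x ≠ w (i - 1) ∧ x ≠ w (i + 1)

/-- An index whose vertex is not visited at any inner index other than itself. -/
def Unglued (I : Set ℤ) (w : ℤ → V) (l : ℤ) : Prop := ∀ b, IsInner I b → w b = w l → b = l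

/-- The right end of a track is infinite or a leaf of the graph. -/
def RightOpen (G : SimpleGraph V) (I : Set ℤ) (w : ℤ → V) : Prop :=
  (∀ k ∈ I, k + 1 ∈ I) ∨
    ∃ M ∈ I, M + 1 ∉ I ∧ Unglued I w M ∧ ∀ u, G.Adj (w M) u → u = w (M - 1)

/-- The left end of a track is infinite or a leaf of the graph. -/
def LeftOpen (G : SimpleGraph V) (I : Set ℤ) (w : ℤ → V) : Prop :=
  (∀ k ∈ I, k - 1 ∈ I) ∨
    ∃ m ∈ I, m - 1 ∉ I ∧ Unglued I w m ∧ ∀ u, G.Adj (w m) u → u = w (m + 1)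

namespace Track

variable {I : Set ℤ} {w : ℤ → V}

lemma mem_of_inner (T : Track G I w) {i : ℤ} (hi : IsInner I i) : i ∈ I :=
  T.ord.out hi.1 hi.2 ⟨by omega, by omega⟩

lemma inner_of_between (T : Track G I w) {i j k : ℤ} (hi : i ∈ I) (hj : j ∈ I) (hik : i < k)
    (hkj : k < j) : IsInner I k :=
  ⟨T.ord.out hi hj ⟨by omega, by omega⟩, T.ord.out hi hj ⟨by omega, by omega⟩⟩

lemma adj_left (T : Track G I w) {i : ℤ} (hi : IsInner I i) : G.Adj (w i) (w (i - 1)) := by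
  have := T.adj (i - 1) hi.1 (by simpa using T.mem_of_inner hi)
  rw [sub_add_cancel] at this
  exact this.symm

lemma adj_right (T : Track G I w) {i : ℤ} (hi : IsInner I i) : G.Adj (w i) (w (i + 1)) :=
  T.adj i (T.mem_of_inner hi) hi.2

lemma left_ne_right (T : Track G I w) {i : ℤ} (hi : IsInner I i) : w (i - 1) ≠ w (i + 1) := by
  intro h
  have hI := T.mem_of_inner hi
  have := T.edge_inj (i - 1) i hi.1 (by simpa using hI) hI hi.2
    (by rw [sub_add_cancel, h, Sym2.eq_swap])
  omega

lemma unglued_of_inner (T : Track G I w) {i : ℤ} (hi : IsInner I i) : Unglued I w i :=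
  fun b hb h => T.inj b i hb hi h

lemma extra_edge_ne (_T : Track G I w) {b l : ℤ} {x : V} (hx : Extra G I w b x)
    (hl : Unglued I w l) (hl' : Unglued I w (l + 1)) : s(w l, w (l + 1)) ≠ s(w b, x) := by
  intro h
  rcases Sym2.eq_iff.1 h with ⟨h1, h2⟩ | ⟨h1, h2⟩
  · obtain rfl := hl b hx.1 h1.symm
    exact hx.2.2.2 h2.symm
  · obtain rfl := hl' b hx.1 h2.symm
    exact hx.2.2.1 (by rw [add_sub_cancel_right, h1])

/-- An arc traversing the germ at `i + 1` towards `i` keeps following the track. -/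
lemma propagate (_ : Track G I w) (h : GermSystem G F U) {i j : ℤ}
    (hin : ∀ k, i < k → k < j → IsInner I k) (hno : ∀ k, i < k → k < j → ∀ x, ¬ Extra G I w k x)
    (hF : ∀ k, i < k → k < j → s(w k, w (k + 1)) ∉ F) (hU : U (w (i + 1)) (w i)) :
    ∀ k, i < k → k ≤ j → U (w k) (w (k - 1)) := by
  intro k hk
  induction k, (show i + 1 ≤ k by omega) using Int.leInduction with
  | base => intro _; rwa [add_sub_cancel_right]
  | succ k hk ih =>
    intro hkj
    have h1 := ih (by omega) (by omega)
    obtain ⟨u, hu, hUu, -⟩ := h.two _ _ h1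
    have hux : u = w (k + 1) := by
      by_contra hne
      exact hno k (by omega) (by omega) u ⟨hin k (by omega) (by omega), h.adj _ _ hUu, hu, hne⟩
    rw [add_sub_cancel_right]
    exact h.symm _ _ (hF k (by omega) (by omega)) (hux ▸ hUu)

/-- Between two branching positions of a track some germ is missed. -/
lemma exists_missed_between (T : Track G I w) (h : GermSystem G F U) {i j : ℤ} {x : V}
    (hij : i < j) (hi : IsInner I i) (hj : Extra G I w j x)
    (hno : ∀ k, i < k → k < j → ∀ x, ¬ Extra G I w k x)
    (hF : ∀ k, i < k → k < j → s(w k, w (k + 1)) ∉ F) (hi' : s(w i, w (i + 1)) ∈ F)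
    (hj' : s(w j, w (j + 1)) ∈ F) (hx : s(w j, x) ∈ F) :
    ∃ q u, i < q ∧ q ≤ j ∧ IsInner I q ∧ s(w q, u) ∈ F ∧ ¬ U (w q) u := by
  have hin : ∀ k, i < k → k < j → IsInner I k := fun k h1 h2 =>
    T.inner_of_between hi.1 hj.1.2 (by omega) (by omega)
  by_cases hU : U (w (i + 1)) (w i)
  · have h1 := T.propagate h hin hno hF hU j hij le_rfl
    by_cases h2 : U (w j) (w (j + 1))
    · exact ⟨j, x, hij, le_rfl, hj.1, hx, fun h3 =>
        h.not_three (T.left_ne_right hj.1) hj.2.2.1.symm hj.2.2.2.symm h1 h2 h3⟩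
    · exact ⟨j, _, hij, le_rfl, hj.1, hj', h2⟩
  · exact ⟨i + 1, _, by omega, by omega, T.inner_of_between hi.1 hj.1.2 (by omega) (by omega),
      by rwa [Sym2.eq_swap], hU⟩

/-- An arc system misses the germ coming out of an open end without branching. -/
lemma missed_of_rightOpen (T : Track G I w) (h : GermSystem G F U) (ho : RightOpen G I w) {i : ℤ}
    (hi : IsInner I i) (hno : ∀ k, i < k → ∀ x, ¬ Extra G I w k x)
    (hF : ∀ k, i < k → k ∈ I → k + 1 ∈ I → Unglued I w k → Unglued I w (k + 1) →
      s(w k, w (k + 1)) ∉ F) :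
    ¬ U (w (i + 1)) (w i) := by
  intro hU
  rcases ho with ho | ⟨M, hM, hM1, hMu, hleaf⟩
  · have hmem : ∀ k, i ≤ k → k ∈ I := by
      intro k hk
      induction k, hk using Int.leInduction with
      | base => exact T.mem_of_inner hi
      | succ k hk ih => exact ho _ ih
    have hin : ∀ k, i < k → IsInner I k := fun k hk => ⟨hmem _ (by omega), hmem _ (by omega)⟩
    have hall : ∀ k, i < k → U (w k) (w (k - 1)) := fun k hk =>
      T.propagate h (j := k) (fun l h1 _ => hin l h1) (fun l h1 _ => hno l h1)
        (fun l h1 _ => hF l h1 (hmem _ (by omega)) (hmem _ (by omega))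
          (T.unglued_of_inner (hin _ h1)) (T.unglued_of_inner (hin _ (by omega)))) hU k hk le_rfl
    have hfin : (Set.Ioi i).Finite := by
      refine Set.Finite.of_finite_image (f := fun k => (w k, w (k - 1))) (h.finite.subset ?_) ?_
      · rintro _ ⟨k, hk, rfl⟩
        exact hall k hk
      · intro k hk l hl hkl
        exact T.inj k l (hin k hk) (hin l hl) (Prod.ext_iff.1 hkl).1
    exact Set.Ioi_infinite i hfin
  · have hiM : i < M := by
      by_contra! hle
      exact hM1 (T.ord.out hM hi.2 ⟨by omega, by omega⟩)
    have hin : ∀ k, i < k → k < M → IsInner I k := fun k h1 h2 =>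
      T.inner_of_between hi.1 hM (by omega) h2
    have hung : ∀ k, i < k → k ≤ M → Unglued I w k := fun k h1 h2 => by
      rcases h2.lt_or_eq with h2 | rfl
      · exact T.unglued_of_inner (hin k h1 h2)
      · exact hMu
    have hmem : ∀ k, i < k → k ≤ M → k ∈ I := fun k h1 h2 =>
      T.ord.out (T.mem_of_inner hi) hM ⟨by omega, h2⟩
    have hUM := T.propagate h hin (fun l h1 _ => hno l h1)
      (fun l h1 h2 => hF l h1 (hmem _ h1 h2.le) (hmem _ (by omega) (by omega)) (hung _ h1 h2.le)
        (hung _ (by omega) (by omega))) hU M hiM le_rfl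
    obtain ⟨u, hu, hUu, -⟩ := h.two _ _ hUM
    exact hu (hleaf u (h.adj _ _ hUu))

lemma unglued_succ_of_rightOpen (T : Track G I w) (ho : RightOpen G I w) {i : ℤ}
    (hi : IsInner I i) : Unglued I w (i + 1) := by
  rcases ho with ho | ⟨M, hM, hM1, hMu, -⟩
  · exact T.unglued_of_inner ⟨by simpa using T.mem_of_inner hi, ho _ hi.2⟩
  · rcases lt_trichotomy (i + 1) M with h | h | h
    · exact T.unglued_of_inner (T.inner_of_between hi.1 hM (by omega) h)
    · exact h ▸ hMu
    · exact (hM1 (T.ord.out hM hi.2 ⟨by omega, by omega⟩)).elim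

lemma reverse (T : Track G I w) : Track G {k | -k ∈ I} (fun k => w (-k)) where
  ord := by
    refine ⟨fun a ha b hb c hc => ?_⟩
    exact T.ord.out hb ha ⟨by have := hc.2; omega, by have := hc.1; omega⟩
  exists_edge := by
    obtain ⟨k, h1, h2⟩ := T.exists_edge
    exact ⟨-(k + 1), by simpa using h2, by simpa using h1⟩
  adj := by
    intro k h1 h2
    have := T.adj (-(k + 1)) h2 (by simpa using h1)
    have e : -(k + 1) + 1 = -k := by ring
    rw [e] at this
    exact this.symm
  inj := by
    intro i j hi hj h
    have e : ∀ i : ℤ, IsInner {k | -k ∈ I} i → IsInner I (-i) := fun i hi =>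
      ⟨by have := hi.2; rwa [Set.mem_ofPred_eq, neg_add'] at this,
        by have := hi.1; rwa [Set.mem_ofPred_eq, neg_sub, sub_eq_neg_add] at this⟩
    have := T.inj _ _ (e i hi) (e j hj) h
    omega
  edge_inj := by
    intro k l h1 h2 h3 h4 h
    have e : ∀ k : ℤ, -(k + 1) + 1 = -k := fun k => by ring
    have := T.edge_inj (-(k + 1)) (-(l + 1)) h2 (by rw [e]; exact h1) h4 (by rw [e]; exact h3)
      (by rw [e, e, Sym2.eq_swap, h, Sym2.eq_swap])
    omega

end Track

lemma inner_reverse {I : Set ℤ} {i : ℤ} : IsInner {k | -k ∈ I} i ↔ IsInner I (-i) := by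
  have h1 : -(i - 1) = -i + 1 := by ring
  have h2 : -(i + 1) = -i - 1 := by ring
  simp only [IsInner, Set.mem_ofPred_eq, h1, h2, and_comm]

lemma extra_reverse {I : Set ℤ} {w : ℤ → V} {i : ℤ} {x : V} :
    Extra G {k | -k ∈ I} (fun k => w (-k)) i x ↔ Extra G I w (-i) x := by
  have h1 : -(i - 1) = -i + 1 := by ring
  have h2 : -(i + 1) = -i - 1 := by ring
  simp only [Extra, inner_reverse, h1, h2]
  tauto

lemma unglued_reverse {I : Set ℤ} {w : ℤ → V} {i : ℤ} :
    Unglued {k | -k ∈ I} (fun k => w (-k)) i ↔ Unglued I w (-i) := by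
  constructor
  · intro h b hb hw
    have := h (-b) (inner_reverse.2 (by rwa [neg_neg])) (by simpa using hw)
    omega
  · intro h b hb hw
    have := h (-b) (inner_reverse.1 hb) hw
    omega

lemma rightOpen_reverse {I : Set ℤ} {w : ℤ → V} (h : LeftOpen G I w) :
    RightOpen G {k | -k ∈ I} (fun k => w (-k)) := by
  have e : ∀ k : ℤ, -(k + 1) = -k - 1 := fun k => by ring
  rcases h with h | ⟨m, hm, hm1, hu, hl⟩
  · refine Or.inl fun k hk => ?_
    have := h _ hk
    rwa [Set.mem_ofPred_eq, e]
  · refine Or.inr ⟨-m, by simpa using hm, by rwa [Set.mem_ofPred_eq, e, neg_neg],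
      unglued_reverse.2 (by rwa [neg_neg]), fun u hadj => ?_⟩
    have e' : -(-m - 1) = m + 1 := by ring
    simp only [neg_neg, e'] at hadj ⊢
    exact hl u hadj

lemma NArcConn.exists_germSystem_of_list (hG : NArcConn ↥(GraphRealization G) 7)
    (L : List (Sym2 V)) (hL : ∀ e ∈ L, e ∈ G.edgeSet) (hlen : L.length ≤ 7) {e f : Sym2 V}
    (he : e ∈ L) (hf : f ∈ L) (hef : e ≠ f) : ∃ U, GermSystem G {e | e ∈ L} U := by
  classical
  obtain ⟨U, hU⟩ := hG.exists_germSystem L.toFinset (fun e he => hL e (by simpa using he))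
    (L.toFinset_card_le.trans hlen)
    (Finset.one_lt_card.2 ⟨e, by simpa using he, f, by simpa using hf, hef⟩)
  refine ⟨U, ?_⟩
  have e : {e | e ∈ L} = (↑L.toFinset : Set (Sym2 V)) := by ext; simp
  rwa [e]

lemma exists_next_int {P : ℤ → Prop} {i j : ℤ} (hij : i < j) (hj : P j) :
    ∃ k, i < k ∧ k ≤ j ∧ P k ∧ ∀ l, i < l → l < k → ¬ P l := by
  obtain ⟨k, hk, hmin⟩ := Int.exists_least_of_bdd (P := fun k => i < k ∧ P k)
    ⟨i, fun z hz => hz.1.le⟩ ⟨j, hij, hj⟩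
  refine ⟨k, hk.1, hmin j ⟨hij, hj⟩, hk.2, fun l h1 h2 h3 => ?_⟩
  have := hmin l ⟨h1, h3⟩
  omega

lemma exists_prev_int {P : ℤ → Prop} {i j : ℤ} (hij : i < j) (hi : P i) :
    ∃ k, i ≤ k ∧ k < j ∧ P k ∧ ∀ l, k < l → l < j → ¬ P l := by
  obtain ⟨k, hk, hmax⟩ := Int.exists_greatest_of_bdd (P := fun k => k < j ∧ P k)
    ⟨j, fun z hz => hz.1.le⟩ ⟨i, hij, hi⟩
  refine ⟨k, hmax i ⟨hij, hi⟩, hk.1, hk.2, fun l h1 h2 h3 => ?_⟩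
  have := hmax l ⟨h2, h3⟩
  omega

namespace Track

variable {I : Set ℤ} {w : ℤ → V}

lemma edge_left (T : Track G I w) {i : ℤ} (hi : IsInner I i) : s(w i, w (i - 1)) ∈ G.edgeSet :=
  T.adj_left hi

lemma edge_right (T : Track G I w) {i : ℤ} (hi : IsInner I i) : s(w i, w (i + 1)) ∈ G.edgeSet :=
  T.adj_right hi

lemma left_ne_right_edge (T : Track G I w) {i : ℤ} (hi : IsInner I i) :
    s(w i, w (i - 1)) ≠ s(w i, w (i + 1)) := fun h =>
  T.left_ne_right hi (Sym2.congr_right.1 h)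

lemma edge_ne (T : Track G I w) {k l : ℤ} (hk : k ∈ I) (hk' : k + 1 ∈ I) (hl : l ∈ I)
    (hl' : l + 1 ∈ I) (hkl : k ≠ l) : s(w k, w (k + 1)) ≠ s(w l, w (l + 1)) :=
  fun h => hkl (T.edge_inj k l hk hk' hl hl' h)

lemma edge_ne_left (T : Track G I w) {k i : ℤ} (hk : k ∈ I) (hk' : k + 1 ∈ I) (hi : IsInner I i)
    (hki : k ≠ i - 1) : s(w k, w (k + 1)) ≠ s(w i, w (i - 1)) := by
  have := T.edge_ne hk hk' hi.1 (by rw [sub_add_cancel]; exact T.mem_of_inner hi) hki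
  rwa [sub_add_cancel, Sym2.eq_swap (a := w (i - 1))] at this

lemma not_three_extra_same (T : Track G I w) (hG : NArcConn ↥(GraphRealization G) 7) {i : ℤ}
    {x y z : V} (hx : Extra G I w i x) (hy : Extra G I w i y) (hz : Extra G I w i z)
    (hxy : x ≠ y) (hxz : x ≠ z) (hyz : y ≠ z) : False := by
  obtain ⟨U, hU⟩ := hG.exists_germSystem_of_list
    [s(w i, w (i - 1)), s(w i, w (i + 1)), s(w i, x), s(w i, y), s(w i, z)]
    (by
      simp only [List.mem_cons, List.not_mem_nil, or_false]
      rintro e (rfl | rfl | rfl | rfl | rfl)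
      exacts [T.edge_left hx.1, T.edge_right hx.1, hx.2.1, hy.2.1, hz.2.1])
    (by simp) (by simp) (by simp) (T.left_ne_right_edge hx.1)
  set F : Set (Sym2 V) := {e | e ∈ [s(w i, w (i - 1)), s(w i, w (i + 1)), s(w i, x), s(w i, y),
    s(w i, z)]} with hF
  have hlr := T.left_ne_right hx.1
  have h1 : ∀ {a b c}, a ≠ b → a ≠ c → b ≠ c → U (w i) a → U (w i) b → U (w i) c → False :=
    fun h1 h2 h3 => hU.not_three h1 h2 h3
  have h2 : ∀ {a b c}, a ≠ b → a ≠ c → b ≠ c → s(w i, a) ∈ F → s(w i, b) ∈ F → s(w i, c) ∈ F →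
      ¬ U (w i) a → ¬ U (w i) b → ¬ U (w i) c → False :=
    fun {a b c} h1 h2 h3 ha hb hc ha' hb' hc' => hU.not_three_missed (p := (w i, a))
      (q := (w i, b)) (r := (w i, c)) (by simpa using h1) (by simpa using h2) (by simpa using h3)
      ⟨ha, ha'⟩ ⟨hb, hb'⟩ ⟨hc, hc'⟩
  have hl : s(w i, w (i - 1)) ∈ F := by simp [F]
  have hr : s(w i, w (i + 1)) ∈ F := by simp [F]
  have hxF : s(w i, x) ∈ F := by simp [F]
  have hyF : s(w i, y) ∈ F := by simp [F]
  have hzF : s(w i, z) ∈ F := by simp [F]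
  have hlx := hx.2.2.1.symm
  have hrx := hx.2.2.2.symm
  have hly := hy.2.2.1.symm
  have hry := hy.2.2.2.symm
  have hlz := hz.2.2.1.symm
  have hrz := hz.2.2.2.symm
  by_cases hUl : U (w i) (w (i - 1)) <;> by_cases hUr : U (w i) (w (i + 1)) <;>
    by_cases hUx : U (w i) x <;> by_cases hUy : U (w i) y <;> by_cases hUz : U (w i) z <;>
    first
    | exact h1 hlr hlx hrx hUl hUr hUx
    | exact h1 hlr hly hry hUl hUr hUy
    | exact h1 hlr hlz hrz hUl hUr hUz
    | exact h1 hlx hly hxy hUl hUx hUy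
    | exact h1 hlx hlz hxz hUl hUx hUz
    | exact h1 hly hlz hyz hUl hUy hUz
    | exact h1 hrx hry hxy hUr hUx hUy
    | exact h1 hrx hrz hxz hUr hUx hUz
    | exact h1 hry hrz hyz hUr hUy hUz
    | exact h1 hxy hxz hyz hUx hUy hUz
    | exact h2 hlr hlx hrx hl hr hxF hUl hUr hUx
    | exact h2 hlr hly hry hl hr hyF hUl hUr hUy
    | exact h2 hlr hlz hrz hl hr hzF hUl hUr hUz
    | exact h2 hlx hly hxy hl hxF hyF hUl hUx hUy
    | exact h2 hlx hlz hxz hl hxF hzF hUl hUx hUz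
    | exact h2 hly hlz hyz hl hyF hzF hUl hUy hUz
    | exact h2 hrx hry hxy hr hxF hyF hUr hUx hUy
    | exact h2 hrx hrz hxz hr hxF hzF hUr hUx hUz
    | exact h2 hry hrz hyz hr hyF hzF hUr hUy hUz
    | exact h2 hxy hxz hyz hxF hyF hzF hUx hUy hUz

lemma not_two_one (T : Track G I w) (hG : NArcConn ↥(GraphRealization G) 7) {i j : ℤ}
    {x y z : V} (hij : i < j) (hx : Extra G I w i x) (hy : Extra G I w i y) (hxy : x ≠ y)
    (hz : Extra G I w j z) : False := by
  obtain ⟨j, hij, -, ⟨z, hz⟩, hno⟩ := exists_next_int (P := fun j => ∃ z, Extra G I w j z)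
    hij ⟨z, hz⟩
  obtain ⟨U, hU⟩ := hG.exists_germSystem_of_list
    [s(w i, w (i - 1)), s(w i, w (i + 1)), s(w i, x), s(w i, y), s(w j, w (j + 1)), s(w j, z)]
    (by
      simp only [List.mem_cons, List.not_mem_nil, or_false]
      rintro e (rfl | rfl | rfl | rfl | rfl | rfl)
      exacts [T.edge_left hx.1, T.edge_right hx.1, hx.2.1, hy.2.1, T.edge_right hz.1, hz.2.1])
    (by simp) (by simp) (by simp) (T.left_ne_right_edge hx.1)
  obtain ⟨u, u', huu, hu, hu'⟩ := hU.exists_two_missed (v := w i) (T.left_ne_right hx.1)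
    hx.2.2.1.symm hx.2.2.2.symm hy.2.2.1.symm hy.2.2.2.symm hxy (by simp) (by simp) (by simp)
    (by simp)
  obtain ⟨q, t, hq, hqj, hqi, hqt⟩ := T.exists_missed_between hU hij hx.1 hz
    (fun k h1 h2 x h => hno k h1 h2 ⟨x, h⟩) (by
      intro k h1 h2
      have hk := T.inner_of_between (T.mem_of_inner hx.1) (T.mem_of_inner hz.1) h1 h2
      have hk' : IsInner I (k + 1) := T.inner_of_between hk.1 hz.1.2 (by omega) (by omega)
      have ek := T.unglued_of_inner hk
      have ek' := T.unglued_of_inner hk'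
      simp only [List.mem_cons, List.not_mem_nil, or_false, Set.mem_ofPred_eq, not_or]
      have hkI := T.mem_of_inner hk
      exact ⟨T.edge_ne_left hkI hk.2 hx.1 (by omega),
        T.edge_ne hkI hk.2 (T.mem_of_inner hx.1) hx.1.2 (by omega), T.extra_edge_ne hx ek ek',
        T.extra_edge_ne hy ek ek', T.edge_ne hkI hk.2 (T.mem_of_inner hz.1) hz.1.2 (by omega),
        T.extra_edge_ne hz ek ek'⟩)
    (by simp) (by simp) (by simp)
  have hne : w i ≠ w q := fun h => by have := T.inj i q hx.1 hqi h; omega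
  exact hU.not_three_missed (p := (w i, u)) (q := (w i, u')) (r := (w q, t)) (by simpa using huu)
    (by simp [hne]) (by simp [hne]) hu hu' hqt

lemma not_one_two (T : Track G I w) (hG : NArcConn ↥(GraphRealization G) 7) {i j : ℤ}
    {x y z : V} (hij : i < j) (hx : Extra G I w i x) (hy : Extra G I w j y)
    (hz : Extra G I w j z) (hyz : y ≠ z) : False := by
  obtain ⟨i, -, hij, ⟨x, hx⟩, hno⟩ := exists_prev_int (P := fun i => ∃ x, Extra G I w i x)
    hij ⟨x, hx⟩
  obtain ⟨U, hU⟩ := hG.exists_germSystem_of_list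
    [s(w i, w (i - 1)), s(w i, w (i + 1)), s(w i, x), s(w j, w (j + 1)), s(w j, y), s(w j, z)]
    (by
      simp only [List.mem_cons, List.not_mem_nil, or_false]
      rintro e (rfl | rfl | rfl | rfl | rfl | rfl)
      exacts [T.edge_left hx.1, T.edge_right hx.1, hx.2.1, T.edge_right hy.1, hy.2.1, hz.2.1])
    (by simp) (by simp) (by simp) (T.left_ne_right_edge hx.1)
  obtain ⟨u, hu⟩ := hU.exists_missed (v := w i) (T.left_ne_right hx.1)
    hx.2.2.1.symm hx.2.2.2.symm (by simp) (by simp) (by simp)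
  obtain ⟨t, ht⟩ := hU.exists_missed (v := w j) hy.2.2.2.symm hz.2.2.2.symm hyz (by simp) (by simp)
    (by simp)
  have hin : ∀ k, i < k → k < j → IsInner I k := fun k h1 h2 =>
    T.inner_of_between hx.1.1 hy.1.2 (by omega) (by omega)
  have hF : ∀ k, i < k → k < j → s(w k, w (k + 1)) ∉ {e : Sym2 V | e ∈ [s(w i, w (i - 1)),
      s(w i, w (i + 1)), s(w i, x), s(w j, w (j + 1)), s(w j, y), s(w j, z)]} := by
    intro k h1 h2
    have hk := T.inner_of_between (T.mem_of_inner hx.1) (T.mem_of_inner hz.1) h1 h2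
    have hk' : IsInner I (k + 1) := T.inner_of_between hk.1 hz.1.2 (by omega) (by omega)
    have ek := T.unglued_of_inner hk
    have ek' := T.unglued_of_inner hk'
    simp only [List.mem_cons, List.not_mem_nil, or_false, Set.mem_ofPred_eq, not_or]
    have hkI := T.mem_of_inner hk
    exact ⟨T.edge_ne_left hkI hk.2 hx.1 (by omega),
      T.edge_ne hkI hk.2 (T.mem_of_inner hx.1) hx.1.2 (by omega), T.extra_edge_ne hx ek ek',
      T.edge_ne hkI hk.2 (T.mem_of_inner hz.1) hz.1.2 (by omega),
      T.extra_edge_ne hy ek ek', T.extra_edge_ne hz ek ek'⟩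
  have hne : w i ≠ w j := fun h => by have := T.inj i j hx.1 hy.1 h; omega
  by_cases hUi : U (w (i + 1)) (w i)
  · have hUj := T.propagate hU hin (fun k h1 h2 x h => hno k h1 h2 ⟨x, h⟩) hF hUi j hij le_rfl
    have key : ∃ a b, a ≠ b ∧ (s(w j, a) ∈ {e : Sym2 V | e ∈ [s(w i, w (i - 1)),
      s(w i, w (i + 1)), s(w i, x), s(w j, w (j + 1)), s(w j, y), s(w j, z)]} ∧ ¬ U (w j) a) ∧
      s(w j, b) ∈ {e : Sym2 V | e ∈ [s(w i, w (i - 1)), s(w i, w (i + 1)), s(w i, x),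
        s(w j, w (j + 1)), s(w j, y), s(w j, z)]} ∧ ¬ U (w j) b := by
      have h1 : ∀ {a b}, w (j - 1) ≠ a → w (j - 1) ≠ b → a ≠ b → U (w j) a → ¬ U (w j) b :=
        fun h1 h2 h3 ha hb => hU.not_three h1 h2 h3 hUj ha hb
      by_cases hUr : U (w j) (w (j + 1))
      · exact ⟨y, z, hyz, ⟨by simp, h1 (T.left_ne_right hy.1) hy.2.2.1.symm hy.2.2.2.symm hUr⟩,
          by simp, h1 (T.left_ne_right hy.1) hz.2.2.1.symm hz.2.2.2.symm hUr⟩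
      · by_cases hUy : U (w j) y
        · exact ⟨_, z, hz.2.2.2.symm, ⟨by simp, hUr⟩, by simp,
            h1 hy.2.2.1.symm hz.2.2.1.symm hyz hUy⟩
        · exact ⟨_, y, hy.2.2.2.symm, ⟨by simp, hUr⟩, by simp, hUy⟩
    obtain ⟨a, b, hab, ha, hb⟩ := key
    exact hU.not_three_missed (p := (w i, u)) (q := (w j, a)) (r := (w j, b)) (by simp [hne])
      (by simp [hne]) (by simpa using hab) hu ha hb
  · have hmem : s(w (i + 1), w i) ∈ {e : Sym2 V | e ∈ [s(w i, w (i - 1)), s(w i, w (i + 1)),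
        s(w i, x), s(w j, w (j + 1)), s(w j, y), s(w j, z)]} := by
      rw [Sym2.eq_swap]; simp
    by_cases hij' : i + 1 = j
    · have hUl : ¬ U (w j) (w (j - 1)) := by rwa [← hij', add_sub_cancel_right]
      by_cases hc : U (w j) (w (j + 1)) ∧ U (w j) y ∧ U (w j) z
      · exact hU.not_three hy.2.2.2.symm hz.2.2.2.symm hyz hc.1 hc.2.1 hc.2.2
      · have key : ∃ a, w (j - 1) ≠ a ∧ s(w j, a) ∈ {e : Sym2 V | e ∈ [s(w i, w (i - 1)),
            s(w i, w (i + 1)), s(w i, x), s(w j, w (j + 1)), s(w j, y), s(w j, z)]} ∧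
            ¬ U (w j) a := by
          by_cases h1 : U (w j) (w (j + 1))
          · by_cases h2 : U (w j) y
            · exact ⟨z, hz.2.2.1.symm, by simp, fun h3 => hc ⟨h1, h2, h3⟩⟩
            · exact ⟨y, hy.2.2.1.symm, by simp, h2⟩
          · exact ⟨_, T.left_ne_right hy.1, by simp, h1⟩
        obtain ⟨a, ha, ha'⟩ := key
        subst hij'
        rw [add_sub_cancel_right] at ha
        exact hU.not_three_missed (p := (w i, u)) (q := (w (i + 1), w i)) (r := (w (i + 1), a))
          (by simp [hne]) (by simp [hne]) (by simpa using ha) hu ⟨hmem, hUi⟩ ha'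
    · have h1 := hin (i + 1) (by omega) (by omega)
      have hne1 : w i ≠ w (i + 1) := fun h => by have := T.inj i (i + 1) hx.1 h1 h; omega
      have hne2 : w (i + 1) ≠ w j := fun h => by have := T.inj (i + 1) j h1 hy.1 h; omega
      exact hU.not_three_missed (p := (w i, u)) (q := (w (i + 1), w i)) (r := (w j, t))
        (by simp [hne1]) (by simp [hne]) (by simp [hne2]) hu ⟨hmem, hUi⟩ ht

lemma not_one_one_one (T : Track G I w) (hG : NArcConn ↥(GraphRealization G) 7) {i j k : ℤ}
    {x y z : V} (hij : i < j) (hjk : j < k) (hx : Extra G I w i x) (hy : Extra G I w j y)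
    (hz : Extra G I w k z) : False := by
  obtain ⟨j, hij, hjk', ⟨y, hy⟩, hno⟩ := exists_next_int (P := fun j => ∃ y, Extra G I w j y)
    hij ⟨y, hy⟩
  obtain ⟨k, hjk, -, ⟨z, hz⟩, hno'⟩ := exists_next_int (P := fun j => ∃ y, Extra G I w j y)
    (hjk'.trans_lt hjk) ⟨z, hz⟩
  obtain ⟨U, hU⟩ := hG.exists_germSystem_of_list
    [s(w i, w (i - 1)), s(w i, w (i + 1)), s(w i, x), s(w j, w (j + 1)), s(w j, y),
      s(w k, w (k + 1)), s(w k, z)]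
    (by
      simp only [List.mem_cons, List.not_mem_nil, or_false]
      rintro e (rfl | rfl | rfl | rfl | rfl | rfl | rfl)
      exacts [T.edge_left hx.1, T.edge_right hx.1, hx.2.1, T.edge_right hy.1, hy.2.1,
        T.edge_right hz.1, hz.2.1])
    (by simp) (by simp) (by simp) (T.left_ne_right_edge hx.1)
  have hF : ∀ l, i < l → l < k → l ≠ j → s(w l, w (l + 1)) ∉ {e : Sym2 V | e ∈ [s(w i, w (i - 1)),
      s(w i, w (i + 1)), s(w i, x), s(w j, w (j + 1)), s(w j, y), s(w k, w (k + 1)),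
      s(w k, z)]} := by
    intro l h1 h2 h3
    have hl := T.inner_of_between (T.mem_of_inner hx.1) (T.mem_of_inner hz.1) h1 h2
    have hl' : IsInner I (l + 1) := T.inner_of_between hl.1 hz.1.2 (by omega) (by omega)
    have el := T.unglued_of_inner hl
    have el' := T.unglued_of_inner hl'
    simp only [List.mem_cons, List.not_mem_nil, or_false, Set.mem_ofPred_eq, not_or]
    have hlI := T.mem_of_inner hl
    exact ⟨T.edge_ne_left hlI hl.2 hx.1 (by omega),
      T.edge_ne hlI hl.2 (T.mem_of_inner hx.1) hx.1.2 (by omega), T.extra_edge_ne hx el el',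
      T.edge_ne hlI hl.2 (T.mem_of_inner hy.1) hy.1.2 h3, T.extra_edge_ne hy el el',
      T.edge_ne hlI hl.2 (T.mem_of_inner hz.1) hz.1.2 (by omega), T.extra_edge_ne hz el el'⟩
  obtain ⟨u, hu⟩ := hU.exists_missed (v := w i) (T.left_ne_right hx.1)
    hx.2.2.1.symm hx.2.2.2.symm (by simp) (by simp) (by simp)
  obtain ⟨q, t, hq, hqj, hqi, hqt⟩ := T.exists_missed_between hU hij hx.1 hy
    (fun k h1 h2 x h => hno k h1 h2 ⟨x, h⟩) (fun l h1 h2 => hF l h1 (by omega) (by omega))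
    (by simp) (by simp) (by simp)
  obtain ⟨r, t', hr, hrk, hri, hrt⟩ := T.exists_missed_between hU hjk hy.1 hz
    (fun k h1 h2 x h => hno' k h1 h2 ⟨x, h⟩) (fun l h1 h2 => hF l (by omega) h2 (by omega))
    (by simp) (by simp) (by simp)
  have h1 : w i ≠ w q := fun h => by have := T.inj i q hx.1 hqi h; omega
  have h2 : w i ≠ w r := fun h => by have := T.inj i r hx.1 hri h; omega
  have h3 : w q ≠ w r := fun h => by have := T.inj q r hqi hri h; omega
  exact hU.not_three_missed (p := (w i, u)) (q := (w q, t)) (r := (w r, t')) (by simp [h1])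
    (by simp [h2]) (by simp [h3]) hu hqt hrt

lemma not_three_extra_of_le (T : Track G I w) (hG : NArcConn ↥(GraphRealization G) 7) {i j k : ℤ}
    {x y z : V} (hij : i ≤ j) (hjk : j ≤ k) (hx : Extra G I w i x) (hy : Extra G I w j y)
    (hz : Extra G I w k z) (hxy : (i, x) ≠ (j, y)) (hxz : (i, x) ≠ (k, z))
    (hyz : (j, y) ≠ (k, z)) : False := by
  rcases hij.lt_or_eq with hij | rfl <;> rcases hjk.lt_or_eq with hjk | rfl
  · exact T.not_one_one_one hG hij hjk hx hy hz
  · exact T.not_one_two hG hij hx hy hz (by simpa using hyz)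
  · exact T.not_two_one hG hjk hx hy (by simpa using hxy) hz
  · exact T.not_three_extra_same hG hx hy hz (by simpa using hxy) (by simpa using hxz)
      (by simpa using hyz)

/-- A track in a 7-arc connected graph branches at most twice. -/
lemma not_three_extra (T : Track G I w) (hG : NArcConn ↥(GraphRealization G) 7) {i j k : ℤ}
    {x y z : V} (hx : Extra G I w i x) (hy : Extra G I w j y)
    (hz : Extra G I w k z) (hxy : (i, x) ≠ (j, y)) (hxz : (i, x) ≠ (k, z))
    (hyz : (j, y) ≠ (k, z)) : False := by
  rcases le_total i j with h1 | h1 <;> rcases le_total j k with h2 | h2 <;>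
    rcases le_total i k with h3 | h3
  · exact T.not_three_extra_of_le hG h1 h2 hx hy hz hxy hxz hyz
  · exact T.not_three_extra_of_le hG h1 h2 hx hy hz hxy hxz hyz
  · exact T.not_three_extra_of_le hG h3 h2 hx hz hy hxz hxy hyz.symm
  · exact T.not_three_extra_of_le hG h3 h1 hz hx hy hxz.symm hyz.symm hxy
  · exact T.not_three_extra_of_le hG h1 h3 hy hx hz hxy.symm hyz hxz
  · exact T.not_three_extra_of_le hG h2 h3 hy hz hx hyz hxy.symm hxz.symm
  · exact T.not_three_extra_of_le hG h2 h1 hz hy hx hyz.symm hxz.symm hxy.symm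
  · exact T.not_three_extra_of_le hG h2 h1 hz hy hx hyz.symm hxz.symm hxy.symm

lemma not_two_extra_of_le (T : Track G I w) (hG : NArcConn ↥(GraphRealization G) 7)
    (ho : RightOpen G I w) {i j : ℤ} {x y : V} (hij : i ≤ j) (hx : Extra G I w i x)
    (hy : Extra G I w j y) (hxy : (i, x) ≠ (j, y)) : False := by
  have hno : ∀ k, i < k → k ≠ j → ∀ z, ¬ Extra G I w k z := fun k h1 h2 z hz =>
    T.not_three_extra hG hx hy hz hxy (by rintro h; cases h; omega) (by rintro h; cases h; omega)
  rcases hij.lt_or_eq with hij | rfl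
  · obtain ⟨U, hU⟩ := hG.exists_germSystem_of_list
      [s(w i, w (i - 1)), s(w i, w (i + 1)), s(w i, x), s(w j, w (j + 1)), s(w j, y)]
      (by
        simp only [List.mem_cons, List.not_mem_nil, or_false]
        rintro e (rfl | rfl | rfl | rfl | rfl)
        exacts [T.edge_left hx.1, T.edge_right hx.1, hx.2.1, T.edge_right hy.1, hy.2.1])
      (by simp) (by simp) (by simp) (T.left_ne_right_edge hx.1)
    have hF : ∀ l, i < l → l ≠ j → l ∈ I → l + 1 ∈ I → Unglued I w l → Unglued I w (l + 1) →
        s(w l, w (l + 1)) ∉ {e : Sym2 V | e ∈ [s(w i, w (i - 1)),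
        s(w i, w (i + 1)), s(w i, x), s(w j, w (j + 1)), s(w j, y)]} := by
      intro l h1 h2 hlI hlI' el el'
      simp only [List.mem_cons, List.not_mem_nil, or_false, Set.mem_ofPred_eq, not_or]
      exact ⟨T.edge_ne_left hlI hlI' hx.1 (by omega),
        T.edge_ne hlI hlI' (T.mem_of_inner hx.1) hx.1.2 (by omega), T.extra_edge_ne hx el el',
        T.edge_ne hlI hlI' (T.mem_of_inner hy.1) hy.1.2 h2, T.extra_edge_ne hy el el'⟩
    obtain ⟨u, hu⟩ := hU.exists_missed (v := w i) (T.left_ne_right hx.1)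
      hx.2.2.1.symm hx.2.2.2.symm (by simp) (by simp) (by simp)
    have hin : ∀ k, i < k → k ≤ j → IsInner I k := fun k h1 h2 =>
      T.inner_of_between hx.1.1 hy.1.2 (by omega) (by omega)
    obtain ⟨q, t, hq, hqj, hqi, hqt⟩ := T.exists_missed_between hU hij hx.1 hy
      (fun k h1 h2 => hno k h1 h2.ne) (fun l h1 h2 => hF l h1 h2.ne
        (T.mem_of_inner (hin l h1 h2.le)) (hin l h1 h2.le).2 (T.unglued_of_inner (hin l h1 h2.le))
        (T.unglued_of_inner (hin (l + 1) (by omega) (by omega))))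
      (by simp) (by simp) (by simp)
    have hr := T.missed_of_rightOpen hU ho hy.1 (fun k h1 => hno k (by omega) (by omega))
      (fun l h1 => hF l (by omega) (by omega))
    have hg := T.unglued_succ_of_rightOpen ho hy.1
    have h1 : w i ≠ w q := fun h => by have := T.inj i q hx.1 hqi h; omega
    have h2 : w i ≠ w (j + 1) := fun h => by have := hg i hx.1 h; omega
    have h3 : w q ≠ w (j + 1) := fun h => by have := hg q hqi h; omega
    exact hU.not_three_missed (p := (w i, u)) (q := (w q, t)) (r := (w (j + 1), w j)) (by simp [h1])
      (by simp [h2]) (by simp [h3]) hu hqt ⟨by rw [Sym2.eq_swap]; simp, hr⟩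
  · obtain ⟨U, hU⟩ := hG.exists_germSystem_of_list
      [s(w i, w (i - 1)), s(w i, w (i + 1)), s(w i, x), s(w i, y)]
      (by
        simp only [List.mem_cons, List.not_mem_nil, or_false]
        rintro e (rfl | rfl | rfl | rfl)
        exacts [T.edge_left hx.1, T.edge_right hx.1, hx.2.1, hy.2.1])
      (by simp) (by simp) (by simp) (T.left_ne_right_edge hx.1)
    obtain ⟨u, u', huu, hu, hu'⟩ := hU.exists_two_missed (v := w i) (T.left_ne_right hx.1)
      hx.2.2.1.symm hx.2.2.2.symm hy.2.2.1.symm hy.2.2.2.symm (by simpa using hxy) (by simp)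
      (by simp) (by simp) (by simp)
    have hr := T.missed_of_rightOpen hU ho hy.1 (fun k h1 => hno k (by omega) (by omega))
      (fun l h1 hlI hlI' el el' => by
        simp only [List.mem_cons, List.not_mem_nil, or_false, Set.mem_ofPred_eq, not_or]
        exact ⟨T.edge_ne_left hlI hlI' hx.1 (by omega),
          T.edge_ne hlI hlI' (T.mem_of_inner hx.1) hx.1.2 (by omega), T.extra_edge_ne hx el el',
          T.extra_edge_ne hy el el'⟩)
    have hg := T.unglued_succ_of_rightOpen ho hy.1
    have h1 : w i ≠ w (i + 1) := fun h => by have := hg i hx.1 h; omega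
    exact hU.not_three_missed (p := (w i, u)) (q := (w i, u')) (r := (w (i + 1), w i))
      (by simpa using huu) (by simp [h1]) (by simp [h1]) hu hu' ⟨by rw [Sym2.eq_swap]; simp, hr⟩

/-- A track in a 7-arc connected graph with an open end branches at most once. -/
lemma not_two_extra (T : Track G I w) (hG : NArcConn ↥(GraphRealization G) 7)
    (ho : RightOpen G I w) {i j : ℤ} {x y : V} (hx : Extra G I w i x)
    (hy : Extra G I w j y) (hxy : (i, x) ≠ (j, y)) : False := by
  rcases le_total i j with h | h
  · exact T.not_two_extra_of_le hG ho h hx hy hxy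
  · exact T.not_two_extra_of_le hG ho h hy hx hxy.symm

lemma not_two_extra_of_leftOpen (T : Track G I w) (hG : NArcConn ↥(GraphRealization G) 7)
    (ho : LeftOpen G I w) {i j : ℤ} {x y : V} (hx : Extra G I w i x)
    (hy : Extra G I w j y) (hxy : (i, x) ≠ (j, y)) : False :=
  T.reverse.not_two_extra hG (rightOpen_reverse ho) (i := -i) (j := -j)
    (extra_reverse.2 (by rwa [neg_neg])) (extra_reverse.2 (by rwa [neg_neg])) (by simpa using hxy)

/-- A track in a 7-arc connected graph with two open ends does not branch. -/
lemma not_extra (T : Track G I w) (hG : NArcConn ↥(GraphRealization G) 7)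
    (hl : LeftOpen G I w) (hr : RightOpen G I w) {i : ℤ} {x : V} (hx : Extra G I w i x) :
    False := by
  have hno : ∀ k, k ≠ i → ∀ z, ¬ Extra G I w k z := fun k h1 z hz =>
    T.not_two_extra hG hr hx hz (by rintro h; cases h; omega)
  obtain ⟨U, hU⟩ := hG.exists_germSystem_of_list
    [s(w i, w (i - 1)), s(w i, w (i + 1)), s(w i, x)]
    (by
      simp only [List.mem_cons, List.not_mem_nil, or_false]
      rintro e (rfl | rfl | rfl)
      exacts [T.edge_left hx.1, T.edge_right hx.1, hx.2.1])
    (by simp) (by simp) (by simp) (T.left_ne_right_edge hx.1)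
  obtain ⟨u, hu⟩ := hU.exists_missed (v := w i) (T.left_ne_right hx.1)
    hx.2.2.1.symm hx.2.2.2.symm (by simp) (by simp) (by simp)
  have h1 := T.missed_of_rightOpen hU hr hx.1 (fun k h1 => hno k (by omega))
    (fun l h1 hlI hlI' el el' => by
      simp only [List.mem_cons, List.not_mem_nil, or_false, Set.mem_ofPred_eq, not_or]
      exact ⟨T.edge_ne_left hlI hlI' hx.1 (by omega),
        T.edge_ne hlI hlI' (T.mem_of_inner hx.1) hx.1.2 (by omega), T.extra_edge_ne hx el el'⟩)
  have hg1 := T.unglued_succ_of_rightOpen hr hx.1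
  have hx' := extra_reverse.2 (by rwa [neg_neg] : Extra G I w (- -i) x)
  have h2 := T.reverse.missed_of_rightOpen hU (rightOpen_reverse hl) hx'.1
    (fun k h1 z hz => hno (-k) (by omega) z (extra_reverse.1 hz))
    (fun l h1 hlI hlI' el el' => by
      have e1 := T.reverse.edge_ne_left hlI hlI' hx'.1 (by omega)
      have e2 := T.reverse.edge_ne hlI hlI' (T.reverse.mem_of_inner hx'.1) hx'.1.2 (by omega)
      have e3 := T.reverse.extra_edge_ne hx' el el'
      have e4 : -(-i - 1) = i + 1 := by ring
      have e5 : -(-i + 1) = i - 1 := by ring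
      simp only [neg_neg, e4, e5] at e1 e2 e3
      simp only [List.mem_cons, List.not_mem_nil, or_false, Set.mem_ofPred_eq, not_or]
      exact ⟨e2, e1, e3⟩)
  have hg2 := unglued_reverse.1
    (T.reverse.unglued_succ_of_rightOpen (rightOpen_reverse hl) hx'.1)
  have e5 : -(-i + 1) = i - 1 := by ring
  simp only [neg_neg, e5] at h2 hg2
  have n1 : w i ≠ w (i + 1) := fun h => by have := hg1 i hx.1 h; omega
  have n2 : w i ≠ w (i - 1) := fun h => by have := hg2 i hx.1 h; omega
  exact hU.not_three_missed (p := (w i, u)) (q := (w (i + 1), w i)) (r := (w (i - 1), w i))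
    (by simp [n1]) (by simp [n2]) (by simp [(T.left_ne_right hx.1).symm]) hu
    ⟨by rw [Sym2.eq_swap]; simp, h1⟩ ⟨by rw [Sym2.eq_swap]; simp, h2⟩

end Track

end Tracks

section MaximalTracks

variable {V : Type*} {G : SimpleGraph V}

/-- A track that cannot be extended. -/
def IsMaxTrack (G : SimpleGraph V) (I : Set ℤ) (w : ℤ → V) : Prop :=
  ∀ I' w', Track G I' w' → I ⊆ I' → Set.EqOn w w' I → I' ⊆ I

/-- The last vertex of the track is also visited at an inner index. -/
def GluedRight (I : Set ℤ) (w : ℤ → V) : Prop :=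
  ∃ M ∈ I, M + 1 ∉ I ∧ ∃ a, IsInner I a ∧ w a = w M

/-- The first vertex of the track is also visited at an inner index. -/
def GluedLeft (I : Set ℤ) (w : ℤ → V) : Prop :=
  ∃ m ∈ I, m - 1 ∉ I ∧ ∃ a, IsInner I a ∧ w a = w m

/-- A closed track without further gluing. -/
def IsCycleTrack (I : Set ℤ) (w : ℤ → V) : Prop :=
  ∃ m M, m < M ∧ I = Set.Icc m M ∧ w m = w M ∧ Unglued I w M

/-- The edge `vu` is an edge of the track. -/
def OnTrack (I : Set ℤ) (w : ℤ → V) (v u : V) : Prop :=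
  ∃ k ∈ I, k + 1 ∈ I ∧ s(w k, w (k + 1)) = s(v, u)

namespace Track

variable {I : Set ℤ} {w : ℤ → V}

lemma exists_isMaxTrack (T : Track G I w) :
    ∃ I' w', Track G I' w' ∧ IsMaxTrack G I' w' ∧ I ⊆ I' ∧ Set.EqOn w w' I := by
  classical
  let gr : Set ℤ → (ℤ → V) → Set (ℤ × V) := fun I w => {p | p.1 ∈ I ∧ p.2 = w p.1}
  have hgr : ∀ {I w I' w'}, gr I w ⊆ gr I' w' ↔ I ⊆ I' ∧ Set.EqOn w w' I := by
    intro I w I' w'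
    constructor
    · intro h
      have := fun k (hk : k ∈ I) => h (show (k, w k) ∈ gr I w from ⟨hk, rfl⟩)
      exact ⟨fun k hk => (this k hk).1, fun k hk => (this k hk).2⟩
    · rintro ⟨h1, h2⟩ ⟨k, v⟩ ⟨hk, hv⟩
      exact ⟨h1 hk, hv.trans (h2 hk)⟩
  obtain ⟨S, hTS, ⟨I', w', T', rfl⟩, hmax⟩ := zorn_subset_nonempty
    {S | ∃ I w, Track G I w ∧ S = gr I w} (by
      intro c hc hchain ⟨S₀, hS₀⟩
      have hrep : ∀ S ∈ c, ∃ I w, Track G I w ∧ S = gr I w := fun S hS => hc hS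
      obtain ⟨I₀, w₀, T₀, -⟩ := hrep S₀ hS₀
      let J : Set ℤ := {k | ∃ v, (k, v) ∈ ⋃₀ c}
      let W : ℤ → V := fun k => if h : ∃ v, (k, v) ∈ ⋃₀ c then h.choose else w₀ 0
      have hdir : ∀ p ∈ ⋃₀ c, ∀ q ∈ ⋃₀ c, ∃ I w, gr I w ∈ c ∧ Track G I w ∧ p ∈ gr I w ∧
          q ∈ gr I w := by
        rintro p ⟨S, hS, hp⟩ q ⟨S', hS', hq⟩
        rcases hchain.total hS hS' with h | h
        · obtain ⟨I, w, T, rfl⟩ := hrep S' hS'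
          exact ⟨I, w, hS', T, h hp, hq⟩
        · obtain ⟨I, w, T, rfl⟩ := hrep S hS
          exact ⟨I, w, hS, T, hp, h hq⟩
      have hW : ∀ k v, (k, v) ∈ ⋃₀ c → W k = v := by
        intro k v hv
        have hk : ∃ v, (k, v) ∈ ⋃₀ c := ⟨v, hv⟩
        have e : W k = hk.choose := dif_pos hk
        obtain ⟨I, w, -, -, h1, h2⟩ := hdir _ hv _ hk.choose_spec
        rw [e]
        exact h2.2.trans h1.2.symm
      have hJ : ∀ I w, gr I w ∈ c → I ⊆ J ∧ Set.EqOn w W I := fun I w hc =>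
        ⟨fun k hk => ⟨w k, _, hc, hk, rfl⟩, fun k hk => (hW k (w k) ⟨_, hc, hk, rfl⟩).symm⟩
      have hcom : ∀ k ∈ J, ∀ l ∈ J, ∃ I w, Track G I w ∧ k ∈ I ∧ l ∈ I ∧ I ⊆ J ∧
          Set.EqOn w W I := by
        rintro k ⟨v, hv⟩ l ⟨u, hu⟩
        obtain ⟨I, w, hI, T, h1, h2⟩ := hdir _ hv _ hu
        exact ⟨I, w, T, h1.1, h2.1, hJ I w hI⟩
      have hT : Track G J W := by
        have hord : J.OrdConnected := ⟨fun k hk l hl x hx => by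
          obtain ⟨I, w, T, h1, h2, h3, -⟩ := hcom k hk l hl
          exact h3 (T.ord.out h1 h2 hx)⟩
        refine ⟨hord, ?_, ?_, ?_, ?_⟩
        · obtain ⟨I, w, T, rfl⟩ := hrep S₀ hS₀
          obtain ⟨k, h1, h2⟩ := T.exists_edge
          exact ⟨k, (hJ I w hS₀).1 h1, (hJ I w hS₀).1 h2⟩
        · intro k hk hk'
          obtain ⟨I, w, T, h1, h2, h3, h4⟩ := hcom k hk _ hk'
          rw [← h4 h1, ← h4 h2]
          exact T.adj k h1 h2
        · intro i j hi hj hij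
          obtain ⟨I, w, T, h1, h2, h3, h4⟩ := hcom (min i j - 1) (by
              rcases min_cases i j with ⟨h, -⟩ | ⟨h, -⟩ <;> rw [h]
              exacts [hi.1, hj.1]) (max i j + 1) (by
              rcases max_cases i j with ⟨h, -⟩ | ⟨h, -⟩ <;> rw [h]
              exacts [hi.2, hj.2])
          have hm : ∀ x, min i j - 1 ≤ x → x ≤ max i j + 1 → x ∈ I := fun x ha hb =>
            T.ord.out h1 h2 ⟨ha, hb⟩
          have hi' := hm i (by omega) (by omega)
          have hj' := hm j (by omega) (by omega)
          rw [← h4 hi', ← h4 hj'] at hij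
          exact T.inj i j ⟨hm _ (by omega) (by omega), hm _ (by omega) (by omega)⟩
            ⟨hm _ (by omega) (by omega), hm _ (by omega) (by omega)⟩ hij
        · intro k l hk hk' hl hl' hkl
          obtain ⟨I, w, T, h1, h2, h3, h4⟩ := hcom (min k l) (by
              rcases min_cases k l with ⟨h, -⟩ | ⟨h, -⟩ <;> rw [h]
              exacts [hk, hl]) (max k l + 1) (by
              rcases max_cases k l with ⟨h, -⟩ | ⟨h, -⟩ <;> rw [h]
              exacts [hk', hl'])
          have hm : ∀ x, min k l ≤ x → x ≤ max k l + 1 → x ∈ I := fun x ha hb =>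
            T.ord.out h1 h2 ⟨ha, hb⟩
          have a1 := hm k (by omega) (by omega)
          have a2 := hm (k + 1) (by omega) (by omega)
          have a3 := hm l (by omega) (by omega)
          have a4 := hm (l + 1) (by omega) (by omega)
          rw [← h4 a1, ← h4 a2, ← h4 a3, ← h4 a4] at hkl
          exact T.edge_inj k l a1 a2 a3 a4 hkl
      refine ⟨gr J W, ⟨J, W, hT, rfl⟩, fun S hS => ?_⟩
      obtain ⟨I, w, T, rfl⟩ := hrep S hS
      exact hgr.2 (hJ I w hS)) (gr I w) ⟨I, w, T, rfl⟩
  refine ⟨I', w', T', fun I'' w'' T'' h1 h2 => ?_, hgr.1 hTS⟩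
  exact (hgr.1 (hmax ⟨I'', w'', T'', rfl⟩ (hgr.2 ⟨h1, h2⟩))).1

end Track

lemma IsMaxTrack.reverse {I : Set ℤ} {w : ℤ → V} (h : IsMaxTrack G I w) :
    IsMaxTrack G {k | -k ∈ I} (fun k => w (-k)) := by
  intro I' w' T' h1 h2 k hk
  have := h _ _ T'.reverse (fun k hk => h1 (by simpa using hk)) (fun k hk => by
    have := h2 (x := -k) (by simpa using hk)
    simpa using this)
  exact this (by simpa using hk)

namespace Track

variable {I : Set ℤ} {w : ℤ → V}

lemma lt_of_inner (T : Track G I w) {a M : ℤ} (ha : IsInner I a) (hM : M ∈ I) (hM1 : M + 1 ∉ I) :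
    a + 1 ≤ M := by
  by_contra! h
  exact hM1 (T.ord.out hM ha.2 ⟨by omega, by omega⟩)

lemma le_of_mem (T : Track G I w) {a M : ℤ} (ha : a ∈ I) (hM : M ∈ I) (hM1 : M + 1 ∉ I) :
    a ≤ M := by
  by_contra! h
  exact hM1 (T.ord.out hM ha ⟨by omega, by omega⟩)

lemma ge_of_mem (T : Track G I w) {a m : ℤ} (ha : a ∈ I) (hm : m ∈ I) (hm1 : m - 1 ∉ I) :
    m ≤ a := by
  by_contra! h
  exact hm1 (T.ord.out ha hm ⟨by omega, by omega⟩)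

/-- Extending a track at its last vertex. -/
lemma extend (T : Track G I w) {M : ℤ} (hM : M ∈ I) (hM1 : M + 1 ∉ I) (hMu : Unglued I w M)
    {u : V} (hu : G.Adj (w M) u) (hoff : ¬ OnTrack I w (w M) u) :
    Track G (insert (M + 1) I) (Function.update w (M + 1) u) := by
  have hle : ∀ k ∈ I, k ≤ M := fun k hk => T.le_of_mem hk hM hM1
  have hI : ∀ k, k ∈ insert (M + 1) I → k ≠ M + 1 → k ∈ I := fun k hk h => hk.resolve_left h
  have hw : ∀ k, k ≠ M + 1 → Function.update w (M + 1) u k = w k := fun k h =>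
    Function.update_of_ne h _ _
  have hle' : ∀ k, k ∈ insert (M + 1) I → k ≤ M + 1 := by
    rintro k (rfl | hk)
    · exact le_rfl
    · have := hle k hk; omega
  have hM1' : Function.update w (M + 1) u (M + 1) = u := Function.update_self _ _ _
  refine ⟨⟨?_⟩, ?_, ?_, ?_, ?_⟩
  · intro a ha b hb c hc
    by_cases hcM : c = M + 1
    · exact Or.inl hcM
    · have := hle' b hb
      have hc2 := hc.2
      have hc1 := hc.1
      exact Or.inr (T.ord.out (hI a ha (by omega)) hM ⟨hc1, by omega⟩)
  · obtain ⟨k, h1, h2⟩ := T.exists_edge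
    exact ⟨k, Or.inr h1, Or.inr h2⟩
  · intro k hk hk'
    by_cases hkM : k = M
    · subst hkM
      rw [hM1', hw k (by omega)]
      exact hu
    · have := hle' _ hk'
      rw [hw k (by omega), hw _ (by omega)]
      exact T.adj k (hI _ hk (by omega)) (hI _ hk' (by omega))
  · intro i j hi hj hij
    have h1 := hle' _ hi.2
    have h2 := hle' _ hj.2
    rw [hw i (by omega), hw j (by omega)] at hij
    by_cases hiM : i = M
    · subst hiM
      by_contra hne
      have hj' : IsInner I j := ⟨hI _ hj.1 (by omega), hI _ hj.2 (by omega)⟩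
      exact hne (hMu j hj' hij.symm).symm
    · have hi' : IsInner I i := ⟨hI _ hi.1 (by omega), hI _ hi.2 (by omega)⟩
      by_cases hjM : j = M
      · subst hjM
        exact hMu i hi' hij
      · exact T.inj i j hi' ⟨hI _ hj.1 (by omega), hI _ hj.2 (by omega)⟩ hij
  · intro k l hk hk' hl hl' hkl
    have h1 := hle' _ hk'
    have h2 := hle' _ hl'
    rw [hw k (by omega), hw l (by omega)] at hkl
    by_cases hkM : k = M <;> by_cases hlM : l = M
    · omega
    · rw [hkM, hM1', hw (l + 1) (by omega)] at hkl
      exact (hoff ⟨l, hI _ hl (by omega), hI _ hl' (by omega), hkl.symm⟩).elim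
    · rw [hlM, hM1', hw (k + 1) (by omega)] at hkl
      exact (hoff ⟨k, hI _ hk (by omega), hI _ hk' (by omega), hkl⟩).elim
    · rw [hw _ (by omega), hw _ (by omega)] at hkl
      exact T.edge_inj k l (hI _ hk (by omega)) (hI _ hk' (by omega)) (hI _ hl (by omega))
        (hI _ hl' (by omega)) hkl

lemma right_cases (T : Track G I w) (hmax : IsMaxTrack G I w) :
    RightOpen G I w ∨ GluedRight I w ∨ IsCycleTrack I w := by
  by_cases hinf : ∀ k ∈ I, k + 1 ∈ I
  · exact Or.inl (Or.inl hinf)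
  push Not at hinf
  obtain ⟨M, hM, hM1⟩ := hinf
  by_cases hg : ∃ a, IsInner I a ∧ w a = w M
  · exact Or.inr (Or.inl ⟨M, hM, hM1, hg⟩)
  push Not at hg
  have hMu : Unglued I w M := fun b hb h => (hg b hb h).elim
  by_cases hleaf : ∀ u, G.Adj (w M) u → u = w (M - 1)
  · exact Or.inl (Or.inr ⟨M, hM, hM1, hMu, hleaf⟩)
  push Not at hleaf
  obtain ⟨u, hu, hne⟩ := hleaf
  have hon : OnTrack I w (w M) u := by
    by_contra hoff
    exact hM1 (hmax _ _ (T.extend hM hM1 hMu hu hoff) (Set.subset_insert _ _)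
      (fun k hk => (Function.update_of_ne (by rintro rfl; exact hM1 hk) _ _).symm)
      (Set.mem_insert _ _))
  obtain ⟨k, hk, hk', he⟩ := hon
  have hkM := T.le_of_mem hk' hM hM1
  rcases Sym2.eq_iff.1 he with ⟨h1, h2⟩ | ⟨h1, h2⟩
  · have hk1 : k - 1 ∉ I := fun h => hg k ⟨h, hk'⟩ h1
    refine Or.inr (Or.inr ⟨k, M, by omega, ?_, h1, hMu⟩)
    refine Set.Subset.antisymm (fun x hx => ⟨T.ge_of_mem hx hk hk1, T.le_of_mem hx hM hM1⟩)
      (T.ord.out hk hM)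
  · by_cases hkM' : k + 1 = M
    · subst hkM'
      rw [add_sub_cancel_right] at hne
      exact (hne h1.symm).elim
    · exact (hg (k + 1) ⟨by simpa using hk, T.ord.out hk hM ⟨by omega, by omega⟩⟩ h2).elim

lemma leftOpen_of_reverse {I : Set ℤ} {w : ℤ → V}
    (h : RightOpen G {k | -k ∈ I} (fun k => w (-k))) : LeftOpen G I w := by
  rcases h with h | ⟨M, hM, hM1, hu, hl⟩
  · refine Or.inl fun k hk => ?_
    have := h (-k) (by simpa using hk)
    rwa [Set.mem_ofPred_eq, neg_add', neg_neg] at this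
  · refine Or.inr ⟨-M, hM, by rwa [Set.mem_ofPred_eq, neg_add'] at hM1, unglued_reverse.1 hu,
      fun u hadj => ?_⟩
    have e : -(M - 1) = -M + 1 := by ring
    have := hl u hadj
    simpa only [e] using this

lemma left_cases (T : Track G I w) (hmax : IsMaxTrack G I w) :
    LeftOpen G I w ∨ GluedLeft I w ∨ IsCycleTrack I w := by
  rcases T.reverse.right_cases hmax.reverse with h | h | h
  · exact Or.inl (leftOpen_of_reverse h)
  · obtain ⟨M, hM, hM1, a, ha, haw⟩ := h
    exact Or.inr (Or.inl ⟨-M, hM, by rwa [Set.mem_ofPred_eq, neg_add'] at hM1, -a,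
      inner_reverse.1 ha, haw⟩)
  · obtain ⟨m, M, hmM, hI, hw, hu⟩ := h
    have hI' : I = Set.Icc (-M) (-m) := by
      ext k
      have : -k ∈ {k | -k ∈ I} ↔ -k ∈ Set.Icc m M := by rw [hI]
      rw [Set.mem_ofPred_eq, neg_neg] at this
      rw [this, Set.mem_Icc, Set.mem_Icc]
      omega
    refine Or.inr (Or.inr ⟨-M, -m, by omega, hI', hw.symm, ?_⟩)
    have := unglued_reverse.1 hu
    intro b hb hbw
    have h2 := this b hb (hbw.trans hw)
    rw [h2, hI'] at hb
    have := hb.1.1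
    omega

lemma extra_of_gluedRight (T : Track G I w) {M a : ℤ} (hM : M ∈ I) (hM1 : M + 1 ∉ I)
    (ha : IsInner I a) (haw : w a = w M) : Extra G I w a (w (M - 1)) := by
  have haM := T.lt_of_inner ha hM hM1
  have hM' : M - 1 ∈ I := T.ord.out (T.mem_of_inner ha) hM ⟨by omega, by omega⟩
  have hMM : M - 1 + 1 ∈ I := by simpa using hM
  have hadj : G.Adj (w a) (w (M - 1)) := by
    have := T.adj _ hM' hMM
    rw [sub_add_cancel] at this
    rw [haw]
    exact this.symm
  refine ⟨ha, hadj, fun h => ?_, fun h => ?_⟩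
  · have := T.edge_ne_left hM' hMM ha (by omega)
    apply this
    rw [h, sub_add_cancel, haw, Sym2.eq_swap]
  · by_cases hk : a = M - 1
    · subst hk
      exact hadj.ne rfl
    · have := T.edge_ne hM' hMM (T.mem_of_inner ha) ha.2 (Ne.symm hk)
      apply this
      rw [← h, sub_add_cancel, haw, Sym2.eq_swap]

lemma extra_of_gluedLeft (T : Track G I w) {m a : ℤ} (hm : m ∈ I) (hm1 : m - 1 ∉ I)
    (ha : IsInner I a) (haw : w a = w m) : Extra G I w a (w (m + 1)) := by
  have e : -(-m + 1) = m - 1 := by ring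
  have e' : -(-m - 1) = m + 1 := by ring
  have := T.reverse.extra_of_gluedRight (M := -m) (a := -a) (by simpa using hm)
    (by rwa [Set.mem_ofPred_eq, e]) (inner_reverse.2 (by rwa [neg_neg])) (by simpa using haw)
  have := extra_reverse.1 this
  simpa only [e', neg_neg] using this

/-- A maximal track other than a cycle contains all edges at its vertices. -/
lemma onTrack_of_adj (T : Track G I w) (hG : NArcConn ↥(GraphRealization G) 7)
    (hl : LeftOpen G I w ∨ GluedLeft I w) (hr : RightOpen G I w ∨ GluedRight I w) {i : ℤ}
    (hi : i ∈ I) {x : V} (hx : G.Adj (w i) x) : OnTrack I w (w i) x := by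
  by_contra hoff
  have hin : ∀ i, IsInner I i → G.Adj (w i) x → ¬ OnTrack I w (w i) x → False := by
    intro i hi hx hoff
    have hmem := T.mem_of_inner hi
    have hE : Extra G I w i x := by
      refine ⟨hi, hx, ?_, ?_⟩
      · rintro rfl
        exact hoff ⟨i - 1, hi.1, by simpa using hmem, by rw [sub_add_cancel, Sym2.eq_swap]⟩
      · rintro rfl
        exact hoff ⟨i, hmem, hi.2, rfl⟩
    have hL : ∀ m ∈ I, m - 1 ∉ I → ∀ a, IsInner I a → w a = w m → (a, w (m + 1)) ≠ (i, x) := by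
      rintro m hm hm1 a ha haw h
      cases h
      have := T.ge_of_mem ha.1 hm hm1
      exact hoff ⟨m, hm, T.ord.out hm ha.1 ⟨by omega, by
        by_contra! h
        have h' : i = m + 1 := by omega
        have := T.adj m hm (h' ▸ hmem)
        rw [h'] at haw
        exact this.ne haw.symm⟩, by rw [haw]⟩
    have hR : ∀ M ∈ I, M + 1 ∉ I → ∀ a, IsInner I a → w a = w M → (a, w (M - 1)) ≠ (i, x) := by
      rintro M hM hM1 a ha haw h
      cases h
      have := T.lt_of_inner ha hM hM1
      exact hoff ⟨M - 1, T.ord.out hmem hM ⟨by omega, by omega⟩, by simpa using hM,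
        by rw [haw, sub_add_cancel, Sym2.eq_swap]⟩
    rcases hl with hl | ⟨m, hm, hm1, a, ha, haw⟩ <;> rcases hr with hr | ⟨M, hM, hM1, b, hb, hbw⟩
    · exact T.not_extra hG hl hr hE
    · exact T.not_two_extra_of_leftOpen hG hl (T.extra_of_gluedRight hM hM1 hb hbw) hE
        (hR M hM hM1 b hb hbw)
    · exact T.not_two_extra hG hr (T.extra_of_gluedLeft hm hm1 ha haw) hE (hL m hm hm1 a ha haw)
    · refine T.not_three_extra hG (T.extra_of_gluedLeft hm hm1 ha haw)
        (T.extra_of_gluedRight hM hM1 hb hbw) hE (fun h => ?_) (hL m hm hm1 a ha haw)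
        (hR M hM hM1 b hb hbw)
      have h1 := (Prod.ext_iff.1 h).1
      have h2 := (Prod.ext_iff.1 h).2
      simp only at h1 h2
      subst h1
      have h3 := T.ge_of_mem ha.1 hm hm1
      have h4 := T.lt_of_inner ha hM hM1
      have := T.edge_inj m (M - 1) hm (T.ord.out hm hM ⟨by omega, by omega⟩)
        (T.ord.out hm hM ⟨by omega, by omega⟩) (by simpa using hM)
        (by rw [h2, sub_add_cancel, ← haw, hbw, Sym2.eq_swap])
      omega
  by_cases hii : IsInner I i
  · exact hin i hii hx hoff
  by_cases hi1 : i - 1 ∈ I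
  · have hi2 : i + 1 ∉ I := fun h => hii ⟨hi1, h⟩
    rcases hr with (hr | ⟨M, hM, hM1, -, hleaf⟩) | ⟨M, hM, hM1, b, hb, hbw⟩
    · exact hi2 (hr i hi)
    · obtain rfl : i = M := le_antisymm (T.le_of_mem hi hM hM1) (T.le_of_mem hM hi hi2)
      rw [hleaf x hx] at hoff
      exact hoff ⟨i - 1, hi1, by simpa using hi, by rw [sub_add_cancel, Sym2.eq_swap]⟩
    · obtain rfl : i = M := le_antisymm (T.le_of_mem hi hM hM1) (T.le_of_mem hM hi hi2)
      exact hin b hb (hbw ▸ hx) (hbw ▸ hoff)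
  · rcases hl with (hl | ⟨M, hM, hM1, -, hleaf⟩) | ⟨M, hM, hM1, b, hb, hbw⟩
    · exact hi1 (hl i hi)
    · obtain rfl : i = M := le_antisymm (T.ge_of_mem hM hi hi1) (T.ge_of_mem hi hM hM1)
      rw [hleaf x hx] at hoff
      obtain ⟨k, hk, hk'⟩ := T.exists_edge
      exact hoff ⟨i, hi, T.ord.out hi hk' ⟨by omega, by have := T.ge_of_mem hk hi hi1; omega⟩, rfl⟩
    · obtain rfl : i = M := le_antisymm (T.ge_of_mem hM hi hi1) (T.ge_of_mem hi hM hM1)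
      exact hin b hb (hbw ▸ hx) (hbw ▸ hoff)

/-- A cycle with a further edge can be cut open at that edge. -/
lemma rotate {m M a : ℤ} (T : Track G (Set.Icc m M) w) (hw : w m = w M)
    (hu : Unglued (Set.Icc m M) w M) (hma : m < a) (haM : a ≤ M) {x : V} (hx : G.Adj (w a) x)
    (hoff : ¬ OnTrack (Set.Icc m M) w (w a) x) :
    ∃ w', Track G (Set.Icc 0 (M - m + 1)) w' ∧ w' 0 = w' (M - m) := by
  have hmem : ∀ k, m ≤ k → k ≤ M → k ∈ Set.Icc m M := fun k h1 h2 => ⟨h1, h2⟩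
  have hinj : ∀ k l, m < k → k ≤ M → m < l → l ≤ M → w k = w l → k = l := by
    intro k l h1 h2 h3 h4 h
    have hin : ∀ k, m < k → k < M → IsInner (Set.Icc m M) k := fun k h1 h2 =>
      ⟨hmem _ (by omega) (by omega), hmem _ (by omega) (by omega)⟩
    rcases h2.lt_or_eq with h2 | rfl
    · rcases h4.lt_or_eq with h4 | rfl
      · exact T.inj k l (hin k h1 h2) (hin l h3 h4) h
      · exact hu k (hin k h1 h2) h
    · rcases h4.lt_or_eq with h4 | rfl
      · exact (hu l (hin l h3 h4) h.symm).symm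
      · rfl
  let c : ℤ → ℤ := fun k => if k ≤ M - a then a + k else a + k - (M - m)
  let e : ℤ → ℤ := fun k => if k < M - a then a + k else a + k - (M - m)
  let w' : ℤ → V := fun k => if k ≤ M - m then w (c k) else x
  have hw1 : ∀ k, k ≤ M - m → w' k = w (c k) := fun k h => if_pos h
  have hw2 : w' (M - m + 1) = x := if_neg (by omega)
  have hwn : w' (M - m) = w a := by
    rw [hw1 _ le_rfl]
    congr 1
    simp only [c]
    rw [if_neg (by omega)]
    ring
  have he : ∀ k, 0 ≤ k → k < M - m → m ≤ e k ∧ e k + 1 ≤ M ∧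
      s(w' k, w' (k + 1)) = s(w (e k), w (e k + 1)) := by
    intro k h1 h2
    rw [hw1 k (by omega), hw1 (k + 1) (by omega)]
    simp only [c, e]
    rcases lt_trichotomy k (M - a) with h | h | h
    · rw [if_pos h, if_pos h.le, if_pos (by omega)]
      exact ⟨by omega, by omega, by rw [add_assoc]⟩
    · rw [if_neg (by omega), if_pos h.le, if_neg (by omega)]
      refine ⟨by omega, by omega, ?_⟩
      have e1 : a + k = M := by omega
      have e2 : a + k - (M - m) = m := by omega
      have e3 : a + (k + 1) - (M - m) = m + 1 := by omega
      rw [e1, e3, ← hw]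
      congr 2
      · omega
      · ring
    · rw [if_neg (by omega), if_neg (by omega), if_neg (by omega)]
      refine ⟨by omega, by omega, ?_⟩
      congr 3
      ring
  refine ⟨w', ⟨Set.ordConnected_Icc, ⟨0, ⟨le_rfl, by omega⟩, ⟨by omega, by omega⟩⟩, ?_, ?_, ?_⟩, ?_⟩
  · intro k hk hk'
    by_cases hkn : k = M - m
    · subst hkn
      rwa [hw2, hwn]
    · obtain ⟨h1, h2, h3⟩ := he k hk.1 (by have := hk'.2; omega)
      rw [← SimpleGraph.mem_edgeSet, h3]
      exact T.adj _ (hmem _ h1 (by omega)) (hmem _ (by omega) h2)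
  · intro i j hi hj hij
    have hi1 := hi.1.1
    have hi2 := hi.2.2
    have hj1 := hj.1.1
    have hj2 := hj.2.2
    rw [hw1 i (by omega), hw1 j (by omega)] at hij
    have hc : ∀ k, 0 < k → k ≤ M - m → m < c k ∧ c k ≤ M := by
      intro k h1 h2
      simp only [c]
      split_ifs <;> omega
    have h1 := hc i (by omega) (by omega)
    have h2 := hc j (by omega) (by omega)
    have := hinj _ _ h1.1 h1.2 h2.1 h2.2 hij
    simp only [c] at this
    split_ifs at this <;> omega
  · intro k l hk hk' hl hl' hkl
    have hk2 := hk'.2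
    have hl2 := hl'.2
    have hke := he k hk.1
    have hle := he l hl.1
    by_cases hkM : k = M - m <;> by_cases hlM : l = M - m
    · omega
    · obtain ⟨h1, h2, h3⟩ := hle (by omega)
      subst hkM
      rw [hw2, hwn, h3] at hkl
      exact (hoff ⟨e l, hmem _ h1 (by omega), hmem _ (by omega) h2, hkl.symm⟩).elim
    · obtain ⟨h1, h2, h3⟩ := hke (by omega)
      subst hlM
      rw [hw2, hwn, h3] at hkl
      exact (hoff ⟨e k, hmem _ h1 (by omega), hmem _ (by omega) h2, hkl⟩).elim
    · obtain ⟨h1, h2, h3⟩ := hke (by omega)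
      obtain ⟨h4, h5, h6⟩ := hle (by omega)
      rw [h3, h6] at hkl
      have := T.edge_inj _ _ (hmem _ h1 (by omega)) (hmem _ (by omega) h2) (hmem _ h4 (by omega))
        (hmem _ (by omega) h5) hkl
      have hk1 := hk.1
      have hl1 := hl.1
      simp only [e] at this
      split_ifs at this <;> omega
  · rw [hwn, hw1 0 (by omega)]
    congr 1
    simp only [c]
    rw [if_pos (by omega), add_zero]

lemma of_adj {v u : V} (h : G.Adj v u) :
    Track G (Set.Icc 0 1) (fun k => if k = 0 then v else u) := by
  have h0 : ∀ k : ℤ, k ∈ Set.Icc (0 : ℤ) 1 → k + 1 ∈ Set.Icc (0 : ℤ) 1 → k = 0 := fun k h1 h2 => by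
    have := h1.1
    have := h2.2
    omega
  refine ⟨Set.ordConnected_Icc, ⟨0, by simp, by simp⟩, ?_, ?_, ?_⟩
  · intro k h1 h2
    obtain rfl := h0 k h1 h2
    simpa using h
  · intro i j hi
    have := hi.1.1
    have := hi.2.2
    omega
  · intro k l h1 h2 h3 h4 _
    rw [h0 k h1 h2, h0 l h3 h4]

end Track

/-- A connected graph is covered by any track all of whose vertices have only track edges. -/
lemma NArcConn.covers_of_onTrack (hG : NArcConn ↥(GraphRealization G) 7) {I : Set ℤ} {w : ℤ → V}
    (T : Track G I w) (h : ∀ i ∈ I, ∀ x, G.Adj (w i) x → OnTrack I w (w i) x) :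
    (∀ v, ∃ k ∈ I, w k = v) ∧ ∀ v u, G.Adj v u → OnTrack I w v u := by
  have huniv : w '' I = Set.univ := by
    refine hG.eq_univ_of_closed (by norm_num) ?_ ?_
    · obtain ⟨k, hk, -⟩ := T.exists_edge
      exact ⟨_, k, hk, rfl⟩
    · rintro _ ⟨i, hi, rfl⟩ x hx
      obtain ⟨k, hk, hk', he⟩ := h i hi x hx
      rcases Sym2.eq_iff.1 he with ⟨-, h2⟩ | ⟨h1, -⟩
      · exact ⟨_, hk', h2⟩
      · exact ⟨_, hk, h1⟩
  have hv : ∀ v, ∃ k ∈ I, w k = v := fun v => by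
    have : v ∈ w '' I := huniv ▸ Set.mem_univ v
    exact this
  refine ⟨hv, fun v u hvu => ?_⟩
  obtain ⟨k, hk, rfl⟩ := hv v
  exact h k hk u hvu

/-- A 7-arc connected graph with an edge is covered by a track, which is a cycle or has each of its
ends open or glued to an inner vertex. -/
theorem NArcConn.exists_track (hG : NArcConn ↥(GraphRealization G) 7)
    (hnt : Nontrivial ↥(GraphRealization G)) :
    ∃ I w, Track G I w ∧ (∀ v, ∃ k ∈ I, w k = v) ∧ (∀ v u, G.Adj v u → OnTrack I w v u) ∧
      (IsCycleTrack I w ∨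
        (LeftOpen G I w ∨ GluedLeft I w) ∧ (RightOpen G I w ∨ GluedRight I w)) := by
  obtain ⟨v₀, u₀, h₀⟩ := hG.exists_adj (by norm_num) hnt
  obtain ⟨I, w, T, hmax, -, -⟩ := (Track.of_adj h₀).exists_isMaxTrack
  have main : ∀ I w, Track G I w → IsMaxTrack G I w → ¬ IsCycleTrack I w →
    ∃ I w, Track G I w ∧ (∀ v, ∃ k ∈ I, w k = v) ∧ (∀ v u, G.Adj v u → OnTrack I w v u) ∧
      (IsCycleTrack I w ∨
        (LeftOpen G I w ∨ GluedLeft I w) ∧ (RightOpen G I w ∨ GluedRight I w)) := by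
    intro I w T hmax hc
    have hl := (or_assoc.2 (T.left_cases hmax)).resolve_right hc
    have hr := (or_assoc.2 (T.right_cases hmax)).resolve_right hc
    obtain ⟨h1, h2⟩ := hG.covers_of_onTrack T (fun i hi x hx => T.onTrack_of_adj hG hl hr hi hx)
    exact ⟨I, w, T, h1, h2, Or.inr ⟨hl, hr⟩⟩
  by_cases hc : IsCycleTrack I w
  swap
  · exact main I w T hmax hc
  by_cases hon : ∀ i ∈ I, ∀ x, G.Adj (w i) x → OnTrack I w (w i) x
  · obtain ⟨h1, h2⟩ := hG.covers_of_onTrack T hon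
    exact ⟨I, w, T, h1, h2, Or.inl hc⟩
  push Not at hon
  obtain ⟨a, ha, x, hx, hoff⟩ := hon
  obtain ⟨m, M, hmM, rfl, hw, hu⟩ := hc
  obtain ⟨w', T', hw'⟩ : ∃ w', Track G (Set.Icc 0 (M - m + 1)) w' ∧ w' 0 = w' (M - m) := by
    rcases ha.1.lt_or_eq with h | rfl
    · exact T.rotate hw hu h ha.2 hx hoff
    · rw [hw] at hx hoff
      exact T.rotate hw hu hmM le_rfl hx hoff
  obtain ⟨I'', w'', T'', hmax'', hI, hw''⟩ := T'.exists_isMaxTrack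
  have h0 : (0 : ℤ) ∈ Set.Icc 0 (M - m + 1) := ⟨le_rfl, by omega⟩
  have hn : IsInner I'' (M - m) := ⟨hI ⟨by omega, by omega⟩, hI ⟨by omega, by omega⟩⟩
  have h0n : w'' 0 = w'' (M - m) := by
    rw [← hw'' h0, ← hw'' (show M - m ∈ Set.Icc 0 (M - m + 1) from ⟨by omega, by omega⟩), hw']
  refine main I'' w'' T'' hmax'' ?_
  rintro ⟨m', M', hmM', rfl, hwm, hu'⟩
  have h00 := hI h0
  have h01 := h00.2
  rcases h00.1.lt_or_eq with h | h
  · have := T''.inj 0 (M - m) ⟨⟨by omega, by omega⟩, hI ⟨by omega, by omega⟩⟩ hn h0n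
    omega
  · have := hu' _ hn (by rw [← h0n, ← hwm, h])
    have := hn.2.2
    omega

end MaximalTracks

section QuotientMaps

variable {A X Y : Type*} [TopologicalSpace A] [TopologicalSpace X] [TopologicalSpace Y]

/-- A continuous surjection that is locally proper over a Hausdorff space is a quotient map. -/
lemma isQuotientMap_of_locally_compact_preimage [T2Space X] {f : A → X} (hf : Continuous f)
    (hs : Function.Surjective f) (h : ∀ y, ∃ N ∈ 𝓝 y, ∃ K, IsCompact K ∧ f ⁻¹' N ⊆ K) :
    IsQuotientMap f := by
  refine IsClosedMap.isQuotientMap (fun C hC => ?_) hf hs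
  refine isClosed_of_closure_subset fun y hy => ?_
  obtain ⟨N, hN, K, hK, hNK⟩ := h y
  have hcl : IsClosed (f '' (K ∩ C)) := ((hK.inter_right hC).image hf).isClosed
  have hy' : y ∈ closure (f '' (K ∩ C)) := by
    rw [mem_closure_iff_nhds] at hy ⊢
    intro t ht
    obtain ⟨_, ⟨h1, h2⟩, x, hx, rfl⟩ := hy (t ∩ N) (Filter.inter_mem ht hN)
    exact ⟨f x, h1, x, ⟨hNK h2, hx⟩, rfl⟩
  rw [hcl.closure_eq] at hy'
  exact Set.image_mono Set.inter_subset_right hy'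

/-- Two quotients of the same space by the same relation are homeomorphic. -/
lemma nonempty_homeomorph_of_ker_eq {f : A → X} {g : A → Y} (hf : IsQuotientMap f)
    (hg : IsQuotientMap g) (h : ∀ a b, f a = f b ↔ g a = g b) : Nonempty (X ≃ₜ Y) := by
  have hfg : ∀ a b, f a = f b → g a = g b := fun a b => (h a b).1
  have hgf : ∀ a b, g a = g b → f a = f b := fun a b => (h a b).2
  have e1 : ∀ a, g (Function.surjInv hf.surjective (f a)) = g a := fun a =>
    hfg _ _ (Function.surjInv_eq hf.surjective _)
  have e2 : ∀ a, f (Function.surjInv hg.surjective (g a)) = f a := fun a =>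
    hgf _ _ (Function.surjInv_eq hg.surjective _)
  refine ⟨⟨⟨fun x => g (Function.surjInv hf.surjective x),
    fun y => f (Function.surjInv hg.surjective y), fun x => ?_, fun y => ?_⟩, ?_, ?_⟩⟩
  · obtain ⟨a, rfl⟩ := hf.surjective x
    simp only [e1, e2]
  · obtain ⟨a, rfl⟩ := hg.surjective y
    simp only [e1, e2]
  · refine hf.continuous_iff.2 ?_
    exact hg.continuous.congr fun a => (e1 a).symm
  · refine hg.continuous_iff.2 ?_
    exact hf.continuous.congr fun a => (e2 a).symm

/-- Two quotients of a set `D` of reals with the same set `J` of representatives are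
homeomorphic. -/
lemma nonempty_homeomorph_of_retract {D J : Set ℝ} {f : D → X} {g : D → Y} (hf : IsQuotientMap f)
    (hg : IsQuotientMap g) (r : D → D) (hr : ∀ x, (r x : ℝ) ∈ J) (hfr : ∀ x, f (r x) = f x)
    (hgr : ∀ x, g (r x) = g x) (hfJ : ∀ x y : D, (x : ℝ) ∈ J → (y : ℝ) ∈ J → f x = f y → x = y)
    (hgJ : ∀ x y : D, (x : ℝ) ∈ J → (y : ℝ) ∈ J → g x = g y → x = y) : Nonempty (X ≃ₜ Y) := by
  refine nonempty_homeomorph_of_ker_eq hf hg fun a b => ?_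
  rw [← hfr a, ← hfr b, ← hgr a, ← hgr b]
  exact ⟨fun h => by rw [hfJ _ _ (hr a) (hr b) h], fun h => by rw [hgJ _ _ (hr a) (hr b) h]⟩

end QuotientMaps

section TrackCurves

variable {V : Type*} {G : SimpleGraph V}

/-- The curve in the realization that follows a sequence of vertices. -/
noncomputable def trackCurve (w : ℤ → V) (x : ℝ) : V → ℝ :=
  edgePoint (w ⌊x⌋) (w (⌊x⌋ + 1)) (Int.fract x)

/-- The real interval spanned by an interval of integers. -/
def hull (I : Set ℤ) : Set ℝ := {x | ⌊x⌋ ∈ I ∧ ⌈x⌉ ∈ I}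

lemma hull_Icc (m M : ℤ) : hull (Set.Icc m M) = Set.Icc (m : ℝ) M := by
  ext x
  simp only [hull, Set.mem_Icc, Set.mem_ofPred_eq, Int.le_floor, Int.ceil_le]
  exact ⟨fun h => ⟨h.1.1, h.2.2⟩, fun h => ⟨⟨h.1, (Int.floor_le_ceil x).trans (Int.ceil_le.2 h.2)⟩,
    (Int.le_floor.2 h.1).trans (Int.floor_le_ceil x), h.2⟩⟩

lemma hull_Ici (m : ℤ) : hull (Set.Ici m) = Set.Ici (m : ℝ) := by
  ext x
  simp only [hull, Set.mem_Ici, Set.mem_ofPred_eq, Int.le_floor]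
  exact ⟨fun h => h.1, fun h => ⟨h, (Int.le_floor.2 h).trans (Int.floor_le_ceil x)⟩⟩

lemma hull_univ : hull Set.univ = Set.univ := by ext; simp [hull]

lemma intCast_mem_hull {I : Set ℤ} {k : ℤ} : (k : ℝ) ∈ hull I ↔ k ∈ I := by simp [hull]

section Curve

variable {w : ℤ → V}

lemma trackCurve_intCast (k : ℤ) : trackCurve w k = vertexPoint (w k) := by
  simp [trackCurve, edgePoint_zero]

lemma trackCurve_of_mem_Icc {n : ℤ} {x : ℝ} (hx : x ∈ Set.Icc (n : ℝ) (n + 1)) :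
    trackCurve w x = edgePoint (w n) (w (n + 1)) (x - n) := by
  rcases hx.2.lt_or_eq with h | rfl
  · have : ⌊x⌋ = n := Int.floor_eq_iff.2 ⟨hx.1, h⟩
    rw [trackCurve, this, Int.fract, this]
  · have := trackCurve_intCast (w := w) (n + 1)
    push_cast at this
    rw [this, add_sub_cancel_left, edgePoint_one]

lemma continuous_trackCurve : Continuous (trackCurve w) := by
  have hc : ∀ n : ℤ, ContinuousOn (trackCurve w) (Set.Icc (n : ℝ) (n + 1)) := fun n =>
    ((continuous_edgePoint _ _).comp (continuous_id.sub continuous_const)).continuousOn.congr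
      fun x hx => trackCurve_of_mem_Icc hx
  refine continuous_iff_continuousAt.2 fun x => continuousAt_iff_continuous_left_right.2 ⟨?_, ?_⟩
  · have h1 : ((⌈x⌉ - 1 : ℤ) : ℝ) < x := by push_cast; linarith [Int.ceil_lt_add_one x]
    have h2 : x ≤ ((⌈x⌉ - 1 : ℤ) : ℝ) + 1 := by push_cast; linarith [Int.le_ceil x]
    exact ((hc (⌈x⌉ - 1)) x ⟨h1.le, h2⟩).mono_of_mem_nhdsWithin
      (Filter.mem_of_superset (Icc_mem_nhdsLE h1) (Set.Icc_subset_Icc_right h2))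
  · exact ((hc ⌊x⌋) x ⟨Int.floor_le x, (Int.lt_floor_add_one x).le⟩).mono_of_mem_nhdsWithin
      (Icc_mem_nhdsGE_of_mem ⟨Int.floor_le x, Int.lt_floor_add_one x⟩)

end Curve

namespace Track

variable {I : Set ℤ} {w : ℤ → V}

lemma adj_of_mem_hull (T : Track G I w) {x : ℝ} (hx : x ∈ hull I) :
    (x = ⌊x⌋ ∧ ⌊x⌋ ∈ I) ∨ (⌊x⌋ ∈ I ∧ ⌊x⌋ + 1 ∈ I ∧ Int.fract x ∈ Set.Ioo 0 1 ∧
      G.Adj (w ⌊x⌋) (w (⌊x⌋ + 1))) := by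
  by_cases h : Int.fract x = 0
  · exact Or.inl ⟨by rw [Int.fract] at h; linarith, hx.1⟩
  · have hc : ⌈x⌉ = ⌊x⌋ + 1 := by
      rw [Int.ceil_eq_iff]
      have h1 := (Int.fract_nonneg x).lt_of_ne' h
      have h2 := Int.fract_lt_one x
      rw [Int.fract] at h1 h2
      push_cast
      constructor <;> linarith
    have h2 := hx.2
    rw [hc] at h2
    exact Or.inr ⟨hx.1, h2, ⟨(Int.fract_nonneg x).lt_of_ne' h, Int.fract_lt_one x⟩,
      T.adj _ hx.1 h2⟩

lemma trackCurve_mem (T : Track G I w) {x : ℝ} (hx : x ∈ hull I) :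
    trackCurve w x ∈ GraphRealization G := by
  rcases T.adj_of_mem_hull hx with ⟨h, -⟩ | ⟨-, -, h, hadj⟩
  · rw [h, trackCurve_intCast]
    exact GraphRealization.vertexPoint_mem _
  · exact GraphRealization.edgePoint_mem hadj ⟨h.1.le, h.2.le⟩

lemma eq_of_trackCurve_eq (T : Track G I w) {x y : ℝ} (hx : x ∈ hull I) (hy : y ∈ hull I)
    (h : trackCurve w x = trackCurve w y) :
    x = y ∨ ∃ k ∈ I, ∃ l ∈ I, x = k ∧ y = l ∧ w k = w l := by
  have key : ∀ x y, x ∈ hull I → y ∈ hull I → trackCurve w x = trackCurve w y →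
      Int.fract x ∈ Set.Ioo 0 1 → G.Adj (w ⌊x⌋) (w (⌊x⌋ + 1)) → y ≠ ⌊y⌋ := by
    intro x y hx hy h hf hadj hyi
    rw [hyi, trackCurve_intCast] at h
    have h1 : 0 < trackCurve w x (w ⌊x⌋) := by
      rw [trackCurve, edgePoint_left hadj.ne]; linarith [hf.2]
    have h2 : 0 < trackCurve w x (w (⌊x⌋ + 1)) := by
      rw [trackCurve, edgePoint_right hadj.ne]; exact hf.1
    rw [h] at h1 h2
    exact hadj.ne ((eq_of_vertexPoint_pos h1).trans (eq_of_vertexPoint_pos h2).symm)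
  rcases T.adj_of_mem_hull hx with ⟨hxi, hxI⟩ | ⟨hxI, hxI', hfx, hax⟩ <;>
    rcases T.adj_of_mem_hull hy with ⟨hyi, hyI⟩ | ⟨hyI, hyI', hfy, hay⟩
  · rw [hxi, hyi, trackCurve_intCast, trackCurve_intCast] at h
    exact Or.inr ⟨_, hxI, _, hyI, hxi, hyi, vertexPoint_injective h⟩
  · exact (key y x hy hx h.symm hfy hay hxi).elim
  · exact (key x y hx hy h hfx hax hyi).elim
  · have h1 : 0 < trackCurve w x (w ⌊x⌋) := by
      rw [trackCurve, edgePoint_left hax.ne]; linarith [hfx.2]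
    have h2 : 0 < trackCurve w x (w (⌊x⌋ + 1)) := by
      rw [trackCurve, edgePoint_right hax.ne]; exact hfx.1
    have hfl : ⌊x⌋ = ⌊y⌋ := by
      refine T.edge_inj _ _ hxI hxI' hyI hyI' (Sym2.eq_iff.2 ?_)
      rw [h] at h1 h2
      have := hax.ne
      rcases eq_or_eq_of_edgePoint_pos h1 with e1 | e1 <;>
        rcases eq_or_eq_of_edgePoint_pos h2 with e2 | e2
      · exact (this (e1.trans e2.symm)).elim
      · exact Or.inl ⟨e1, e2⟩
      · exact Or.inr ⟨e1, e2⟩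
      · exact (this (e1.trans e2.symm)).elim
    left
    have := congrFun h (w (⌊x⌋ + 1))
    rw [trackCurve, trackCurve, ← hfl, edgePoint_right hax.ne, edgePoint_right hax.ne, Int.fract,
      Int.fract, ← hfl] at this
    linarith

lemma finite_fiber (T : Track G I w) (v : V) : {k | k ∈ I ∧ w k = v}.Finite := by
  have h1 : {k | IsInner I k ∧ w k = v}.Subsingleton := fun i hi j hj =>
    T.inj i j hi.1 hj.1 (hi.2.trans hj.2.symm)
  have h2 : {k | k ∈ I ∧ k + 1 ∉ I}.Subsingleton := fun i hi j hj =>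
    le_antisymm (T.le_of_mem hi.1 hj.1 hj.2) (T.le_of_mem hj.1 hi.1 hi.2)
  have h3 : {k | k ∈ I ∧ k - 1 ∉ I}.Subsingleton := fun i hi j hj =>
    le_antisymm (T.ge_of_mem hj.1 hi.1 hi.2) (T.ge_of_mem hi.1 hj.1 hj.2)
  refine (h1.finite.union (h2.finite.union h3.finite)).subset fun k hk => ?_
  by_cases ha : k + 1 ∈ I
  · by_cases hb : k - 1 ∈ I
    · exact Or.inl ⟨⟨hb, ha⟩, hk.2⟩
    · exact Or.inr (Or.inr ⟨hk.1, hb⟩)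
  · exact Or.inr (Or.inl ⟨hk.1, ha⟩)

/-- The parametrization of the realization of `G` by a track. -/
noncomputable def param (T : Track G I w) (x : hull I) : GraphRealization G :=
  ⟨trackCurve w x, T.trackCurve_mem x.2⟩

lemma surjective_param (T : Track G I w) (hv : ∀ v, ∃ k ∈ I, w k = v)
    (he : ∀ v u, G.Adj v u → OnTrack I w v u) : Function.Surjective T.param := by
  rintro ⟨p, hp⟩
  rcases hp with ⟨v, rfl⟩ | ⟨v, u, t, hvu, ht, rfl⟩
  · obtain ⟨k, hk, rfl⟩ := hv v
    exact ⟨⟨k, intCast_mem_hull.2 hk⟩, Subtype.ext (trackCurve_intCast k)⟩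
  · obtain ⟨k, hk, hk', hs⟩ := he v u hvu
    have hmem : ∀ t ∈ Set.Icc (0 : ℝ) 1, (k : ℝ) + t ∈ hull I ∧
        trackCurve w (k + t) = edgePoint (w k) (w (k + 1)) t := by
      intro t ht
      constructor
      · have h1 : k ≤ ⌊(k : ℝ) + t⌋ := Int.le_floor.2 (by linarith [ht.1])
        have h2 : ⌈(k : ℝ) + t⌉ ≤ k + 1 := Int.ceil_le.2 (by push_cast; linarith [ht.2])
        have h3 := Int.floor_le_ceil ((k : ℝ) + t)
        exact ⟨T.ord.out hk hk' ⟨by omega, by omega⟩, T.ord.out hk hk' ⟨by omega, by omega⟩⟩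
      · rw [trackCurve_of_mem_Icc (n := k) ⟨by linarith [ht.1], by linarith [ht.2]⟩,
          add_sub_cancel_left]
    rcases Sym2.eq_iff.1 hs with ⟨rfl, rfl⟩ | ⟨rfl, rfl⟩
    · exact ⟨⟨k + t, (hmem t ht).1⟩, Subtype.ext (hmem t ht).2⟩
    · have ht' : 1 - t ∈ Set.Icc (0 : ℝ) 1 := ⟨by linarith [ht.2], by linarith [ht.1]⟩
      refine ⟨⟨k + (1 - t), (hmem _ ht').1⟩, Subtype.ext ?_⟩
      exact (hmem _ ht').2.trans (edgePoint_symm _ _ _).symm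

lemma isQuotientMap_param (T : Track G I w) (hv : ∀ v, ∃ k ∈ I, w k = v)
    (he : ∀ v u, G.Adj v u → OnTrack I w v u) (hI : IsClosed (hull I)) :
    IsQuotientMap T.param := by
  refine isQuotientMap_of_locally_compact_preimage
    ((continuous_trackCurve.comp continuous_subtype_val).subtype_mk _) (T.surjective_param hv he) ?_
  rintro ⟨p, hp⟩
  obtain ⟨v, hv⟩ := GraphRealization.exists_pos hp
  refine ⟨{q | 0 < q.1 v}, (isOpen_lt continuous_const
    ((continuous_apply v).comp continuous_subtype_val)).mem_nhds hv,
    Subtype.val ⁻¹' ⋃ k ∈ {k | k ∈ I ∧ w k = v}, Set.Icc ((k : ℝ) - 1) (k + 1), ?_, ?_⟩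
  · exact hI.isClosedEmbedding_subtypeVal.isCompact_preimage
      ((T.finite_fiber v).isCompact_biUnion fun k _ => isCompact_Icc)
  · intro x hx
    have hx' : 0 < trackCurve w x v := hx
    have h1 := Int.floor_le (x : ℝ)
    have h2 := Int.lt_floor_add_one (x : ℝ)
    simp only [Set.mem_preimage, Set.mem_iUnion]
    rcases T.adj_of_mem_hull x.2 with ⟨h, hI⟩ | ⟨hI, hI', h, hadj⟩
    · rw [h, trackCurve_intCast] at hx'
      exact ⟨⌊(x : ℝ)⌋, ⟨hI, (eq_of_vertexPoint_pos hx').symm⟩, by constructor <;> linarith⟩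
    · rcases eq_or_eq_of_edgePoint_pos hx' with e | e
      · exact ⟨⌊(x : ℝ)⌋, ⟨hI, e.symm⟩, by constructor <;> linarith⟩
      · exact ⟨⌊(x : ℝ)⌋ + 1, ⟨hI', e.symm⟩, by push_cast; constructor <;> linarith⟩

end Track

end TrackCurves

section Reparametrization

/-- An order automorphism of the line can be altered to the right of a point so as to map a
given later point one unit further. -/
lemma OrderIso.exists_bend (φ : ℝ ≃o ℝ) {p q : ℝ} (h : p < q) :
    ∃ ψ : ℝ ≃o ℝ, (∀ x ≤ p, ψ x = φ x) ∧ ψ q = φ p + 1 := by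
  have hpos : 0 < q - p := sub_pos.2 h
  have hmono : StrictMono fun x => φ (min x p) + (max x p - p) / (q - p) := by
    intro x y hxy
    simp only
    rcases le_or_gt y p with hy | hy
    · rw [min_eq_left hy, min_eq_left (hxy.le.trans hy), max_eq_right hy,
        max_eq_right (hxy.le.trans hy)]
      have := φ.strictMono hxy
      linarith
    · refine add_lt_add_of_le_of_lt (φ.monotone (min_le_min_right p hxy.le)) ?_
      refine div_lt_div_of_pos_right ?_ hpos
      rw [max_eq_left hy.le]
      have := max_lt hxy hy
      linarith
  have hsurj : Function.Surjective fun x => φ (min x p) + (max x p - p) / (q - p) := by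
    intro y
    rcases le_or_gt y (φ p) with hy | hy
    · have : φ.symm y ≤ p := by rwa [OrderIso.symm_apply_le]
      refine ⟨φ.symm y, ?_⟩
      simp only [min_eq_left this, max_eq_right this]
      simp
    · have : p ≤ p + (y - φ p) * (q - p) := by nlinarith
      refine ⟨p + (y - φ p) * (q - p), ?_⟩
      simp only [min_eq_right this, max_eq_left this]
      field_simp
      ring
  refine ⟨hmono.orderIsoOfSurjective _ hsurj, fun x hx => ?_, ?_⟩
  · change φ (min x p) + (max x p - p) / (q - p) = φ x
    rw [min_eq_left hx, max_eq_right hx]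
    simp
  · change φ (min q p) + (max q p - p) / (q - p) = φ p + 1
    rw [min_eq_right h.le, max_eq_left h.le, div_self hpos.ne']

lemma OrderIso.exists_four_points {p q r s : ℝ} (hpq : p < q) (hqr : q < r) (hrs : r < s) :
    ∃ φ : ℝ ≃o ℝ, φ p = 0 ∧ φ q = 1 ∧ φ r = 2 ∧ φ s = 3 := by
  obtain ⟨φ₁, h₁, h₁'⟩ := (OrderIso.addRight (-p)).exists_bend hpq
  obtain ⟨φ₂, h₂, h₂'⟩ := φ₁.exists_bend hqr
  obtain ⟨φ₃, h₃, h₃'⟩ := φ₂.exists_bend hrs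
  have e : (OrderIso.addRight (-p)) p = 0 := by simp
  have ep : φ₁ p = 0 := by rw [h₁ p le_rfl, e]
  have eq : φ₁ q = 1 := by rw [h₁', e, zero_add]
  have ep2 : φ₂ p = 0 := by rw [h₂ p hpq.le, ep]
  have eq2 : φ₂ q = 1 := by rw [h₂ q le_rfl, eq]
  have er2 : φ₂ r = 2 := by rw [h₂', eq]; norm_num
  refine ⟨φ₃, ?_, ?_, ?_, ?_⟩
  · rw [h₃ p (hpq.trans hqr).le, ep2]
  · rw [h₃ q hqr.le, eq2]
  · rw [h₃ r le_rfl, er2]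
  · rw [h₃', er2]; norm_num

/-- Two curves that agree at a parameter can be concatenated there. -/
lemma exists_concat {X : Type*} [TopologicalSpace X] {A B : ℝ → X} (hA : Continuous A)
    (hB : Continuous B) {c : ℝ} (h : A c = B c) :
    ∃ g, Continuous g ∧ (∀ x ≤ c, g x = A x) ∧ ∀ x, c ≤ x → g x = B x := by
  refine ⟨fun x => if x ≤ c then A x else B x,
    hA.if_le hB continuous_id continuous_const fun x hx => by rw [hx, h],
    fun x hx => if_pos hx, fun x hx => ?_⟩
  rcases hx.eq_or_lt with rfl | hx
  · simp [h]
  · exact if_neg hx.not_ge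

lemma injOn_union_of_imp_eq {X Y : Type*} {g : X → Y} {A B : Set X} (hA : Set.InjOn g A)
    (hB : Set.InjOn g B) (h : ∀ x ∈ A, ∀ y ∈ B, g x = g y → x = y) : Set.InjOn g (A ∪ B) := by
  rintro x (hx | hx) y (hy | hy) hxy
  · exact hA hx hy hxy
  · exact h x hx y hy hxy
  · exact (h y hy x hx hxy.symm).symm
  · exact hB hx hy hxy

end Reparametrization

section Circle

lemma exists_cos_sin_eq {x y : ℝ} (h : x ^ 2 + y ^ 2 = 1) :
    ∃ t ∈ Set.Ioc (0 : ℝ) 1, Real.cos (2 * Real.pi * t) = x ∧ Real.sin (2 * Real.pi * t) = y := by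
  have hπ := Real.pi_pos
  have hx1 : -1 ≤ x := by nlinarith
  have hx2 : x ≤ 1 := by nlinarith
  rcases lt_or_ge 0 y with hy | hy
  · refine ⟨Real.arccos x / (2 * Real.pi), ⟨?_, ?_⟩, ?_⟩
    · refine div_pos (Real.arccos_pos.2 ?_) (by positivity)
      nlinarith
    · rw [div_le_one (by positivity)]
      linarith [Real.arccos_le_pi x]
    · rw [mul_div_cancel₀ _ (by positivity), Real.cos_arccos hx1 hx2, Real.sin_arccos]
      refine ⟨rfl, ?_⟩
      rw [show 1 - x ^ 2 = y ^ 2 by linarith, Real.sqrt_sq hy.le]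
  · refine ⟨1 - Real.arccos x / (2 * Real.pi), ⟨?_, ?_⟩, ?_⟩
    · rw [sub_pos, div_lt_one (by positivity)]
      linarith [Real.arccos_le_pi x]
    · have := div_nonneg (Real.arccos_nonneg x) (by positivity : 0 ≤ 2 * Real.pi)
      linarith
    · rw [mul_sub, mul_div_cancel₀ _ (by positivity), mul_one, Real.cos_two_pi_sub,
        Real.sin_two_pi_sub, Real.cos_arccos hx1 hx2, Real.sin_arccos]
      refine ⟨rfl, ?_⟩
      rw [show 1 - x ^ 2 = (-y) ^ 2 by linarith, Real.sqrt_sq (by linarith), neg_neg]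

lemma eq_of_cos_sin_eq {s t : ℝ} (h1 : s - t < 1) (h2 : t - s < 1)
    (hc : Real.cos (2 * Real.pi * s) = Real.cos (2 * Real.pi * t))
    (hs : Real.sin (2 * Real.pi * s) = Real.sin (2 * Real.pi * t)) : s = t := by
  have hπ := Real.pi_pos
  have h := (Real.Angle.angle_eq_iff_two_pi_dvd_sub).1 (Real.Angle.cos_sin_inj hc hs)
  obtain ⟨k, hk⟩ := h
  have hk' : s - t = k := by
    have : 2 * Real.pi * (s - t) = 2 * Real.pi * k := by linarith
    exact mul_left_cancel₀ (by positivity) this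
  have h3 : k < 1 := by exact_mod_cast hk' ▸ h1
  have h4 : -1 < k := by
    have : (-1 : ℝ) < k := by linarith
    exact_mod_cast this
  have : k = 0 := by omega
  rw [this, Int.cast_zero] at hk'
  linarith

lemma eq_zero_of_cos_eq_one {t : ℝ} (h1 : -1 < t) (h2 : t < 1)
    (hc : Real.cos (2 * Real.pi * t) = 1) : t = 0 := by
  have hπ := Real.pi_pos
  have := (Real.cos_eq_one_iff_of_lt_of_lt (by nlinarith) (by nlinarith)).1 hc
  rcases mul_eq_zero.1 this with h | h
  · linarith
  · exact h

lemma eq_one_of_cos_eq_one {t : ℝ} (h1 : 0 < t) (h2 : t ≤ 1)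
    (hc : Real.cos (2 * Real.pi * t) = 1) : t = 1 := by
  have : t - 1 = 0 := eq_zero_of_cos_eq_one (by linarith) (by linarith) (by
    rw [mul_sub, mul_one, Real.cos_sub_two_pi, hc])
  linarith

end Circle

section Models

open Real in
lemma exists_circle_curve : ∃ g : ℝ → ℝ × ℝ, Continuous g ∧ g '' Set.Ioc 0 1 = unitCircleSet ∧
    Set.InjOn g (Set.Ioc 0 1) ∧ g 0 = g 1 := by
  refine ⟨fun t => (cos (2 * π * t), sin (2 * π * t)), by fun_prop, ?_, ?_, by simp⟩
  · ext ⟨x, y⟩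
    simp only [unitCircleSet, Set.mem_image, Set.mem_ofPred_eq, Prod.mk.injEq]
    exact ⟨fun ⟨t, _, h1, h2⟩ => by rw [← h1, ← h2, cos_sq_add_sin_sq], exists_cos_sin_eq⟩
  · intro s hs t ht h
    rw [Prod.mk.injEq] at h
    exact eq_of_cos_sin_eq (by linarith [hs.2, ht.1]) (by linarith [hs.1, ht.2]) h.1 h.2

open Real in
lemma exists_lollipop_curve : ∃ g : ℝ → ℝ × ℝ, Continuous g ∧
    g '' Set.Ioc 0 2 = lollipopSet ∧ Set.InjOn g (Set.Ioc 0 2) ∧ g 0 = g 1 := by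
  obtain ⟨g, hg, hA, hB⟩ := exists_concat (c := 1)
    (A := fun t : ℝ => (cos (2 * π * t), sin (2 * π * t))) (B := fun t : ℝ => (t, (0 : ℝ)))
    (by fun_prop) (by fun_prop) (by simp)
  have hJ : Set.Ioc (0 : ℝ) 2 = Set.Ioc 0 1 ∪ Set.Icc 1 2 :=
    (Set.Ioc_union_Icc_eq_Ioc zero_lt_one one_le_two).symm
  refine ⟨g, hg, ?_, ?_, ?_⟩
  · rw [hJ, Set.image_union]
    refine congrArg₂ _ ?_ ?_
    · ext ⟨x, y⟩
      simp only [circleAt, Set.mem_image, Set.mem_ofPred_eq, sub_zero, one_pow]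
      constructor
      · rintro ⟨t, ht, h⟩
        rw [hA t ht.2, Prod.mk.injEq] at h
        rw [← h.1, ← h.2, cos_sq_add_sin_sq]
      · intro h
        obtain ⟨t, ht, rfl, rfl⟩ := exists_cos_sin_eq h
        exact ⟨t, ht, hA t ht.2⟩
    · ext ⟨x, y⟩
      simp only [hSeg, Set.mem_image, Set.mem_ofPred_eq]
      constructor
      · rintro ⟨t, ht, h⟩
        rw [hB t ht.1, Prod.mk.injEq] at h
        exact ⟨h.2.symm, h.1 ▸ ht.1, h.1 ▸ ht.2⟩
      · rintro ⟨rfl, h1, h2⟩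
        exact ⟨x, ⟨h1, h2⟩, hB x h1⟩
  · rw [hJ]
    refine injOn_union_of_imp_eq ?_ ?_ ?_
    · intro s hs t ht h
      rw [hA s hs.2, hA t ht.2, Prod.mk.injEq] at h
      exact eq_of_cos_sin_eq (by linarith [hs.2, ht.1]) (by linarith [hs.1, ht.2]) h.1 h.2
    · intro s hs t ht h
      rw [hB s hs.1, hB t ht.1, Prod.mk.injEq] at h
      exact h.1
    · intro s hs t ht h
      rw [hA s hs.2, hB t ht.1, Prod.mk.injEq] at h
      have h1 := cos_le_one (2 * π * s)
      have : t = 1 := by linarith [ht.1]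
      rw [this] at h ⊢
      exact eq_one_of_cos_eq_one hs.1 hs.2 h.1
  · rw [hA 0 zero_le_one, hA 1 le_rfl]
    simp

open Real in
lemma exists_openLollipop_curve : ∃ g : ℝ → ℝ × ℝ, Continuous g ∧
    g '' Set.Ioi 0 = openLollipopSet ∧ Set.InjOn g (Set.Ioi 0) ∧ g 0 = g 1 ∧
    ∀ x, 1 ≤ x → (g x).1 = 2 - 1 / x := by
  obtain ⟨g, hg, hA, hB⟩ := exists_concat (c := 1)
    (A := fun t : ℝ => (cos (2 * π * t), sin (2 * π * t)))
    (B := fun t : ℝ => (2 - 1 / max t 1, (0 : ℝ)))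
    (by fun_prop) (by
      refine Continuous.prodMk (continuous_const.sub (continuous_const.div (by fun_prop) ?_))
        continuous_const
      intro x
      have := le_max_right x 1
      positivity) (by norm_num)
  replace hB : ∀ x, 1 ≤ x → g x = (2 - 1 / x, 0) := fun x hx => by
    rw [hB x hx, max_eq_left hx]
  have hJ : Set.Ioi (0 : ℝ) = Set.Ioc 0 1 ∪ Set.Ici 1 :=
    (Set.Ioc_union_Ici_eq_Ioi zero_lt_one).symm
  have hY : openLollipopSet = circleAt (0, 0) 1 ∪ {p | p.2 = 0 ∧ 1 ≤ p.1 ∧ p.1 < 2} := by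
    ext ⟨x, y⟩
    simp only [openLollipopSet, lollipopSet, hSeg, circleAt, Set.mem_sdiff, Set.mem_union,
      Set.mem_ofPred_eq, Set.mem_singleton_iff, Prod.mk.injEq, sub_zero, one_pow]
    constructor
    · rintro ⟨h | ⟨h1, h2, h3⟩, h⟩
      · exact Or.inl h
      · exact Or.inr ⟨h1, h2, h3.lt_of_ne fun e => h ⟨e, h1⟩⟩
    · rintro (h | ⟨h1, h2, h3⟩)
      · refine ⟨Or.inl h, ?_⟩
        rintro ⟨rfl, rfl⟩
        norm_num at h
      · exact ⟨Or.inr ⟨h1, h2, h3.le⟩, fun h => h3.ne h.1⟩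
  refine ⟨g, hg, ?_, ?_, ?_, fun x hx => by rw [hB x hx]⟩
  · rw [hJ, Set.image_union, hY]
    refine congrArg₂ _ ?_ ?_
    · ext ⟨x, y⟩
      simp only [circleAt, Set.mem_image, Set.mem_ofPred_eq, sub_zero, one_pow]
      constructor
      · rintro ⟨t, ht, h⟩
        rw [hA t ht.2, Prod.mk.injEq] at h
        rw [← h.1, ← h.2, cos_sq_add_sin_sq]
      · intro h
        obtain ⟨t, ht, rfl, rfl⟩ := exists_cos_sin_eq h
        exact ⟨t, ht, hA t ht.2⟩
    · ext ⟨x, y⟩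
      simp only [Set.mem_image, Set.mem_ofPred_eq, Set.mem_Ici]
      constructor
      · rintro ⟨t, ht, h⟩
        rw [hB t ht, Prod.mk.injEq] at h
        have h0 : 0 < 1 / t := by positivity
        have h1 : 1 / t ≤ 1 := by rwa [div_le_one (by positivity)]
        exact ⟨h.2.symm, by linarith [h.1], by linarith [h.1]⟩
      · rintro ⟨rfl, h1, h2⟩
        have h3 : 1 ≤ 1 / (2 - x) := by
          rw [le_div_iff₀ (by linarith)]
          linarith
        refine ⟨1 / (2 - x), h3, ?_⟩
        rw [hB _ h3]
        simp
  · rw [hJ]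
    refine injOn_union_of_imp_eq ?_ ?_ ?_
    · intro s hs t ht h
      rw [hA s hs.2, hA t ht.2, Prod.mk.injEq] at h
      exact eq_of_cos_sin_eq (by linarith [hs.2, ht.1]) (by linarith [hs.1, ht.2]) h.1 h.2
    · intro s hs t ht h
      rw [hB s hs, hB t ht, Prod.mk.injEq] at h
      have : 1 / s = 1 / t := by linarith [h.1]
      simpa using this
    · intro s hs t ht h
      rw [hA s hs.2, hB t ht, Prod.mk.injEq] at h
      have h1 := cos_le_one (2 * π * s)
      have ht' : (1 : ℝ) ≤ t := ht
      have : t = 1 := by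
        by_contra hne
        have h3 : 1 < t := ht'.lt_of_ne' hne
        have h2 : 1 / t < 1 := by rwa [div_lt_one (by positivity)]
        linarith [h.1]
      rw [this] at h ⊢
      refine eq_one_of_cos_eq_one hs.1 hs.2 (h.1.trans (by norm_num))
  · rw [hA 0 zero_le_one, hA 1 le_rfl]
    simp

open Real in
lemma exists_figureEight_curve : ∃ g : ℝ → ℝ × ℝ, Continuous g ∧
    g '' Set.Ioo 0 2 = figureEightSet ∧ Set.InjOn g (Set.Ioo 0 2) ∧ g 0 = g 1 ∧ g 2 = g 1 := by
  obtain ⟨g, hg, hA, hB⟩ := exists_concat (c := 1)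
    (A := fun t : ℝ => (-1 + cos (2 * π * t), sin (2 * π * t)))
    (B := fun t : ℝ => (1 - cos (2 * π * (t - 1)), sin (2 * π * (t - 1))))
    (by fun_prop) (by fun_prop) (by simp)
  have hJ : Set.Ioo (0 : ℝ) 2 = Set.Ioc 0 1 ∪ Set.Ico 1 2 := by
    ext x
    simp only [Set.mem_Ioo, Set.mem_union, Set.mem_Ioc, Set.mem_Ico]
    grind
  refine ⟨g, hg, ?_, ?_, ?_, ?_⟩
  · rw [hJ, Set.image_union]
    refine congrArg₂ _ ?_ ?_
    · ext ⟨x, y⟩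
      simp only [circleAt, Set.mem_image, Set.mem_ofPred_eq, sub_zero, one_pow]
      constructor
      · rintro ⟨t, ht, h⟩
        rw [hA t ht.2, Prod.mk.injEq] at h
        rw [← h.1, ← h.2, sub_neg_eq_add, neg_add_cancel_comm, cos_sq_add_sin_sq]
      · intro h
        obtain ⟨t, ht, h1, h2⟩ := exists_cos_sin_eq h
        exact ⟨t, ht, by rw [hA t ht.2, h1, h2]; simp⟩
    · ext ⟨x, y⟩
      simp only [circleAt, Set.mem_image, Set.mem_ofPred_eq, sub_zero, one_pow]
      constructor
      · rintro ⟨t, ht, h⟩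
        rw [hB t ht.1, Prod.mk.injEq] at h
        rw [← h.1, ← h.2]
        linarith [cos_sq_add_sin_sq (2 * π * (t - 1))]
      · intro h
        obtain ⟨t, ht, h1, h2⟩ := exists_cos_sin_eq (x := 1 - x) (y := -y) (by linarith)
        have e : 2 * π * (2 - t - 1) = 2 * π - 2 * π * t := by ring
        refine ⟨2 - t, ⟨by linarith [ht.2], by linarith [ht.1]⟩, ?_⟩
        rw [hB _ (by linarith [ht.2]), e, cos_two_pi_sub, sin_two_pi_sub, h1, h2]
        simp
  · rw [hJ]
    refine injOn_union_of_imp_eq ?_ ?_ ?_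
    · intro s hs t ht h
      rw [hA s hs.2, hA t ht.2, Prod.mk.injEq] at h
      exact eq_of_cos_sin_eq (by linarith [hs.2, ht.1]) (by linarith [hs.1, ht.2])
        (by linarith [h.1]) h.2
    · intro s hs t ht h
      rw [hB s hs.1, hB t ht.1, Prod.mk.injEq] at h
      have := eq_of_cos_sin_eq (s := s - 1) (t := t - 1) (by linarith [hs.2, ht.1])
        (by linarith [hs.1, ht.2]) (by linarith [h.1]) h.2
      linarith
    · intro s hs t ht h
      rw [hA s hs.2, hB t ht.1, Prod.mk.injEq] at h
      have h1 := cos_le_one (2 * π * s)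
      have h2 := cos_le_one (2 * π * (t - 1))
      have h3 := eq_one_of_cos_eq_one hs.1 hs.2 (by linarith [h.1])
      have h4 := eq_zero_of_cos_eq_one (t := t - 1) (by linarith [ht.1]) (by linarith [ht.2])
        (by linarith [h.1])
      linarith
  · rw [hA 0 zero_le_one, hA 1 le_rfl]
    simp
  · rw [hB 2 one_le_two, hB 1 le_rfl]
    norm_num

open Real in
lemma exists_dumbbell_curve : ∃ g : ℝ → ℝ × ℝ, Continuous g ∧
    g '' Set.Ioo 0 3 = dumbbellSet ∧ Set.InjOn g (Set.Ioo 0 3) ∧ g 0 = g 1 ∧ g 3 = g 2 := by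
  obtain ⟨g₁, hg₁, hA₁, hB₁⟩ := exists_concat (c := 1)
    (A := fun t : ℝ => (-2 + cos (2 * π * t), sin (2 * π * t)))
    (B := fun t : ℝ => (-3 + 2 * t, (0 : ℝ))) (by fun_prop) (by fun_prop) (by norm_num)
  obtain ⟨g, hg, hg1, hC⟩ := exists_concat (c := 2) (A := g₁)
    (B := fun t : ℝ => (2 - cos (2 * π * (t - 2)), sin (2 * π * (t - 2))))
    hg₁ (by fun_prop) (by rw [hB₁ 2 one_le_two]; norm_num)
  have hA : ∀ x ≤ 1, g x = (-2 + cos (2 * π * x), sin (2 * π * x)) := fun x hx => by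
    rw [hg1 x (by linarith), hA₁ x hx]
  have hB : ∀ x, 1 ≤ x → x ≤ 2 → g x = (-3 + 2 * x, 0) := fun x hx hx' => by
    rw [hg1 x hx', hB₁ x hx]
  have hJ : Set.Ioo (0 : ℝ) 3 = Set.Ioc 0 1 ∪ Set.Ico 2 3 ∪ Set.Icc 1 2 := by
    ext x
    simp only [Set.mem_Ioo, Set.mem_union, Set.mem_Ioc, Set.mem_Ico, Set.mem_Icc]
    grind
  refine ⟨g, hg, ?_, ?_, ?_, ?_⟩
  · rw [hJ, Set.image_union, Set.image_union]
    refine congrArg₂ _ (congrArg₂ _ ?_ ?_) ?_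
    · ext ⟨x, y⟩
      simp only [circleAt, Set.mem_image, Set.mem_ofPred_eq, sub_zero, one_pow]
      constructor
      · rintro ⟨t, ht, h⟩
        rw [hA t ht.2, Prod.mk.injEq] at h
        rw [← h.1, ← h.2, sub_neg_eq_add, neg_add_cancel_comm, cos_sq_add_sin_sq]
      · intro h
        obtain ⟨t, ht, h1, h2⟩ := exists_cos_sin_eq h
        exact ⟨t, ht, by rw [hA t ht.2, h1, h2]; simp⟩
    · ext ⟨x, y⟩
      simp only [circleAt, Set.mem_image, Set.mem_ofPred_eq, sub_zero, one_pow]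
      constructor
      · rintro ⟨t, ht, h⟩
        rw [hC t ht.1, Prod.mk.injEq] at h
        rw [← h.1, ← h.2]
        linarith [cos_sq_add_sin_sq (2 * π * (t - 2))]
      · intro h
        obtain ⟨t, ht, h1, h2⟩ := exists_cos_sin_eq (x := 2 - x) (y := -y) (by linarith)
        have e : 2 * π * (3 - t - 2) = 2 * π - 2 * π * t := by ring
        refine ⟨3 - t, ⟨by linarith [ht.2], by linarith [ht.1]⟩, ?_⟩
        rw [hC _ (by linarith [ht.2]), e, cos_two_pi_sub, sin_two_pi_sub, h1, h2]
        simp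
    · ext ⟨x, y⟩
      simp only [hSeg, Set.mem_image, Set.mem_ofPred_eq]
      constructor
      · rintro ⟨t, ht, h⟩
        rw [hB t ht.1 ht.2, Prod.mk.injEq] at h
        exact ⟨h.2.symm, by linarith [h.1, ht.1], by linarith [h.1, ht.2]⟩
      · rintro ⟨rfl, h1, h2⟩
        refine ⟨(x + 3) / 2, ⟨by linarith, by linarith⟩, ?_⟩
        rw [hB _ (by linarith) (by linarith)]
        exact Prod.ext (by ring) rfl
  · rw [hJ]
    refine injOn_union_of_imp_eq (injOn_union_of_imp_eq ?_ ?_ ?_) ?_ ?_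
    · intro s hs t ht h
      rw [hA s hs.2, hA t ht.2, Prod.mk.injEq] at h
      exact eq_of_cos_sin_eq (by linarith [hs.2, ht.1]) (by linarith [hs.1, ht.2])
        (by linarith [h.1]) h.2
    · intro s hs t ht h
      rw [hC s hs.1, hC t ht.1, Prod.mk.injEq] at h
      have := eq_of_cos_sin_eq (s := s - 2) (t := t - 2) (by linarith [hs.2, ht.1])
        (by linarith [hs.1, ht.2]) (by linarith [h.1]) h.2
      linarith
    · intro s hs t ht h
      rw [hA s hs.2, hC t ht.1, Prod.mk.injEq] at h
      have h1 := cos_le_one (2 * π * s)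
      have h2 := cos_le_one (2 * π * (t - 2))
      linarith [h.1]
    · intro s hs t ht h
      rw [hB s hs.1 hs.2, hB t ht.1 ht.2, Prod.mk.injEq] at h
      linarith [h.1]
    · rintro s (hs | hs) t ht h
      · rw [hA s hs.2, hB t ht.1 ht.2, Prod.mk.injEq] at h
        have h1 := cos_le_one (2 * π * s)
        have h3 := eq_one_of_cos_eq_one hs.1 hs.2 (by linarith [h.1, ht.1])
        linarith [h.1, ht.1]
      · rw [hC s hs.1, hB t ht.1 ht.2, Prod.mk.injEq] at h
        have h1 := cos_le_one (2 * π * (s - 2))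
        have h3 := eq_zero_of_cos_eq_one (t := s - 2) (by linarith [hs.1]) (by linarith [hs.2])
          (by linarith [h.1, ht.2])
        linarith [h.1, ht.2]
  · rw [hA 0 zero_le_one, hA 1 le_rfl]
    simp
  · rw [hC 3 (by norm_num), hC 2 le_rfl]
    norm_num

open Real in
lemma exists_theta_curve : ∃ g : ℝ → ℝ × ℝ, Continuous g ∧
    g '' Set.Ioo 0 3 = thetaSet ∧ Set.InjOn g (Set.Ioo 0 3) ∧ g 0 = g 2 ∧ g 3 = g 1 := by
  have hπ := Real.pi_pos
  obtain ⟨g₁, hg₁, hA₁, hB₁⟩ := exists_concat (c := 1)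
    (A := fun t : ℝ => (cos (π * t), sin (π * t)))
    (B := fun t : ℝ => (-3 + 2 * t, (0 : ℝ))) (by fun_prop) (by fun_prop) (by norm_num)
  obtain ⟨g, hg, hg1, hC⟩ := exists_concat (c := 2) (A := g₁)
    (B := fun t : ℝ => (cos (π * (t - 2)), -sin (π * (t - 2))))
    hg₁ (by fun_prop) (by rw [hB₁ 2 one_le_two]; norm_num)
  have hA : ∀ x ≤ 1, g x = (cos (π * x), sin (π * x)) := fun x hx => by
    rw [hg1 x (by linarith), hA₁ x hx]
  have hB : ∀ x, 1 ≤ x → x ≤ 2 → g x = (-3 + 2 * x, 0) := fun x hx hx' => by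
    rw [hg1 x hx', hB₁ x hx]
  have hJ : Set.Ioo (0 : ℝ) 3 = Set.Ioc 0 1 ∪ Set.Ico 2 3 ∪ Set.Icc 1 2 := by
    ext x
    simp only [Set.mem_Ioo, Set.mem_union, Set.mem_Ioc, Set.mem_Ico, Set.mem_Icc]
    grind
  have hpos : ∀ t : ℝ, 0 < t → t < 1 → 0 < sin (π * t) := fun t h0 h1 =>
    sin_pos_of_pos_of_lt_pi (by positivity) (by nlinarith)
  have hinj : ∀ s t : ℝ, 0 ≤ s → s ≤ 1 → 0 ≤ t → t ≤ 1 → cos (π * s) = cos (π * t) → s = t := by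
    intro s t hs hs' ht ht' h
    exact mul_left_cancel₀ hπ.ne' (injOn_cos ⟨by positivity, by nlinarith⟩
      ⟨by positivity, by nlinarith⟩ h)
  have g1 : g 1 = (-1, 0) := by rw [hB 1 le_rfl one_le_two]; norm_num
  have g2 : g 2 = (1, 0) := by rw [hC 2 le_rfl]; norm_num
  have g0 : g 0 = (1, 0) := by rw [hA 0 zero_le_one]; norm_num
  have g3 : g 3 = (-1, 0) := by rw [hC 3 (by norm_num)]; norm_num
  refine ⟨g, hg, ?_, ?_, by rw [g0, g2], by rw [g3, g1]⟩
  · rw [hJ, Set.image_union]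
    refine congrArg₂ _ ?_ ?_
    · ext ⟨x, y⟩
      simp only [circleAt, Set.mem_image, Set.mem_ofPred_eq, sub_zero, one_pow]
      constructor
      · rintro ⟨t, ht | ht, h⟩
        · rw [hA t ht.2, Prod.mk.injEq] at h
          rw [← h.1, ← h.2, cos_sq_add_sin_sq]
        · rw [hC t ht.1, Prod.mk.injEq] at h
          rw [← h.1, ← h.2, neg_sq, cos_sq_add_sin_sq]
      · intro h
        have hx1 : -1 ≤ x := by nlinarith
        have hx2 : x ≤ 1 := by nlinarith
        have h3 : 0 ≤ arccos x / π := div_nonneg (arccos_nonneg x) hπ.le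
        have h4 : arccos x / π ≤ 1 := by
          rw [div_le_one hπ]
          exact arccos_le_pi x
        have hy : sin (arccos x) = |y| := by
          rw [sin_arccos, show 1 - x ^ 2 = y ^ 2 by linarith, sqrt_sq_eq_abs]
        rcases eq_or_ne x (-1) with rfl | hx
        · have hy0 : y = 0 := by nlinarith
          exact ⟨1, Or.inl ⟨one_pos, le_rfl⟩, by rw [g1, hy0]⟩
        rcases eq_or_ne x 1 with rfl | hx'
        · have hy0 : y = 0 := by nlinarith
          exact ⟨2, Or.inr ⟨le_rfl, by norm_num⟩, by rw [g2, hy0]⟩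
        have h5 : 0 < arccos x / π := div_pos (arccos_pos.2 (hx2.lt_of_ne hx')) hπ
        have h6 : arccos x / π < 1 := by
          refine h4.lt_of_ne fun e => hx ?_
          rw [div_eq_one_iff_eq hπ.ne'] at e
          rw [← cos_arccos hx1 hx2, e, cos_pi]
        rcases le_total 0 y with h0 | h0
        · refine ⟨arccos x / π, Or.inl ⟨h5, h4⟩, ?_⟩
          rw [hA _ h4, mul_div_cancel₀ _ hπ.ne', cos_arccos hx1 hx2, hy, abs_of_nonneg h0]
        · refine ⟨2 + arccos x / π, Or.inr ⟨by linarith, by linarith⟩, ?_⟩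
          rw [hC _ (by linarith), add_sub_cancel_left, mul_div_cancel₀ _ hπ.ne',
            cos_arccos hx1 hx2, hy, abs_of_nonpos h0, neg_neg]
    · ext ⟨x, y⟩
      simp only [hSeg, Set.mem_image, Set.mem_ofPred_eq]
      constructor
      · rintro ⟨t, ht, h⟩
        rw [hB t ht.1 ht.2, Prod.mk.injEq] at h
        exact ⟨h.2.symm, by linarith [h.1, ht.1], by linarith [h.1, ht.2]⟩
      · rintro ⟨rfl, h1, h2⟩
        refine ⟨(x + 3) / 2, ⟨by linarith, by linarith⟩, ?_⟩
        rw [hB _ (by linarith) (by linarith)]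
        exact Prod.ext (by ring) rfl
  · rw [hJ]
    have hone : ∀ s ∈ Set.Ioc (0 : ℝ) 1, sin (π * s) ≤ 0 → s = 1 := fun s hs h =>
      hs.2.eq_of_not_lt fun h1 => (hpos s hs.1 h1).not_ge h
    have htwo : ∀ s ∈ Set.Ico (2 : ℝ) 3, sin (π * (s - 2)) ≤ 0 → s = 2 := fun s hs h => by
      by_contra hne
      exact (hpos (s - 2) (by linarith [hs.1.lt_of_ne' hne]) (by linarith [hs.2])).not_ge h
    have hnn : ∀ s : ℝ, 0 ≤ s → s ≤ 1 → 0 ≤ sin (π * s) := fun s h0 h1 =>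
      sin_nonneg_of_nonneg_of_le_pi (by positivity) (by nlinarith)
    refine injOn_union_of_imp_eq (injOn_union_of_imp_eq ?_ ?_ ?_) ?_ ?_
    · intro s hs t ht h
      rw [hA s hs.2, hA t ht.2, Prod.mk.injEq] at h
      exact hinj s t hs.1.le hs.2 ht.1.le ht.2 h.1
    · intro s hs t ht h
      rw [hC s hs.1, hC t ht.1, Prod.mk.injEq] at h
      have := hinj (s - 2) (t - 2) (by linarith [hs.1]) (by linarith [hs.2]) (by linarith [ht.1])
        (by linarith [ht.2]) h.1
      linarith
    · intro s hs t ht h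
      have h' := h
      rw [hA s hs.2, hC t ht.1, Prod.mk.injEq] at h'
      have h1 := hnn s hs.1.le hs.2
      have h2 := hnn (t - 2) (by linarith [ht.1]) (by linarith [ht.2])
      rw [hone s hs (by linarith [h'.2]), htwo t ht (by linarith [h'.2]), g1, g2] at h
      norm_num at h
    · intro s hs t ht h
      rw [hB s hs.1 hs.2, hB t ht.1 ht.2, Prod.mk.injEq] at h
      linarith [h.1]
    · rintro s (hs | hs) t ht h
      · have h' := h
        rw [hA s hs.2, hB t ht.1 ht.2, Prod.mk.injEq] at h'
        have h1 := hone s hs h'.2.le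
        rw [h1, g1, hB t ht.1 ht.2, Prod.mk.injEq] at h
        linarith [h.1]
      · have h' := h
        rw [hC s hs.1, hB t ht.1 ht.2, Prod.mk.injEq] at h'
        have h1 := htwo s hs (by linarith [h'.2])
        rw [h1, g2, hB t ht.1 ht.2, Prod.mk.injEq] at h
        linarith [h.1]

end Models

section ArcConnectedImages

/-- The image of a nondegenerate interval under an injective continuous map to a Hausdorff space
is `n`-arc connected for all `n`. -/
lemma nArcConn_image {X : Type*} [TopologicalSpace X] [T2Space X] {J : Set ℝ}
    (hJ : J.OrdConnected) {p q : ℝ} (hp : p ∈ J) (hq : q ∈ J) (hpq : p < q) {g : ℝ → X}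
    (hg : ContinuousOn g J) (hinj : Set.InjOn g J) (n : ℕ) : NArcConn ↥(g '' J) n := by
  classical
  intro S _
  choose r hrJ hr using fun y : ↥(g '' J) => y.2
  let s : Finset ℝ := insert p (insert q (S.image r))
  have hs : ∀ x ∈ s, x ∈ J := by
    intro x hx
    simp only [s, Finset.mem_insert, Finset.mem_image] at hx
    rcases hx with rfl | rfl | ⟨y, _, rfl⟩
    exacts [hp, hq, hrJ y]
  have hne : s.Nonempty := ⟨p, Finset.mem_insert_self _ _⟩
  have hps : p ∈ s := Finset.mem_insert_self _ _
  have hqs : q ∈ s := Finset.mem_insert_of_mem (Finset.mem_insert_self _ _)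
  have hab : s.min' hne < s.max' hne :=
    (s.min'_le p hps).trans_lt (hpq.trans_le (s.le_max' q hqs))
  have hsub : Set.Icc (s.min' hne) (s.max' hne) ⊆ J :=
    hJ.out (hs _ (s.min'_mem hne)) (hs _ (s.max'_mem hne))
  let f : Set.Icc (s.min' hne) (s.max' hne) → ↥(g '' J) := fun t => ⟨g t, t, hsub t.2, rfl⟩
  have hf : Continuous f :=
    (continuousOn_iff_continuous_domRestrict.1 (hg.mono hsub)).subtype_mk _
  have hfi : Function.Injective f := fun t u h =>
    Subtype.ext (hinj (hsub t.2) (hsub u.2) (congrArg Subtype.val h))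
  refine ⟨Set.range f,
    ⟨(hf.isClosedEmbedding hfi).isEmbedding.toHomeomorph.symm.trans (iccHomeoI _ _ hab)⟩, ?_⟩
  intro y hy
  have hys : r y ∈ s :=
    Finset.mem_insert_of_mem (Finset.mem_insert_of_mem (Finset.mem_image_of_mem r hy))
  exact ⟨⟨r y, s.min'_le _ hys, s.le_max' _ hys⟩, Subtype.ext (hr y)⟩

lemma NArcConn.of_homeomorph {X Y : Type*} [TopologicalSpace X] [TopologicalSpace Y] {n : ℕ}
    (h : NArcConn X n) (e : Y ≃ₜ X) : NArcConn Y n := by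
  intro S hS
  obtain ⟨A, ⟨a⟩, hA⟩ := h (S.map e.toEquiv.toEmbedding) (by rwa [Finset.card_map])
  refine ⟨e.symm '' A, ⟨(e.symm.image A).symm.trans a⟩, fun y hy => ?_⟩
  exact ⟨e y, hA (Finset.mem_coe.2 (Finset.mem_map_of_mem _ hy)), e.symm_apply_apply y⟩

end ArcConnectedImages

section Matching

variable {V : Type*} {G : SimpleGraph V}

namespace Track

variable {I : Set ℤ} {w : ℤ → V}

/-- A quotient of the hull of a track by the gluings of the track is homeomorphic to the
realization of the graph. -/
lemma nonempty_homeomorph (T : Track G I w) (hv : ∀ v, ∃ k ∈ I, w k = v)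
    (he : ∀ v u, G.Adj v u → OnTrack I w v u) (hI : IsClosed (hull I)) {Y : Type*}
    [TopologicalSpace Y] {g : hull I → Y} (hg : IsQuotientMap g) {J : Set ℝ}
    (hgJ : ∀ x y : hull I, (x : ℝ) ∈ J → (y : ℝ) ∈ J → g x = g y → x = y)
    (hr : ∀ x : hull I, ∃ y : hull I, (y : ℝ) ∈ J ∧ T.param y = T.param x ∧ g y = g x)
    (hw : ∀ k ∈ I, ∀ l ∈ I, (k : ℝ) ∈ J → (l : ℝ) ∈ J → w k = w l → k = l) :
    Nonempty (GraphRealization G ≃ₜ Y) := by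
  choose r hrJ hrf hrg using hr
  refine nonempty_homeomorph_of_retract (T.isQuotientMap_param hv he hI) hg r hrJ hrf hrg ?_ hgJ
  intro x y hx hy h
  rcases T.eq_of_trackCurve_eq x.2 y.2 (congrArg Subtype.val h) with h | ⟨k, hk, l, hl, hxk, hyl, h⟩
  · exact Subtype.ext h
  · refine Subtype.ext ?_
    rw [hxk, hyl, hw k hk l hl (hxk ▸ hx) (hyl ▸ hy) h]

lemma nonempty_homeomorph_of_injOn (T : Track G I w) (hv : ∀ v, ∃ k ∈ I, w k = v)
    (he : ∀ v u, G.Adj v u → OnTrack I w v u) (hI : IsClosed (hull I)) {Y : Type*}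
    [TopologicalSpace Y] (e : hull I ≃ₜ Y) (hw : Set.InjOn w I) :
    Nonempty (GraphRealization G ≃ₜ Y) :=
  T.nonempty_homeomorph hv he hI e.isQuotientMap (J := Set.univ)
    (fun _ _ _ _ h => e.injective h) (fun x => ⟨x, trivial, rfl, rfl⟩)
    fun _ hk _ hl _ _ h => hw hk hl h

/-- The realization of a graph is homeomorphic to a plane curve with the same gluings as a track
covering the graph. -/
lemma nonempty_homeomorph_of_curve (T : Track G I w) (hv : ∀ v, ∃ k ∈ I, w k = v)
    (he : ∀ v u, G.Adj v u → OnTrack I w v u) (hI : IsClosed (hull I)) {g : ℝ → ℝ × ℝ}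
    {J : Set ℝ} {Y : Set (ℝ × ℝ)} (φ : ℝ ≃o ℝ) (hg : Continuous g) (hY : g '' J = Y)
    (hJ : Set.InjOn g J) (hsub : ∀ x, φ x ∈ J → x ∈ hull I)
    (hr : ∀ x ∈ hull I, φ x ∈ J ∨
      ∃ k : ℤ, ∃ l ∈ I, x = k ∧ φ l ∈ J ∧ w l = w k ∧ g (φ l) = g (φ k))
    (hw : ∀ k ∈ I, ∀ l ∈ I, φ k ∈ J → φ l ∈ J → w k = w l → k = l)
    (hloc : ∀ y ∈ Y, ∃ N ∈ 𝓝 y, ∃ K, IsCompact K ∧ ∀ x ∈ hull I, g (φ x) ∈ N → x ∈ K) :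
    Nonempty (GraphRealization G ≃ₜ Y) := by
  have hmem : ∀ x : hull I, g (φ x) ∈ Y := by
    intro x
    rw [← hY]
    rcases hr x x.2 with h | ⟨k, l, -, hx, h, -, h'⟩
    · exact ⟨_, h, rfl⟩
    · exact ⟨_, h, by rw [h', hx]⟩
  have hq : IsQuotientMap fun x : hull I => (⟨g (φ x), hmem x⟩ : Y) := by
    refine isQuotientMap_of_locally_compact_preimage
      ((hg.comp (φ.continuous.comp continuous_subtype_val)).subtype_mk _) ?_ ?_
    · rintro ⟨y, hy⟩
      obtain ⟨x, hx, rfl⟩ := hY.symm ▸ hy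
      exact ⟨⟨φ.symm x, hsub _ (by simpa using hx)⟩, by simp⟩
    · rintro ⟨y, hy⟩
      obtain ⟨N, hN, K, hK, h⟩ := hloc y hy
      exact ⟨Subtype.val ⁻¹' N, continuous_subtype_val.continuousAt.preimage_mem_nhds hN,
        Subtype.val ⁻¹' K, hI.isClosedEmbedding_subtypeVal.isCompact_preimage hK,
        fun x hx => h x x.2 hx⟩
  refine T.nonempty_homeomorph hv he hI hq (J := φ ⁻¹' J) ?_ ?_ hw
  · intro x y hx hy h
    exact Subtype.ext (φ.injective (hJ hx hy (congrArg Subtype.val h)))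
  · intro x
    rcases hr x x.2 with h | ⟨k, l, hl, hx, h, h1, h2⟩
    · exact ⟨x, h, rfl, rfl⟩
    · refine ⟨⟨l, intCast_mem_hull.2 hl⟩, h, Subtype.ext ?_, Subtype.ext ?_⟩
      · change trackCurve w l = trackCurve w x
        rw [hx, trackCurve_intCast, trackCurve_intCast, h1]
      · change g (φ l) = g (φ x)
        rw [h2, hx]

lemma nonempty_homeomorph_of_compact_curve {m M : ℤ} (T : Track G (Set.Icc m M) w)
    (hv : ∀ v, ∃ k ∈ Set.Icc m M, w k = v) (he : ∀ v u, G.Adj v u → OnTrack (Set.Icc m M) w v u)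
    {g : ℝ → ℝ × ℝ} {J : Set ℝ} {Y : Set (ℝ × ℝ)} (φ : ℝ ≃o ℝ) (hg : Continuous g)
    (hY : g '' J = Y) (hJ : Set.InjOn g J) (hJsub : J ⊆ Set.Icc (φ m) (φ M))
    (hJsup : Set.Ioo (φ m) (φ M) ⊆ J)
    (hm : ∃ l ∈ Set.Icc m M, φ l ∈ J ∧ w l = w m ∧ g (φ l) = g (φ m))
    (hM : ∃ l ∈ Set.Icc m M, φ l ∈ J ∧ w l = w M ∧ g (φ l) = g (φ M))
    (hw : ∀ k ∈ Set.Icc m M, ∀ l ∈ Set.Icc m M, φ k ∈ J → φ l ∈ J → w k = w l → k = l) :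
    Nonempty (GraphRealization G ≃ₜ Y) := by
  have hc : IsCompact (hull (Set.Icc m M)) := hull_Icc m M ▸ isCompact_Icc
  refine T.nonempty_homeomorph_of_curve hv he hc.isClosed φ hg hY hJ ?_ ?_ hw
    fun _ _ => ⟨Set.univ, Filter.univ_mem, _, hc, fun x hx _ => hx⟩
  · intro x hx
    rw [hull_Icc]
    exact ⟨φ.le_iff_le.1 (hJsub hx).1, φ.le_iff_le.1 (hJsub hx).2⟩
  · intro x hx
    rw [hull_Icc] at hx
    rcases hx.1.eq_or_lt with h | h
    · obtain ⟨l, hl, h1, h2, h3⟩ := hm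
      exact Or.inr ⟨m, l, hl, h.symm, h1, h2, h3⟩
    · rcases hx.2.eq_or_lt with h' | h'
      · obtain ⟨l, hl, h1, h2, h3⟩ := hM
        exact Or.inr ⟨M, l, hl, h', h1, h2, h3⟩
      · exact Or.inl (hJsup ⟨φ.strictMono h, φ.strictMono h'⟩)

end Track

end Matching

section Lines

lemma nonempty_homeomorph_Ici_Ico (m : ℝ) : Nonempty (Set.Ici m ≃ₜ Set.Ico (0 : ℝ) 1) := by
  have hpos : ∀ x : Set.Ici m, 0 < 1 + ((x : ℝ) - m) := fun x => by
    have : m ≤ x := x.2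
    linarith
  have hpos' : ∀ y : Set.Ico (0 : ℝ) 1, 0 < 1 - (y : ℝ) := fun y => sub_pos.2 y.2.2
  refine ⟨⟨⟨fun x => ⟨(x - m) / (1 + (x - m)), ?_, ?_⟩, fun y => ⟨m + y / (1 - y), ?_⟩,
    fun x => ?_, fun y => ?_⟩, ?_, ?_⟩⟩
  · exact div_nonneg (sub_nonneg.2 x.2) (hpos x).le
  · rw [div_lt_one (hpos x)]
    linarith
  · have := div_nonneg y.2.1 (hpos' y).le
    simp only [Set.mem_Ici]
    linarith
  · have := (hpos x).ne'
    refine Subtype.ext ?_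
    field_simp
    ring
  · have := (hpos' y).ne'
    refine Subtype.ext ?_
    field_simp
    ring
  · exact ((continuous_subtype_val.sub continuous_const).div₀ (by fun_prop)
      fun x => (hpos x).ne').subtype_mk _
  · exact (continuous_const.add (continuous_subtype_val.div₀ (by fun_prop)
      fun x => (hpos' x).ne')).subtype_mk _

lemma nonempty_homeomorph_real_Ioo : Nonempty (ℝ ≃ₜ Set.Ioo (0 : ℝ) 1) := by
  have : (Set.range Real.sigmoid).OrdConnected := by
    rw [Real.range_sigmoid]
    exact Set.ordConnected_Ioo
  exact ⟨(Real.sigmoid_strictMono.orderIso _).toHomeomorph.trans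
    (Homeomorph.setCongr Real.range_sigmoid)⟩

end Lines

section Classification

variable {V : Type*} {G : SimpleGraph V}

namespace Track

section Compact

variable {m M : ℤ} {w : ℤ → V}

lemma inner_Icc {a : ℤ} : IsInner (Set.Icc m M) a ↔ m < a ∧ a < M := by
  simp only [IsInner, Set.mem_Icc]
  omega

lemma lt_of_Icc (T : Track G (Set.Icc m M) w) : m < M := by
  obtain ⟨k, h1, h2⟩ := T.exists_edge
  have := h1.1
  have := h2.2
  omega

lemma eq_of_mem_Ioo {φ : ℝ ≃o ℝ} (T : Track G (Set.Icc m M) w) :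
    ∀ k ∈ Set.Icc m M, ∀ l ∈ Set.Icc m M, φ k ∈ Set.Ioo (φ m) (φ M) →
      φ l ∈ Set.Ioo (φ m) (φ M) → w k = w l → k = l := by
  intro k _ l _ hk hl h
  simp only [Set.mem_Ioo, OrderIso.lt_iff_lt, Int.cast_lt] at hk hl
  exact T.inj k l (inner_Icc.2 hk) (inner_Icc.2 hl) h

lemma eq_of_mem_Ioc {φ : ℝ ≃o ℝ} (T : Track G (Set.Icc m M) w)
    (hM : Unglued (Set.Icc m M) w M) :
    ∀ k ∈ Set.Icc m M, ∀ l ∈ Set.Icc m M, φ k ∈ Set.Ioc (φ m) (φ M) →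
      φ l ∈ Set.Ioc (φ m) (φ M) → w k = w l → k = l := by
  intro k hk' l hl' hk hl h
  simp only [Set.mem_Ioc, OrderIso.lt_iff_lt, OrderIso.le_iff_le, Int.cast_lt,
    Int.cast_le] at hk hl
  rcases hk.2.lt_or_eq with hk2 | rfl
  · rcases hl.2.lt_or_eq with hl2 | rfl
    · exact T.inj k l (inner_Icc.2 ⟨hk.1, hk2⟩) (inner_Icc.2 ⟨hl.1, hl2⟩) h
    · exact hM k (inner_Icc.2 ⟨hk.1, hk2⟩) h
  · rcases hl.2.lt_or_eq with hl2 | rfl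
    · exact (hM l (inner_Icc.2 ⟨hl.1, hl2⟩) h.symm).symm
    · rfl

lemma nonempty_homeomorph_circle (T : Track G (Set.Icc m M) w)
    (hv : ∀ v, ∃ k ∈ Set.Icc m M, w k = v) (he : ∀ v u, G.Adj v u → OnTrack (Set.Icc m M) w v u)
    (hmM : w m = w M) (hM : Unglued (Set.Icc m M) w M) :
    Nonempty (GraphRealization G ≃ₜ unitCircleSet) := by
  have hlt : (m : ℝ) < M := by exact_mod_cast T.lt_of_Icc
  obtain ⟨φ, h0, h1, -, -⟩ := OrderIso.exists_four_points hlt (lt_add_one _) (lt_add_one _)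
  obtain ⟨g, hg, hY, hJ, hg01⟩ := exists_circle_curve
  rw [← h0, ← h1] at hY hJ hg01
  have hMmem : φ M ∈ Set.Ioc (φ m) (φ M) := ⟨φ.strictMono hlt, le_rfl⟩
  have hM' : M ∈ Set.Icc m M := ⟨T.lt_of_Icc.le, le_rfl⟩
  exact T.nonempty_homeomorph_of_compact_curve hv he φ hg hY hJ Set.Ioc_subset_Icc_self
    Set.Ioo_subset_Ioc_self ⟨M, hM', hMmem, hmM.symm, hg01.symm⟩ ⟨M, hM', hMmem, rfl, rfl⟩
    (T.eq_of_mem_Ioc hM)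

lemma nonempty_homeomorph_lollipop (T : Track G (Set.Icc m M) w)
    (hv : ∀ v, ∃ k ∈ Set.Icc m M, w k = v) (he : ∀ v u, G.Adj v u → OnTrack (Set.Icc m M) w v u)
    {a : ℤ} (ha : IsInner (Set.Icc m M) a) (hma : w a = w m) (hM : Unglued (Set.Icc m M) w M) :
    Nonempty (GraphRealization G ≃ₜ lollipopSet) := by
  have ha' := inner_Icc.1 ha
  have hlt : (m : ℝ) < a := by exact_mod_cast ha'.1
  have hlt' : (a : ℝ) < M := by exact_mod_cast ha'.2
  obtain ⟨φ, h0, h1, h2, -⟩ := OrderIso.exists_four_points hlt hlt' (lt_add_one _)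
  obtain ⟨g, hg, hY, hJ, hg01⟩ := exists_lollipop_curve
  rw [← h0, ← h1] at hg01
  rw [← h0, ← h2] at hY hJ
  exact T.nonempty_homeomorph_of_compact_curve hv he φ hg hY hJ Set.Ioc_subset_Icc_self
    Set.Ioo_subset_Ioc_self
    ⟨a, T.mem_of_inner ha, ⟨φ.strictMono hlt, φ.monotone hlt'.le⟩, hma, hg01.symm⟩
    ⟨M, ⟨T.lt_of_Icc.le, le_rfl⟩, ⟨φ.strictMono (hlt.trans hlt'), le_rfl⟩, rfl, rfl⟩
    (T.eq_of_mem_Ioc hM)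

lemma nonempty_homeomorph_figureEight (T : Track G (Set.Icc m M) w)
    (hv : ∀ v, ∃ k ∈ Set.Icc m M, w k = v) (he : ∀ v u, G.Adj v u → OnTrack (Set.Icc m M) w v u)
    {a : ℤ} (ha : IsInner (Set.Icc m M) a) (hma : w a = w m) (hMa : w a = w M) :
    Nonempty (GraphRealization G ≃ₜ figureEightSet) := by
  have ha' := inner_Icc.1 ha
  have hlt : (m : ℝ) < a := by exact_mod_cast ha'.1
  have hlt' : (a : ℝ) < M := by exact_mod_cast ha'.2
  obtain ⟨φ, h0, h1, h2, -⟩ := OrderIso.exists_four_points hlt hlt' (lt_add_one _)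
  obtain ⟨g, hg, hY, hJ, hg01, hg21⟩ := exists_figureEight_curve
  rw [← h0, ← h1] at hg01
  rw [← h1, ← h2] at hg21
  rw [← h0, ← h2] at hY hJ
  have hmem : φ a ∈ Set.Ioo (φ m) (φ M) := ⟨φ.strictMono hlt, φ.strictMono hlt'⟩
  exact T.nonempty_homeomorph_of_compact_curve hv he φ hg hY hJ Set.Ioo_subset_Icc_self
    subset_rfl ⟨a, T.mem_of_inner ha, hmem, hma, hg01.symm⟩
    ⟨a, T.mem_of_inner ha, hmem, hMa, hg21.symm⟩ T.eq_of_mem_Ioo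

lemma nonempty_homeomorph_dumbbell (T : Track G (Set.Icc m M) w)
    (hv : ∀ v, ∃ k ∈ Set.Icc m M, w k = v) (he : ∀ v u, G.Adj v u → OnTrack (Set.Icc m M) w v u)
    {a b : ℤ} (ha : IsInner (Set.Icc m M) a) (hma : w a = w m) (hb : IsInner (Set.Icc m M) b)
    (hMb : w b = w M) (hab : a < b) : Nonempty (GraphRealization G ≃ₜ dumbbellSet) := by
  have hlt : (m : ℝ) < a := by exact_mod_cast (inner_Icc.1 ha).1
  have hlt' : (a : ℝ) < b := by exact_mod_cast hab
  have hlt'' : (b : ℝ) < M := by exact_mod_cast (inner_Icc.1 hb).2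
  obtain ⟨φ, h0, h1, h2, h3⟩ := OrderIso.exists_four_points hlt hlt' hlt''
  obtain ⟨g, hg, hY, hJ, hg01, hg32⟩ := exists_dumbbell_curve
  rw [← h0, ← h1] at hg01
  rw [← h2, ← h3] at hg32
  rw [← h0, ← h3] at hY hJ
  exact T.nonempty_homeomorph_of_compact_curve hv he φ hg hY hJ Set.Ioo_subset_Icc_self
    subset_rfl
    ⟨a, T.mem_of_inner ha, ⟨φ.strictMono hlt, φ.strictMono (hlt'.trans hlt'')⟩, hma, hg01.symm⟩
    ⟨b, T.mem_of_inner hb, ⟨φ.strictMono (hlt.trans hlt'), φ.strictMono hlt''⟩, hMb, hg32.symm⟩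
    T.eq_of_mem_Ioo

lemma nonempty_homeomorph_theta (T : Track G (Set.Icc m M) w)
    (hv : ∀ v, ∃ k ∈ Set.Icc m M, w k = v) (he : ∀ v u, G.Adj v u → OnTrack (Set.Icc m M) w v u)
    {a b : ℤ} (ha : IsInner (Set.Icc m M) a) (hma : w a = w m) (hb : IsInner (Set.Icc m M) b)
    (hMb : w b = w M) (hba : b < a) : Nonempty (GraphRealization G ≃ₜ thetaSet) := by
  have hlt : (m : ℝ) < b := by exact_mod_cast (inner_Icc.1 hb).1
  have hlt' : (b : ℝ) < a := by exact_mod_cast hba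
  have hlt'' : (a : ℝ) < M := by exact_mod_cast (inner_Icc.1 ha).2
  obtain ⟨φ, h0, h1, h2, h3⟩ := OrderIso.exists_four_points hlt hlt' hlt''
  obtain ⟨g, hg, hY, hJ, hg02, hg31⟩ := exists_theta_curve
  rw [← h0, ← h2] at hg02
  rw [← h1, ← h3] at hg31
  rw [← h0, ← h3] at hY hJ
  exact T.nonempty_homeomorph_of_compact_curve hv he φ hg hY hJ Set.Ioo_subset_Icc_self
    subset_rfl
    ⟨a, T.mem_of_inner ha, ⟨φ.strictMono (hlt.trans hlt'), φ.strictMono hlt''⟩, hma, hg02.symm⟩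
    ⟨b, T.mem_of_inner hb, ⟨φ.strictMono hlt, φ.strictMono (hlt'.trans hlt'')⟩, hMb, hg31.symm⟩
    T.eq_of_mem_Ioo

lemma nonempty_homeomorph_Icc (T : Track G (Set.Icc m M) w)
    (hv : ∀ v, ∃ k ∈ Set.Icc m M, w k = v) (he : ∀ v u, G.Adj v u → OnTrack (Set.Icc m M) w v u)
    (hm : Unglued (Set.Icc m M) w m) (hM : Unglued (Set.Icc m M) w M)
    (hleaf : ∀ u, G.Adj (w m) u → u = w (m + 1)) :
    Nonempty (GraphRealization G ≃ₜ Set.Icc (0 : ℝ) 1) := by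
  have hlt := T.lt_of_Icc
  have hlt' : (m : ℝ) < M := by exact_mod_cast hlt
  have hne : w m ≠ w M := by
    intro h
    have hadj := T.adj (M - 1) ⟨by omega, by omega⟩ ⟨by omega, by omega⟩
    rw [sub_add_cancel] at hadj
    have h1 := hleaf _ (h ▸ hadj.symm)
    have h2 := T.edge_inj m (M - 1) ⟨by omega, by omega⟩ ⟨by omega, by omega⟩
      ⟨by omega, by omega⟩ ⟨by omega, by omega⟩ (by rw [sub_add_cancel, h, ← h1, Sym2.eq_swap])
    rw [← h2] at hadj
    exact hadj.ne h
  have hw : Set.InjOn w (Set.Icc m M) := by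
    have key : ∀ k ∈ Set.Icc m M, w m = w k → m = k := by
      intro k hk h
      rcases hk.1.eq_or_lt with rfl | h1
      · rfl
      · rcases hk.2.eq_or_lt with rfl | h2
        · exact (hne h).elim
        · exact (hm k (inner_Icc.2 ⟨h1, h2⟩) h.symm).symm
    intro k hk l hl h
    rcases hk.1.eq_or_lt with rfl | h1
    · exact key l hl h
    rcases hl.1.eq_or_lt with rfl | h2
    · exact (key k hk h.symm).symm
    have h1' : (m : ℝ) < k := by exact_mod_cast h1
    have h2' : (m : ℝ) < l := by exact_mod_cast h2
    have h3' : (k : ℝ) ≤ M := by exact_mod_cast hk.2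
    have h4' : (l : ℝ) ≤ M := by exact_mod_cast hl.2
    exact T.eq_of_mem_Ioc (φ := OrderIso.refl ℝ) hM k hk l hl ⟨h1', h3'⟩ ⟨h2', h4'⟩ h
  exact T.nonempty_homeomorph_of_injOn hv he (hull_Icc m M ▸ isClosed_Icc)
    ((Homeomorph.setCongr (hull_Icc m M)).trans (iccHomeoI _ _ hlt')) hw

end Compact

section Infinite

variable {m : ℤ} {w : ℤ → V}

lemma inner_Ici {a : ℤ} : IsInner (Set.Ici m) a ↔ m < a := by
  simp only [IsInner, Set.mem_Ici]
  omega

lemma nonempty_homeomorph_Ico (T : Track G (Set.Ici m) w)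
    (hv : ∀ v, ∃ k ∈ Set.Ici m, w k = v) (he : ∀ v u, G.Adj v u → OnTrack (Set.Ici m) w v u)
    (hm : Unglued (Set.Ici m) w m) : Nonempty (GraphRealization G ≃ₜ Set.Ico (0 : ℝ) 1) := by
  have hw : Set.InjOn w (Set.Ici m) := by
    intro k hk l hl h
    rcases (Set.mem_Ici.1 hk).eq_or_lt with rfl | hk'
    · rcases (Set.mem_Ici.1 hl).eq_or_lt with rfl | hl'
      · rfl
      · exact (hm l (inner_Ici.2 hl') h.symm).symm
    · rcases (Set.mem_Ici.1 hl).eq_or_lt with rfl | hl'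
      · exact hm k (inner_Ici.2 hk') h
      · exact T.inj k l (inner_Ici.2 hk') (inner_Ici.2 hl') h
  obtain ⟨e⟩ := nonempty_homeomorph_Ici_Ico m
  exact T.nonempty_homeomorph_of_injOn hv he (hull_Ici m ▸ isClosed_Ici)
    ((Homeomorph.setCongr (hull_Ici m)).trans e) hw

lemma nonempty_homeomorph_Ioo (T : Track G Set.univ w) (hv : ∀ v, ∃ k ∈ Set.univ, w k = v)
    (he : ∀ v u, G.Adj v u → OnTrack Set.univ w v u) :
    Nonempty (GraphRealization G ≃ₜ Set.Ioo (0 : ℝ) 1) := by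
  obtain ⟨e⟩ := nonempty_homeomorph_real_Ioo
  exact T.nonempty_homeomorph_of_injOn hv he (hull_univ ▸ isClosed_univ)
    (((Homeomorph.setCongr hull_univ).trans (Homeomorph.Set.univ ℝ)).trans e)
    fun k _ l _ h => T.inj k l ⟨trivial, trivial⟩ ⟨trivial, trivial⟩ h

lemma nonempty_homeomorph_openLollipop (T : Track G (Set.Ici m) w)
    (hv : ∀ v, ∃ k ∈ Set.Ici m, w k = v) (he : ∀ v u, G.Adj v u → OnTrack (Set.Ici m) w v u)
    {a : ℤ} (ha : IsInner (Set.Ici m) a) (hma : w a = w m) :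
    Nonempty (GraphRealization G ≃ₜ openLollipopSet) := by
  have hlt : (m : ℝ) < a := by exact_mod_cast inner_Ici.1 ha
  obtain ⟨φ, h0, h1, -, -⟩ := OrderIso.exists_four_points hlt (lt_add_one _) (lt_add_one _)
  obtain ⟨g, hg, hY, hJ, hg01, hgx⟩ := exists_openLollipop_curve
  have hpos : ∀ {x : ℝ}, φ x ∈ Set.Ioi 0 ↔ m < x := by
    intro x
    rw [Set.mem_Ioi, ← h0, φ.lt_iff_lt]
  refine T.nonempty_homeomorph_of_curve hv he (hull_Ici m ▸ isClosed_Ici) φ hg hY hJ ?_ ?_ ?_ ?_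
  · intro x hx
    rw [hull_Ici]
    exact (hpos.1 hx).le
  · intro x hx
    rw [hull_Ici] at hx
    rcases (Set.mem_Ici.1 hx).eq_or_lt with h | h
    · exact Or.inr ⟨m, a, T.mem_of_inner ha, h.symm, hpos.2 hlt, hma, by rw [h0, h1, hg01]⟩
    · exact Or.inl (hpos.2 h)
  · intro k _ l _ hk hl h
    rw [hpos, Int.cast_lt] at hk hl
    exact T.inj k l (inner_Ici.2 hk) (inner_Ici.2 hl) h
  · intro y hy
    have hy2 : y.1 < 2 := by
      rw [← hY] at hy
      obtain ⟨t, ht, rfl⟩ := hy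
      rcases le_or_gt 1 t with h | h
      · rw [hgx t h]
        have : 0 < 1 / t := by positivity
        linarith
      · have hmem : g t ∈ openLollipopSet := hY ▸ ⟨t, ht, rfl⟩
        rcases hmem.1 with h' | h'
        · simp only [circleAt, Set.mem_ofPred_eq] at h'
          nlinarith
        · refine h'.2.2.lt_of_ne fun e => hmem.2 (Prod.ext e h'.1)
    obtain ⟨c, hc1, hc2⟩ := exists_between hy2
    refine ⟨{p | p.1 < c}, (isOpen_lt continuous_fst continuous_const).mem_nhds hc1,
      Set.Icc m (φ.symm (max 1 (1 / (2 - c)))), isCompact_Icc, fun x hx hxc => ?_⟩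
    rw [hull_Ici] at hx
    refine ⟨hx, φ.le_symm_apply.2 ?_⟩
    rcases le_total 1 (φ x) with h | h
    · refine le_max_of_le_right ?_
      rw [Set.mem_ofPred_eq, hgx _ h] at hxc
      have h2 : 0 < φ x := by linarith
      rw [le_div_iff₀ (by linarith)]
      have h3 : 2 - c < 1 / φ x := by linarith
      rw [lt_div_iff₀ h2] at h3
      linarith
    · exact le_max_of_le_left h

end Infinite

end Track

end Classification

section Shapes

variable {V : Type*} {G : SimpleGraph V} {I : Set ℤ} {w : ℤ → V}

lemma neg_neg_mem_eq (I : Set ℤ) : {k | -k ∈ {k | -k ∈ I}} = I := by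
  ext
  simp

lemma succ_mem_reverse (h : ∀ k ∈ I, k - 1 ∈ I) : ∀ k ∈ {k | -k ∈ I}, k + 1 ∈ {k | -k ∈ I} := by
  intro k hk
  have := h _ hk
  rwa [← neg_add'] at this

lemma leftOpen_reverse (h : RightOpen G I w) : LeftOpen G {k | -k ∈ I} (fun k => w (-k)) :=
  Track.leftOpen_of_reverse (by simpa only [neg_neg_mem_eq, neg_neg] using h)

lemma gluedLeft_reverse (h : GluedRight I w) : GluedLeft {k | -k ∈ I} (fun k => w (-k)) := by
  obtain ⟨M, hM, hM1, a, ha, haw⟩ := h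
  refine ⟨-M, by simpa using hM, ?_, -a, inner_reverse.2 (by rwa [neg_neg]),
    by simpa using haw⟩
  have e : -(-M - 1) = M + 1 := by ring
  rwa [Set.mem_ofPred_eq, e]

lemma exists_reverse_eq (hv : ∀ v, ∃ k ∈ I, w k = v) (v : V) :
    ∃ k ∈ {k | -k ∈ I}, w (-k) = v := by
  obtain ⟨k, hk, rfl⟩ := hv v
  exact ⟨-k, by simpa using hk, by rw [neg_neg]⟩

lemma onTrack_reverse {v u : V} (h : OnTrack I w v u) :
    OnTrack {k | -k ∈ I} (fun k => w (-k)) v u := by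
  obtain ⟨k, hk, hk', h⟩ := h
  have e : -(-(k + 1) + 1) = k := by ring
  refine ⟨-(k + 1), by simpa using hk', by rwa [Set.mem_ofPred_eq, e], ?_⟩
  simp only [e, neg_neg]
  rw [Sym2.eq_swap, h]

namespace Track

lemma eq_Icc (T : Track G I w) {m M : ℤ} (hm : m ∈ I) (hm1 : m - 1 ∉ I) (hM : M ∈ I)
    (hM1 : M + 1 ∉ I) : I = Set.Icc m M :=
  Set.Subset.antisymm (fun _ hk => ⟨T.ge_of_mem hk hm hm1, T.le_of_mem hk hM hM1⟩)
    (T.ord.out hm hM)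

lemma Ici_subset_of_succ_mem {m : ℤ} (hm : m ∈ I) (h : ∀ k ∈ I, k + 1 ∈ I) : Set.Ici m ⊆ I :=
  fun k hk => Int.leInduction (m := m) (motive := fun k _ => k ∈ I) hm (fun k _ => h k) k hk

lemma eq_Ici (T : Track G I w) {m : ℤ} (hm : m ∈ I) (hm1 : m - 1 ∉ I) (h : ∀ k ∈ I, k + 1 ∈ I) :
    I = Set.Ici m :=
  Set.Subset.antisymm (fun _ hk => T.ge_of_mem hk hm hm1) (Ici_subset_of_succ_mem hm h)

lemma eq_univ (T : Track G I w) (h : ∀ k ∈ I, k + 1 ∈ I) (h' : ∀ k ∈ I, k - 1 ∈ I) :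
    I = Set.univ := by
  obtain ⟨m, hm, -⟩ := T.exists_edge
  refine Set.eq_univ_of_forall fun k => ?_
  rcases le_total m k with hk | hk
  · exact Ici_subset_of_succ_mem hm h hk
  · have := Ici_subset_of_succ_mem (I := {k | -k ∈ I}) (m := -m) (by simpa using hm)
      (succ_mem_reverse h') (neg_le_neg hk)
    simpa using this

lemma classification_of_infinite (T : Track G I w) (hv : ∀ v, ∃ k ∈ I, w k = v)
    (he : ∀ v u, G.Adj v u → OnTrack I w v u) (hl : LeftOpen G I w ∨ GluedLeft I w)
    (hr : ∀ k ∈ I, k + 1 ∈ I) :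
    Nonempty (GraphRealization G ≃ₜ Set.Ico (0 : ℝ) 1) ∨
      Nonempty (GraphRealization G ≃ₜ Set.Ioo (0 : ℝ) 1) ∨
      Nonempty (GraphRealization G ≃ₜ openLollipopSet) := by
  rcases hl with (hl | ⟨m, hm, hm1, hu, -⟩) | ⟨m, hm, hm1, a, ha, haw⟩
  · obtain rfl := T.eq_univ hr hl
    exact Or.inr (Or.inl (T.nonempty_homeomorph_Ioo hv he))
  · obtain rfl := T.eq_Ici hm hm1 hr
    exact Or.inl (T.nonempty_homeomorph_Ico hv he hu)
  · obtain rfl := T.eq_Ici hm hm1 hr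
    exact Or.inr (Or.inr (T.nonempty_homeomorph_openLollipop hv he ha haw))

lemma nonempty_homeomorph_lollipop_of_gluedLeft (T : Track G I w) (hv : ∀ v, ∃ k ∈ I, w k = v)
    (he : ∀ v u, G.Adj v u → OnTrack I w v u) (hl : GluedLeft I w) {M : ℤ} (hM : M ∈ I)
    (hM1 : M + 1 ∉ I) (hu : Unglued I w M) : Nonempty (GraphRealization G ≃ₜ lollipopSet) := by
  obtain ⟨m, hm, hm1, a, ha, haw⟩ := hl
  obtain rfl := T.eq_Icc hm hm1 hM hM1
  exact T.nonempty_homeomorph_lollipop hv he ha haw hu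

end Track

/-- The realization of a 7-arc connected graph is homeomorphic to one of nine spaces. -/
lemma NArcConn.classification (hG : NArcConn ↥(GraphRealization G) 7)
    (hnt : Nontrivial ↥(GraphRealization G)) :
    Nonempty (GraphRealization G ≃ₜ Set.Icc (0 : ℝ) 1) ∨
      Nonempty (GraphRealization G ≃ₜ Set.Ico (0 : ℝ) 1) ∨
      Nonempty (GraphRealization G ≃ₜ Set.Ioo (0 : ℝ) 1) ∨
      Nonempty (GraphRealization G ≃ₜ unitCircleSet) ∨
      Nonempty (GraphRealization G ≃ₜ thetaSet) ∨
      Nonempty (GraphRealization G ≃ₜ figureEightSet) ∨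
      Nonempty (GraphRealization G ≃ₜ lollipopSet) ∨
      Nonempty (GraphRealization G ≃ₜ openLollipopSet) ∨
      Nonempty (GraphRealization G ≃ₜ dumbbellSet) := by
  obtain ⟨I, w, T, hv, he, ⟨m, M, -, rfl, hw, hu⟩ | ⟨hl, hr⟩⟩ := hG.exists_track hnt
  · have := T.nonempty_homeomorph_circle hv he hw hu
    tauto
  have hv' := exists_reverse_eq hv
  have he' : ∀ v u, G.Adj v u → OnTrack {k | -k ∈ I} (fun k => w (-k)) v u :=
    fun v u h => onTrack_reverse (he v u h)
  rcases hr with (hr | ⟨M, hM, hM1, hMu, hMl⟩) | hr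
  · have := T.classification_of_infinite hv he hl hr
    tauto
  · rcases hl with (hl | ⟨m, hm, hm1, hmu, hleaf⟩) | hl
    · have := T.reverse.classification_of_infinite hv' he'
        (Or.inl (leftOpen_reverse (Or.inr ⟨M, hM, hM1, hMu, hMl⟩)))
        (succ_mem_reverse hl)
      tauto
    · obtain rfl := T.eq_Icc hm hm1 hM hM1
      exact Or.inl (T.nonempty_homeomorph_Icc hv he hmu hMu hleaf)
    · have := T.nonempty_homeomorph_lollipop_of_gluedLeft hv he hl hM hM1 hMu
      tauto
  · rcases hl with (hl | ⟨m, hm, hm1, hmu, -⟩) | ⟨m, hm, hm1, a, ha, haw⟩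
    · have := T.reverse.classification_of_infinite hv' he' (Or.inr (gluedLeft_reverse hr))
        (succ_mem_reverse hl)
      tauto
    · have e : -(-m + 1) = m - 1 := by ring
      have := T.reverse.nonempty_homeomorph_lollipop_of_gluedLeft hv' he' (gluedLeft_reverse hr)
        (M := -m) (by simpa using hm) (by rwa [Set.mem_ofPred_eq, e])
        (unglued_reverse.2 (by rwa [neg_neg]))
      tauto
    · obtain ⟨M, hM, hM1, b, hb, hbw⟩ := hr
      obtain rfl := T.eq_Icc hm hm1 hM hM1
      rcases lt_trichotomy a b with h | rfl | h
      · have := T.nonempty_homeomorph_dumbbell hv he ha haw hb hbw h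
        tauto
      · have := T.nonempty_homeomorph_figureEight hv he ha haw hbw
        tauto
      · have := T.nonempty_homeomorph_theta hv he ha haw hb hbw h
        tauto

end Shapes

section Models

/-- Each of the nine spaces is `n`-arc connected for all `n`. -/
lemma nArcConn_models (n : ℕ) :
    NArcConn (Set.Icc (0 : ℝ) 1) n ∧ NArcConn (Set.Ico (0 : ℝ) 1) n ∧
      NArcConn (Set.Ioo (0 : ℝ) 1) n ∧ NArcConn unitCircleSet n ∧ NArcConn thetaSet n ∧
      NArcConn figureEightSet n ∧ NArcConn lollipopSet n ∧ NArcConn openLollipopSet n ∧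
      NArcConn dumbbellSet n := by
  have line : ∀ J : Set ℝ, J.OrdConnected → Set.Ioo 0 1 ⊆ J → NArcConn J n := by
    intro J hJ h
    have := nArcConn_image hJ (p := 1 / 3) (q := 1 / 2) (h (by norm_num)) (h (by norm_num))
      (by norm_num) continuousOn_id (Set.injOn_id J) n
    rwa [Set.image_id] at this
  have curve : ∀ {g : ℝ → ℝ × ℝ} {J : Set ℝ} {Y : Set (ℝ × ℝ)}, Continuous g → g '' J = Y →
      Set.InjOn g J → J.OrdConnected → Set.Ioo 0 1 ⊆ J → NArcConn Y n := by
    intro g J Y hg hY hi hJ h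
    rw [← hY]
    exact nArcConn_image hJ (p := 1 / 3) (q := 1 / 2) (h (by norm_num)) (h (by norm_num))
      (by norm_num) hg.continuousOn hi n
  obtain ⟨g₁, h₁, i₁, j₁, -⟩ := exists_circle_curve
  obtain ⟨g₂, h₂, i₂, j₂, -⟩ := exists_theta_curve
  obtain ⟨g₃, h₃, i₃, j₃, -⟩ := exists_figureEight_curve
  obtain ⟨g₄, h₄, i₄, j₄, -⟩ := exists_lollipop_curve
  obtain ⟨g₅, h₅, i₅, j₅, -⟩ := exists_openLollipop_curve
  obtain ⟨g₆, h₆, i₆, j₆, -⟩ := exists_dumbbell_curve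
  exact ⟨line _ Set.ordConnected_Icc Set.Ioo_subset_Icc_self,
    line _ Set.ordConnected_Ico Set.Ioo_subset_Ico_self,
    line _ Set.ordConnected_Ioo subset_rfl,
    curve h₁ i₁ j₁ Set.ordConnected_Ioc Set.Ioo_subset_Ioc_self,
    curve h₂ i₂ j₂ Set.ordConnected_Ioo (Set.Ioo_subset_Ioo_right (by norm_num)),
    curve h₃ i₃ j₃ Set.ordConnected_Ioo (Set.Ioo_subset_Ioo_right (by norm_num)),
    curve h₄ i₄ j₄ Set.ordConnected_Ioc
      ((Set.Ioo_subset_Ioo_right one_le_two).trans Set.Ioo_subset_Ioc_self),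
    curve h₅ i₅ j₅ Set.ordConnected_Ioi Set.Ioo_subset_Ioi_self,
    curve h₆ i₆ j₆ Set.ordConnected_Ioo (Set.Ioo_subset_Ioo_right (by norm_num))⟩

end Models

/-- For a graph `G` whose realization has at least two points, the
following are equivalent: (a) `|G|` is 7-arc connected; (b) `|G|` is `n`-arc connected
for every `n`; (c) `|G|` is homeomorphic to one of the nine spaces: `[0,1]`, `[0,1)`,
`(0,1)`, the circle, the θ-curve, the figure-eight, the lollipop, the lollipop minus
its free endpoint, or the dumbbell. -/
theorem statement17 {V : Type*} (G : SimpleGraph V)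
    (hnt : Nontrivial ↥(GraphRealization G)) :
    List.TFAE [
      NArcConn ↥(GraphRealization G) 7,
      ∀ n : ℕ, NArcConn ↥(GraphRealization G) n,
      Nonempty (↥(GraphRealization G) ≃ₜ ↥(Set.Icc (0 : ℝ) 1)) ∨
      Nonempty (↥(GraphRealization G) ≃ₜ ↥(Set.Ico (0 : ℝ) 1)) ∨
      Nonempty (↥(GraphRealization G) ≃ₜ ↥(Set.Ioo (0 : ℝ) 1)) ∨
      Nonempty (↥(GraphRealization G) ≃ₜ ↥unitCircleSet) ∨
      Nonempty (↥(GraphRealization G) ≃ₜ ↥thetaSet) ∨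
      Nonempty (↥(GraphRealization G) ≃ₜ ↥figureEightSet) ∨
      Nonempty (↥(GraphRealization G) ≃ₜ ↥lollipopSet) ∨
      Nonempty (↥(GraphRealization G) ≃ₜ ↥openLollipopSet) ∨
      Nonempty (↥(GraphRealization G) ≃ₜ ↥dumbbellSet)] := by
  tfae_have 1 → 3 := fun h => h.classification hnt
  tfae_have 3 → 2 := by
    intro h n
    obtain ⟨h₁, h₂, h₃, h₄, h₅, h₆, h₇, h₈, h₉⟩ := nArcConn_models n
    rcases h with ⟨⟨e⟩⟩ | ⟨⟨e⟩⟩ | ⟨⟨e⟩⟩ | ⟨⟨e⟩⟩ | ⟨⟨e⟩⟩ | ⟨⟨e⟩⟩ | ⟨⟨e⟩⟩ | ⟨⟨e⟩⟩ | ⟨⟨e⟩⟩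
    exacts [h₁.of_homeomorph e, h₂.of_homeomorph e, h₃.of_homeomorph e, h₄.of_homeomorph e,
      h₅.of_homeomorph e, h₆.of_homeomorph e, h₇.of_homeomorph e, h₈.of_homeomorph e,
      h₉.of_homeomorph e]
  tfae_have 2 → 1 := fun h => h 7
  tfae_finish
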